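/- Let 𝕜 be an algebraically closed field of arbitrary characteristic, k ≥ 1 an integer, n_1, …, n_k and d_1, …, d_k positive integers, and b_1, …, b_k integers. Set b := min{b_1, …, b_k} and d := min{d_1, …, d_k}, and assume d + b ≥ 0. Then for every integer q with 2 ≤ q ≤ n_1 + ⋯ + n_k + 1 and every integer p with 0 ≤ p and n_1!⋯n_k!·p ≤ d^{q−1} + b·d^{q−2}, the Koszul cohomology group K_{p,q}(X, B; L) vanishes, where X = ℙ^{n_1} × ⋯ × ℙ^{n_k}, B = O(b_1, …, b_k) and L = O(d_1, …, d_k); concretely, the Koszul-type complex ⋀^{p+1}V ⊗ R_{q−1} → ⋀^{p}V ⊗ R_q → ⋀^{p−1}V ⊗ R_{q+1} is exact at the middle term, i.e. the image of δ_{p+1,q−1} equals the kernel of δ_{p,q}. -/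

import Mathlib

/-!
Asymptotic vanishing of syzygies of products of projective spaces
(Ein–Lazarsfeld's conjecture; Theorem for `X = ℙ^{n_1} × ⋯ × ℙ^{n_k}`,
`B = O(b_1,…,b_k)`, `L = O(d_1,…,d_k)`).
-/

open MvPolynomial TensorProduct

noncomputable section

/-- The family `v : Fin p → α` with its `i`-th entry omitted. -/
def omitFun {α : Type*} {p : ℕ} (v : Fin p → α) (i : Fin p) : Fin (p - 1) → α := fun j =>
  if (j : ℕ) < (i : ℕ) then v ⟨j, lt_of_lt_of_le j.isLt (Nat.sub_le p 1)⟩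
  else v ⟨(j : ℕ) + 1, Nat.add_lt_of_lt_sub j.isLt⟩

/-- The multihomogeneous component of multidegree `c` of a (multi)graded polynomial ring,
where the variable `x` has multidegree `w x`.  It is `0` if `c` is not attained (e.g. if a
coordinate of `c` is negative). -/
def component (𝕜 : Type*) [Field 𝕜] {σ M : Type*} [AddCommMonoid M] (w : σ → M) (c : M) :
    Submodule 𝕜 (MvPolynomial σ 𝕜) :=
  weightedHomogeneousSubmodule 𝕜 w c

/-- Multiplication `T_{c₁} × T_{c₂} → T_{c₃}` between multihomogeneous components,
when `c₁ + c₂ = c₃`. -/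
def componentMul (𝕜 : Type*) [Field 𝕜] {σ M : Type*} [AddCommMonoid M] (w : σ → M)
    {c₁ c₂ c₃ : M} (h : c₁ + c₂ = c₃)
    (v : component 𝕜 w c₁) (f : component 𝕜 w c₂) : component 𝕜 w c₃ :=
  ⟨(v : MvPolynomial σ 𝕜) * (f : MvPolynomial σ 𝕜), by
    have hv : IsWeightedHomogeneous w (v : MvPolynomial σ 𝕜) c₁ :=
      (mem_weightedHomogeneousSubmodule _ _ _ _).1 v.2
    have hf : IsWeightedHomogeneous w (f : MvPolynomial σ 𝕜) c₂ :=
      (mem_weightedHomogeneousSubmodule _ _ _ _).1 f.2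
    exact (mem_weightedHomogeneousSubmodule _ _ _ _).2 (h ▸ hv.mul hf)⟩

/-- The element `v 0 ∧ v 1 ∧ ⋯ ∧ v (p-1)` of the `p`-th exterior power `⋀^p M`. -/
def wedge (𝕜 : Type*) [Field 𝕜] {M : Type*} [AddCommGroup M] [Module 𝕜 M] (p : ℕ)
    (v : Fin p → M) : ⋀[𝕜]^p M :=
  ⟨ExteriorAlgebra.ιMulti 𝕜 p v, ExteriorAlgebra.ιMulti_range 𝕜 p (Set.mem_range_self v)⟩

section Koszul

variable {𝕜 V A : Type*} [Field 𝕜] [AddCommGroup V] [Module 𝕜 V] [CommRing A] [Algebra 𝕜 A]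

/-- A vector, as an element of exterior degree one of `⋀ V ⊗ A`. -/
def vec (𝕜 : Type*) {V : Type*} (A : Type*) [Field 𝕜] [AddCommGroup V] [Module 𝕜 V] [CommRing A]
    [Algebra 𝕜 A] : V →ₗ[𝕜] ExteriorAlgebra 𝕜 V ⊗[𝕜] A :=
  (Algebra.TensorProduct.includeLeft : _ →ₐ[𝕜] ExteriorAlgebra 𝕜 V ⊗[𝕜] A).toLinearMap ∘ₗ
    ExteriorAlgebra.ι 𝕜

/-- A scalar, as an element of exterior degree zero of `⋀ V ⊗ A`. -/
def scal (𝕜 V : Type*) {A : Type*} [Field 𝕜] [AddCommGroup V] [Module 𝕜 V] [CommRing A]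
    [Algebra 𝕜 A] : A →ₐ[𝕜] ExteriorAlgebra 𝕜 V ⊗[𝕜] A :=
  Algebra.TensorProduct.includeRight

theorem vec_mul_self (v : V) : vec 𝕜 A v * vec 𝕜 A v = 0 := by
  simp [vec]

theorem vec_mul_vec (u v : V) : vec 𝕜 A u * vec 𝕜 A v = -(vec 𝕜 A v * vec 𝕜 A u) := by
  have h := vec_mul_self (𝕜 := 𝕜) (A := A) (u + v)
  simp only [map_add, mul_add, add_mul, vec_mul_self, zero_add, add_zero] at h
  exact eq_neg_of_add_eq_zero_right h

theorem scal_mul_comm (a : A) (x : ExteriorAlgebra 𝕜 V ⊗[𝕜] A) :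
    scal 𝕜 V a * x = x * scal 𝕜 V a := by
  induction x with
  | zero => simp
  | add x y hx hy => rw [mul_add, add_mul, hx, hy]
  | tmul x b => simp [scal, mul_comm]

/-- Induction on `⋀ V ⊗ A`, multiplying by vectors from the left. -/
theorem vec_scal_induction {motive : ExteriorAlgebra 𝕜 V ⊗[𝕜] A → Prop}
    (scal_mem : ∀ a, motive (scal 𝕜 V a)) (add : ∀ x y, motive x → motive y → motive (x + y))
    (vec_mul : ∀ v x, motive x → motive (vec 𝕜 A v * x)) (x : ExteriorAlgebra 𝕜 V ⊗[𝕜] A) :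
    motive x := by
  induction x with
  | zero => simpa using scal_mem 0
  | add x y hx hy => exact add _ _ hx hy
  | tmul x a =>
    induction x using CliffordAlgebra.left_induction generalizing a with
    | algebraMap r =>
      have : (algebraMap 𝕜 (CliffordAlgebra (0 : QuadraticForm 𝕜 V)) r) ⊗ₜ[𝕜] a
          = scal 𝕜 V (r • a) := by
        simp [scal, Algebra.algebraMap_eq_smul_one, TensorProduct.smul_tmul]
      exact this ▸ scal_mem _
    | add x y hx hy => rw [TensorProduct.add_tmul]; exact add _ _ (hx a) (hy a)
    | ι_mul x v hx =>
      have : (CliffordAlgebra.ι (0 : QuadraticForm 𝕜 V) v * x) ⊗ₜ[𝕜] a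
          = vec 𝕜 A v * (x ⊗ₜ[𝕜] a) := by
        simp [vec, ExteriorAlgebra.ι]
      rw [this]; exact vec_mul _ _ (hx a)

theorem algHom_ext_vec_scal {B : Type*} [Ring B] [Algebra 𝕜 B]
    {F G : ExteriorAlgebra 𝕜 V ⊗[𝕜] A →ₐ[𝕜] B}
    (hv : ∀ v, F (vec 𝕜 A v) = G (vec 𝕜 A v)) (hs : ∀ a, F (scal 𝕜 V a) = G (scal 𝕜 V a)) :
    F = G := by
  ext x
  · exact hv x
  · exact hs x

/-- The recursion step defining the Koszul differential. -/
def contrStep (f : V →ₗ[𝕜] A) : V →ₗ[𝕜] CliffordAlgebra (0 : QuadraticForm 𝕜 V) ×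
    (ExteriorAlgebra 𝕜 V ⊗[𝕜] A) →ₗ[𝕜] (ExteriorAlgebra 𝕜 V ⊗[𝕜] A) :=
  LinearMap.mk₂ 𝕜 (fun v y => y.1 ⊗ₜ[𝕜] f v - vec 𝕜 A v * y.2)
    (fun _ _ _ => by simp only [map_add, TensorProduct.tmul_add, add_mul]; abel)
    (fun _ _ _ => by simp only [map_smul, TensorProduct.tmul_smul, smul_mul_assoc, smul_sub])
    (fun _ _ _ => by
      simp only [Prod.fst_add, Prod.snd_add, TensorProduct.add_tmul, mul_add]; abel)
    (fun _ _ _ => by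
      simp only [Prod.smul_fst, Prod.smul_snd, TensorProduct.smul_tmul', mul_smul_comm, smul_sub])

theorem contrStep_contrStep (f : V →ₗ[𝕜] A) (v : V)
    (x : CliffordAlgebra (0 : QuadraticForm 𝕜 V)) (y : ExteriorAlgebra 𝕜 V ⊗[𝕜] A) :
    contrStep f v (CliffordAlgebra.ι (0 : QuadraticForm 𝕜 V) v * x, contrStep f v (x, y)) =
      (0 : QuadraticForm 𝕜 V) v • y := by
  simp only [contrStep, LinearMap.mk₂_apply, mul_sub, ← mul_assoc, vec_mul_self, zero_mul, sub_zero]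
  simp [vec, ExteriorAlgebra.ι]

/-- The Koszul differential on `⋀ V ⊗ A` attached to a linear map `f : V → A`. -/
def contr (f : V →ₗ[𝕜] A) : ExteriorAlgebra 𝕜 V ⊗[𝕜] A →ₗ[𝕜] ExteriorAlgebra 𝕜 V ⊗[𝕜] A :=
  TensorProduct.lift ((LinearMap.mul 𝕜 (ExteriorAlgebra 𝕜 V ⊗[𝕜] A)).compl₁₂
    (CliffordAlgebra.foldr' (0 : QuadraticForm 𝕜 V) (contrStep f) (contrStep_contrStep f) 0)
    (scal 𝕜 V).toLinearMap)

theorem contr_scal (f : V →ₗ[𝕜] A) (a : A) : contr f (scal 𝕜 V a) = 0 := by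
  have h := CliffordAlgebra.foldr'_algebraMap (0 : QuadraticForm 𝕜 V) (contrStep f)
    (contrStep_contrStep f) 0 1
  rw [map_one, smul_zero] at h
  simp [contr, scal, h]

theorem contr_vec_mul (f : V →ₗ[𝕜] A) (v : V) (x : ExteriorAlgebra 𝕜 V ⊗[𝕜] A) :
    contr f (vec 𝕜 A v * x) = scal 𝕜 V (f v) * x - vec 𝕜 A v * contr f x := by
  induction x with
  | zero => simp
  | add x y hx hy => rw [mul_add, map_add, hx, hy, map_add, mul_add, mul_add]; abel
  | tmul x a =>
    have h := CliffordAlgebra.foldr'_ι_mul (0 : QuadraticForm 𝕜 V) (contrStep f)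
      (contrStep_contrStep f) 0 v x
    have e : vec 𝕜 A v * (x ⊗ₜ[𝕜] a) =
        (CliffordAlgebra.ι (0 : QuadraticForm 𝕜 V) v * x) ⊗ₜ[𝕜] a := by
      simp [vec, ExteriorAlgebra.ι]
    rw [e]
    simp only [contr, TensorProduct.lift.tmul, LinearMap.compl₁₂_apply, h]
    simp only [contrStep, LinearMap.mk₂_apply, LinearMap.mul_apply', sub_mul, mul_assoc,
      AlgHom.toLinearMap_apply]
    congr 1
    simp [scal]

theorem contr_scal_mul (f : V →ₗ[𝕜] A) (a : A) (x : ExteriorAlgebra 𝕜 V ⊗[𝕜] A) :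
    contr f (scal 𝕜 V a * x) = scal 𝕜 V a * contr f x := by
  induction x using vec_scal_induction with
  | scal_mem b => rw [← map_mul, contr_scal, contr_scal, mul_zero]
  | add x y hx hy => rw [mul_add, map_add, hx, hy, map_add, mul_add]
  | vec_mul v x hx =>
    rw [← mul_assoc, scal_mul_comm, mul_assoc, contr_vec_mul, hx, contr_vec_mul, mul_sub,
      ← mul_assoc, ← mul_assoc (scal 𝕜 V a), ← map_mul, ← map_mul, mul_comm (f v),
      ← mul_assoc (scal 𝕜 V a), scal_mul_comm a (vec 𝕜 A v), mul_assoc (vec 𝕜 A v)]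

theorem contr_contr (f : V →ₗ[𝕜] A) (x : ExteriorAlgebra 𝕜 V ⊗[𝕜] A) :
    contr f (contr f x) = 0 := by
  induction x using vec_scal_induction with
  | scal_mem b => rw [contr_scal, map_zero]
  | add x y hx hy => rw [map_add, map_add, hx, hy, add_zero]
  | vec_mul v x hx =>
    rw [contr_vec_mul, map_sub, contr_scal_mul, contr_vec_mul, hx, mul_zero, sub_zero, sub_self]

theorem contr_anticomm (f g : V →ₗ[𝕜] A) (x : ExteriorAlgebra 𝕜 V ⊗[𝕜] A) :
    contr f (contr g x) = -contr g (contr f x) := by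
  induction x using vec_scal_induction with
  | scal_mem b => simp only [contr_scal, map_zero, neg_zero]
  | add x y hx hy => rw [map_add, map_add, hx, hy, map_add, map_add]; abel
  | vec_mul v x hx =>
    simp only [contr_vec_mul, map_sub, contr_scal_mul, hx]
    simp only [mul_neg]
    abel

/-- Naturality of the Koszul differential. -/
theorem map_contr {V' A' : Type*} [AddCommGroup V'] [Module 𝕜 V'] [CommRing A'] [Algebra 𝕜 A']
    (F : ExteriorAlgebra 𝕜 V ⊗[𝕜] A →ₐ[𝕜] ExteriorAlgebra 𝕜 V' ⊗[𝕜] A')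
    (f : V →ₗ[𝕜] A) (f' : V' →ₗ[𝕜] A') (θ : A →ₐ[𝕜] A')
    (hθ : ∀ a, F (scal 𝕜 V a) = scal 𝕜 V' (θ a))
    (hF : ∀ v x, contr f' (F (vec 𝕜 A v) * x) =
      scal 𝕜 V' (θ (f v)) * x - F (vec 𝕜 A v) * contr f' x)
    (x : ExteriorAlgebra 𝕜 V ⊗[𝕜] A) : contr f' (F x) = F (contr f x) := by
  induction x using vec_scal_induction with
  | scal_mem b => rw [hθ, contr_scal, contr_scal, map_zero]
  | add x y hx hy => simp only [map_add, hx, hy]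
  | vec_mul v x hx => rw [map_mul, hF, contr_vec_mul, map_sub, map_mul, map_mul, hθ, hx]

/-- The elements of exterior degree `p`, with vectors in `W` and coefficients in `N`. -/
def wedgeDeg (W : Submodule 𝕜 V) (p : ℕ) (N : Submodule 𝕜 A) :
    Submodule 𝕜 (ExteriorAlgebra 𝕜 V ⊗[𝕜] A) :=
  (W.map (vec 𝕜 A)) ^ p * N.map (scal 𝕜 V).toLinearMap

variable {W : Submodule 𝕜 V} {p : ℕ} {N N' : Submodule 𝕜 A}

theorem wedgeDeg_zero : wedgeDeg W 0 N = N.map (scal 𝕜 V).toLinearMap := by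
  rw [wedgeDeg, pow_zero, one_mul]

theorem wedgeDeg_succ : wedgeDeg W (p + 1) N = W.map (vec 𝕜 A) * wedgeDeg W p N := by
  rw [wedgeDeg, pow_succ', mul_assoc, wedgeDeg]

theorem scal_mem_wedgeDeg {a : A} (ha : a ∈ N) : scal 𝕜 V a ∈ wedgeDeg W 0 N := by
  rw [wedgeDeg_zero]; exact Submodule.mem_map_of_mem ha

theorem vec_mul_mem_wedgeDeg {v : V} (hv : v ∈ W) {x : ExteriorAlgebra 𝕜 V ⊗[𝕜] A}
    (hx : x ∈ wedgeDeg W p N) : vec 𝕜 A v * x ∈ wedgeDeg W (p + 1) N := by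
  rw [wedgeDeg_succ]; exact Submodule.mul_mem_mul (Submodule.mem_map_of_mem hv) hx

theorem wedgeDeg_induction
    {motive : ℕ → ExteriorAlgebra 𝕜 V ⊗[𝕜] A → Prop}
    (scal_mem : ∀ a ∈ N, motive 0 (scal 𝕜 V a))
    (add : ∀ p x y, motive p x → motive p y → motive p (x + y))
    (vec_mul : ∀ p, ∀ v ∈ W, ∀ x ∈ wedgeDeg W p N, motive p x → motive (p + 1) (vec 𝕜 A v * x))
    {x : ExteriorAlgebra 𝕜 V ⊗[𝕜] A} (hx : x ∈ wedgeDeg W p N) : motive p x := by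
  induction p generalizing x with
  | zero =>
    rw [wedgeDeg_zero] at hx
    obtain ⟨a, ha, rfl⟩ := hx
    exact scal_mem a ha
  | succ p ih =>
    rw [wedgeDeg_succ] at hx
    refine Submodule.mul_induction_on hx ?_ (fun x y => add _ x y)
    rintro _ ⟨v, hv, rfl⟩ y hy
    exact vec_mul p v hv y hy (ih hy)

theorem wedgeDeg_mono (h : N ≤ N') : wedgeDeg W p N ≤ wedgeDeg W p N' :=
  mul_le_mul_right (Submodule.map_mono h) _

theorem scal_mul_mem_wedgeDeg {a : A} (ha : ∀ b ∈ N, a * b ∈ N')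
    {x : ExteriorAlgebra 𝕜 V ⊗[𝕜] A} (hx : x ∈ wedgeDeg W p N) :
    scal 𝕜 V a * x ∈ wedgeDeg W p N' := by
  refine wedgeDeg_induction (motive := fun p x => scal 𝕜 V a * x ∈ wedgeDeg W p N') ?_ ?_ ?_ hx
  · intro b hb
    rw [← map_mul]; exact scal_mem_wedgeDeg (ha b hb)
  · intro p x y hx hy
    rw [mul_add]; exact add_mem hx hy
  · intro p v hv x _ hx
    rw [← mul_assoc, scal_mul_comm, mul_assoc]; exact vec_mul_mem_wedgeDeg hv hx

theorem contr_wedgeDeg_zero (f : V →ₗ[𝕜] A) {x : ExteriorAlgebra 𝕜 V ⊗[𝕜] A}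
    (hx : x ∈ wedgeDeg W 0 N) : contr f x = 0 := by
  rw [wedgeDeg_zero] at hx
  obtain ⟨a, -, rfl⟩ := hx
  exact contr_scal f a

theorem contr_mem_wedgeDeg (f : V →ₗ[𝕜] A) (hf : ∀ v ∈ W, ∀ a ∈ N, f v * a ∈ N')
    {x : ExteriorAlgebra 𝕜 V ⊗[𝕜] A} (hx : x ∈ wedgeDeg W (p + 1) N) :
    contr f x ∈ wedgeDeg W p N' := by
  refine wedgeDeg_induction (motive := fun q y => ∀ p, q = p + 1 → contr f y ∈ wedgeDeg W p N')
    ?_ ?_ ?_ hx p rfl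
  · intro a ha p hp; omega
  · intro q x y hx hy p hp
    rw [map_add]; exact add_mem (hx p hp) (hy p hp)
  · intro q v hv x hxm hx p hp
    obtain rfl : q = p := by omega
    rw [contr_vec_mul]
    refine sub_mem (scal_mul_mem_wedgeDeg (hf v hv) hxm) ?_
    cases q with
    | zero => rw [contr_wedgeDeg_zero f hxm, mul_zero]; exact zero_mem _
    | succ q => exact vec_mul_mem_wedgeDeg hv (hx q rfl)

end Koszul

section Laurent

open LaurentPolynomial (T)
open scoped LaurentPolynomial

variable {𝕜 P Q P₁ P₂ P₃ Q₁ Q₂ Q₃ : Type*} [Field 𝕜]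
  [CommRing P] [Algebra 𝕜 P] [CommRing Q] [Algebra 𝕜 Q]
  [CommRing P₁] [Algebra 𝕜 P₁] [CommRing P₂] [Algebra 𝕜 P₂] [CommRing P₃] [Algebra 𝕜 P₃]
  [CommRing Q₁] [Algebra 𝕜 Q₁] [CommRing Q₂] [Algebra 𝕜 Q₂] [CommRing Q₃] [Algebra 𝕜 Q₃]

/-- Constant Laurent polynomials. -/
def cst (𝕜 : Type*) {P : Type*} [Field 𝕜] [CommRing P] [Algebra 𝕜 P] : P →ₐ[𝕜] P[T;T⁻¹] :=
  AddMonoidAlgebra.singleZeroAlgHom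

theorem cst_mul_T (a : P) (m : ℤ) : cst 𝕜 a * T m = AddMonoidAlgebra.single m a :=
  (LaurentPolynomial.single_eq_C_mul_T a m).symm

variable (𝕜 P) in
theorem laurent_induction {motive : P[T;T⁻¹] → Prop} (add : ∀ F G, motive F → motive G →
    motive (F + G)) (cst_mul_T : ∀ a m, motive (cst 𝕜 a * T m)) (F : P[T;T⁻¹]) : motive F :=
  LaurentPolynomial.induction_on' F add fun m a => cst_mul_T a m

theorem laurent_algHom_ext {B : Type*} [Ring B] [Algebra 𝕜 B] {F G : P[T;T⁻¹] →ₐ[𝕜] B}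
    (hc : ∀ a, F (cst 𝕜 a) = G (cst 𝕜 a)) (hT : ∀ m, F (T m) = G (T m)) : F = G := by
  refine AlgHom.ext fun H => ?_
  induction H using laurent_induction 𝕜 P with
  | add H K hH hK => rw [map_add, map_add, hH, hK]
  | cst_mul_T a m => rw [map_mul, map_mul, hc, hT]

/-- The homomorphism of Laurent polynomial algebras extending `φ` and sending `T` to `T ^ ε`. -/
def laurentLift (φ : P →ₐ[𝕜] Q[T;T⁻¹]) (ε : ℤ) : P[T;T⁻¹] →ₐ[𝕜] Q[T;T⁻¹] :=
  AddMonoidAlgebra.liftNCAlgHom φ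
    { toFun := fun m => T (ε * m.toAdd)
      map_one' := by simp
      map_mul' := fun a b => by rw [toAdd_mul, mul_add, LaurentPolynomial.T_add] }
    (fun _ _ => Commute.all _ _)

@[simp] theorem laurentLift_cst (φ : P →ₐ[𝕜] Q[T;T⁻¹]) (ε : ℤ) (a : P) :
    laurentLift φ ε (cst 𝕜 a) = φ a := by
  rw [cst, AddMonoidAlgebra.singleZeroAlgHom_apply, laurentLift,
    AddMonoidAlgebra.coe_liftNCAlgHom, AddMonoidAlgebra.liftNC_single]
  simp

@[simp] theorem laurentLift_T (φ : P →ₐ[𝕜] Q[T;T⁻¹]) (ε : ℤ) (m : ℤ) :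
    laurentLift φ ε (T m) = T (ε * m) := by
  rw [laurentLift, AddMonoidAlgebra.coe_liftNCAlgHom, T, AddMonoidAlgebra.liftNC_single]
  simp

/-- Laurent polynomials with coefficients in `W` and exponents in `S`. -/
def laurentSub (W : Submodule 𝕜 P) (S : Set ℤ) : Submodule 𝕜 P[T;T⁻¹] where
  carrier := {F | ∀ m, F.coeff m ∈ W ∧ (m ∉ S → F.coeff m = 0)}
  zero_mem' := fun m => ⟨W.zero_mem, fun _ => rfl⟩
  add_mem' := fun {F G} hF hG m => by
    refine ⟨W.add_mem (hF m).1 (hG m).1, fun hm => ?_⟩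
    rw [AddMonoidAlgebra.coeff_add, Finsupp.add_apply, (hF m).2 hm, (hG m).2 hm, add_zero]
  smul_mem' := fun r F hF m => by
    refine ⟨W.smul_mem r (hF m).1, fun hm => ?_⟩
    rw [AddMonoidAlgebra.coeff_smul, Finsupp.smul_apply, (hF m).2 hm, smul_zero]

variable {W W' W'' : Submodule 𝕜 P} {S S' S'' : Set ℤ}

theorem cst_mul_T_mem {a : P} {m : ℤ} (ha : a ∈ W) (hm : m ∈ S) :
    cst 𝕜 a * T m ∈ laurentSub W S := by
  classical
  intro l
  rw [cst_mul_T, AddMonoidAlgebra.coeff_single, Finsupp.single_apply]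
  split_ifs with h
  · subst h; exact ⟨ha, fun h => (h hm).elim⟩
  · exact ⟨W.zero_mem, fun _ => rfl⟩

theorem cst_mem_laurentSub {a : P} (ha : a ∈ W) (hm : 0 ∈ S) : cst 𝕜 a ∈ laurentSub W S := by
  simpa using cst_mul_T_mem (m := 0) ha hm

theorem laurentSub_induction {motive : P[T;T⁻¹] → Prop} (zero : motive 0)
    (add : ∀ F G, F ∈ laurentSub W S → G ∈ laurentSub W S → motive F → motive G → motive (F + G))
    (cst_mul_T : ∀ a ∈ W, ∀ m ∈ S, motive (cst 𝕜 a * T m))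
    {F : P[T;T⁻¹]} (hF : F ∈ laurentSub W S) : motive F := by
  classical
  suffices h : ∀ s : Finset ℤ, (∀ m ∈ s, m ∈ S ∨ F.coeff m = 0) →
      (∑ m ∈ s, AddMonoidAlgebra.single m (F.coeff m)) ∈ laurentSub W S ∧
      motive (∑ m ∈ s, AddMonoidAlgebra.single m (F.coeff m)) by
    rw [← AddMonoidAlgebra.sum_coeff_single F]
    refine (h _ fun m _ => ?_).2
    by_cases hm : m ∈ S
    · exact Or.inl hm
    · exact Or.inr ((hF m).2 hm)
  intro s
  induction s using Finset.induction_on with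
  | empty => intro _; simpa using zero
  | insert m s hms ih =>
    intro hs
    have ih := ih fun l hl => hs l (Finset.mem_insert_of_mem hl)
    rw [Finset.sum_insert hms]
    rcases hs m (Finset.mem_insert_self m s) with h | h
    · rw [← _root_.cst_mul_T (𝕜 := 𝕜)]
      have := cst_mul_T_mem (hF m).1 h
      exact ⟨add_mem this ih.1, add _ _ this ih.1 (cst_mul_T _ (hF m).1 _ h) ih.2⟩
    · rw [h, AddMonoidAlgebra.single_zero, zero_add]; exact ih

theorem laurentSub_mono (hW : W ≤ W') (hS : S ⊆ S') : laurentSub W S ≤ laurentSub W' S' :=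
  fun _ hF m => ⟨hW (hF m).1, fun hm => (hF m).2 fun h => hm (hS h)⟩

theorem mul_mem_laurentSub {F G : P[T;T⁻¹]} (hW : ∀ a ∈ W, ∀ b ∈ W', a * b ∈ W'')
    (hS : ∀ l ∈ S, ∀ m ∈ S', l + m ∈ S'')
    (hF : F ∈ laurentSub W S) (hG : G ∈ laurentSub W' S') : F * G ∈ laurentSub W'' S'' := by
  refine laurentSub_induction (motive := fun F => F * G ∈ laurentSub W'' S'') ?_ ?_ ?_ hF
  · rw [zero_mul]; exact zero_mem _
  · intro F F' _ _ h h'; rw [add_mul]; exact add_mem h h'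
  · intro a ha l hl
    refine laurentSub_induction (motive := fun G => cst 𝕜 a * T l * G ∈ laurentSub W'' S'') ?_ ?_ ?_ hG
    · rw [mul_zero]; exact zero_mem _
    · intro F F' _ _ h h'; rw [mul_add]; exact add_mem h h'
    · intro b hb m hm
      have : cst 𝕜 a * T l * (cst 𝕜 b * T m) = cst 𝕜 (a * b) * T (l + m) := by
        rw [map_mul, LaurentPolynomial.T_add]; ring
      rw [this]
      exact cst_mul_T_mem (hW a ha b hb) (hS l hl m hm)

/-- An algebra homomorphism maps one space `laurentSub` to another if it does so on monomials. -/
theorem algHom_mem_laurentSub {W₁ : Submodule 𝕜 P₁} {W₂ : Submodule 𝕜 P₂}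
    {Θ : P₁[T;T⁻¹] →ₐ[𝕜] P₂[T;T⁻¹]}
    (h : ∀ a ∈ W₁, ∀ m ∈ S, Θ (cst 𝕜 a * T m) ∈ laurentSub W₂ S') {F : P₁[T;T⁻¹]}
    (hF : F ∈ laurentSub W₁ S) : Θ F ∈ laurentSub W₂ S' := by
  refine laurentSub_induction (motive := fun F => Θ F ∈ laurentSub W₂ S') ?_ ?_ ?_ hF
  · rw [map_zero]; exact zero_mem _
  · intro F G _ _ h h'; rw [map_add]; exact add_mem h h'
  · exact h

open Classical in
/-- The part of a Laurent polynomial with exponents in `S`. -/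
def laurentFilter (𝕜 : Type*) {P : Type*} [Field 𝕜] [CommRing P] [Algebra 𝕜 P] (S : Set ℤ) :
    P[T;T⁻¹] →ₗ[𝕜] P[T;T⁻¹] where
  toFun F := AddMonoidAlgebra.ofCoeff (F.coeff.filter (· ∈ S))
  map_add' F G := by
    rw [AddMonoidAlgebra.coeff_add, Finsupp.filter_add, AddMonoidAlgebra.ofCoeff_add]
  map_smul' r F := by
    rw [AddMonoidAlgebra.coeff_smul, Finsupp.filter_smul, AddMonoidAlgebra.ofCoeff_smul]; rfl

theorem laurentFilter_cst_mul_T_of_mem (a : P) {m : ℤ} (hm : m ∈ S) :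
    laurentFilter 𝕜 S (cst 𝕜 a * T m) = cst 𝕜 a * T m := by
  classical
  rw [cst_mul_T]
  simp only [laurentFilter, LinearMap.coe_mk, AddHom.coe_mk, AddMonoidAlgebra.coeff_single]
  rw [Finsupp.filter_single_of_pos (p := (· ∈ S)) hm, AddMonoidAlgebra.ofCoeff_single]

theorem laurentFilter_cst_mul_T_of_notMem (a : P) {m : ℤ} (hm : m ∉ S) :
    laurentFilter 𝕜 S (cst 𝕜 a * T m) = 0 := by
  classical
  rw [cst_mul_T]
  simp only [laurentFilter, LinearMap.coe_mk, AddHom.coe_mk, AddMonoidAlgebra.coeff_single]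
  rw [Finsupp.filter_single_of_neg (p := (· ∈ S)) hm, AddMonoidAlgebra.ofCoeff_zero]

theorem laurentFilter_mem {F : P[T;T⁻¹]} (hF : F ∈ laurentSub W S) (S' : Set ℤ) :
    laurentFilter 𝕜 S' F ∈ laurentSub W (S ∩ S') := by
  refine laurentSub_induction (motive := fun F => laurentFilter 𝕜 S' F ∈ laurentSub W (S ∩ S')) ?_ ?_ ?_ hF
  · rw [map_zero]; exact zero_mem _
  · intro F G _ _ h h'; rw [map_add]; exact add_mem h h'
  · intro a ha m hm
    by_cases hm' : m ∈ S'
    · rw [laurentFilter_cst_mul_T_of_mem a hm']; exact cst_mul_T_mem ha ⟨hm, hm'⟩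
    · rw [laurentFilter_cst_mul_T_of_notMem a hm']; exact zero_mem _

theorem laurentFilter_of_mem {F : P[T;T⁻¹]} (hF : F ∈ laurentSub W S) :
    laurentFilter 𝕜 S F = F := by
  refine laurentSub_induction (motive := fun F => laurentFilter 𝕜 S F = F) ?_ ?_ ?_ hF
  · rw [map_zero]
  · intro F G _ _ h h'; rw [map_add, h, h']
  · intro a ha m hm
    rw [laurentFilter_cst_mul_T_of_mem a hm]

theorem laurentFilter_add_compl (S : Set ℤ) (F : P[T;T⁻¹]) :
    laurentFilter 𝕜 S F + laurentFilter 𝕜 Sᶜ F = F := by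
  induction F using laurent_induction 𝕜 P with
  | add F G hF hG => rw [map_add, map_add]; nth_rw 3 [← hF, ← hG]; abel
  | cst_mul_T a m =>
    by_cases hm : m ∈ S
    · rw [laurentFilter_cst_mul_T_of_mem a hm,
        laurentFilter_cst_mul_T_of_notMem a (by simpa using hm), add_zero]
    · rw [laurentFilter_cst_mul_T_of_notMem a hm,
        laurentFilter_cst_mul_T_of_mem a (by simpa using hm), zero_add]

theorem laurentFilter_cst_mul (a : P) (F : P[T;T⁻¹]) :
    laurentFilter 𝕜 S (cst 𝕜 a * F) = cst 𝕜 a * laurentFilter 𝕜 S F := by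
  induction F using laurent_induction 𝕜 P with
  | add F G hF hG => rw [mul_add, map_add, map_add, hF, hG, mul_add]
  | cst_mul_T b m =>
    rw [← mul_assoc, ← map_mul]
    by_cases hm : m ∈ S
    · rw [laurentFilter_cst_mul_T_of_mem _ hm, laurentFilter_cst_mul_T_of_mem _ hm, map_mul,
        mul_assoc]
    · rw [laurentFilter_cst_mul_T_of_notMem _ hm, laurentFilter_cst_mul_T_of_notMem _ hm, mul_zero]

/-! ### The Koszul algebra with Laurent coefficients -/

/-- The algebra `⋀ P ⊗ Q[T;T⁻¹]`. -/
abbrev Kos (𝕜 P Q : Type*) [Field 𝕜] [CommRing P] [Algebra 𝕜 P] [CommRing Q] [Algebra 𝕜 Q] :=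
  ExteriorAlgebra 𝕜 P ⊗[𝕜] Q[T;T⁻¹]

/-- The `T`-linear extension of `vec` to Laurent polynomials. -/
def lvec (𝕜 : Type*) {P : Type*} (Q : Type*) [Field 𝕜] [CommRing P] [Algebra 𝕜 P] [CommRing Q]
    [Algebra 𝕜 Q] : P[T;T⁻¹] →ₗ[𝕜] Kos 𝕜 P Q :=
  Finsupp.lsum 𝕜 (fun m : ℤ => (LinearMap.mulRight 𝕜 (scal 𝕜 P (T m : Q[T;T⁻¹]))) ∘ₗ
    vec 𝕜 Q[T;T⁻¹]) ∘ₗ (AddMonoidAlgebra.coeffLinearEquiv 𝕜).toLinearMap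

theorem lvec_cst_mul_T (a : P) (m : ℤ) :
    lvec 𝕜 Q (cst 𝕜 a * T m) = vec 𝕜 Q[T;T⁻¹] a * scal 𝕜 P (T m) := by
  rw [cst_mul_T, lvec, LinearMap.comp_apply, LinearEquiv.coe_coe,
    AddMonoidAlgebra.coeffLinearEquiv_apply, AddMonoidAlgebra.coeff_single,
    Finsupp.lsum_single]
  rfl

theorem lvec_cst (a : P) : lvec 𝕜 Q (cst 𝕜 a) = vec 𝕜 Q[T;T⁻¹] a := by
  simpa using lvec_cst_mul_T (𝕜 := 𝕜) (Q := Q) a 0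

theorem lvec_mul_T (F : P[T;T⁻¹]) (m : ℤ) :
    lvec 𝕜 Q (F * T m) = lvec 𝕜 Q F * scal 𝕜 P (T m) := by
  induction F using laurent_induction 𝕜 P with
  | add F G hF hG => rw [add_mul, map_add, map_add, hF, hG, add_mul]
  | cst_mul_T a l =>
    rw [mul_assoc, ← LaurentPolynomial.T_add, lvec_cst_mul_T, lvec_cst_mul_T, mul_assoc, ← map_mul,
      LaurentPolynomial.T_add]

theorem vec_mul_lvec (v : P) (F : P[T;T⁻¹]) :
    vec 𝕜 Q[T;T⁻¹] v * lvec 𝕜 Q F = -(lvec 𝕜 Q F * vec 𝕜 Q[T;T⁻¹] v) := by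
  induction F using laurent_induction 𝕜 P with
  | add F G hF hG => rw [map_add, mul_add, add_mul, hF, hG]; abel
  | cst_mul_T a l =>
    rw [lvec_cst_mul_T, ← mul_assoc, vec_mul_vec, mul_assoc, scal_mul_comm, neg_mul, mul_assoc]

theorem lvec_mul_self (F : P[T;T⁻¹]) : lvec 𝕜 Q F * lvec 𝕜 Q F = 0 := by
  induction F using laurent_induction 𝕜 P with
  | add F G hF hG =>
    suffices h : ∀ F G : P[T;T⁻¹], lvec 𝕜 Q F * lvec 𝕜 Q G = -(lvec 𝕜 Q G * lvec 𝕜 Q F) by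
      rw [map_add, mul_add, add_mul, add_mul, hF, hG, h G F]; abel
    intro F G
    induction F using laurent_induction 𝕜 P with
    | add F F' hF hF' => rw [map_add, add_mul, mul_add, hF, hF']; abel
    | cst_mul_T a l =>
      rw [lvec_cst_mul_T, mul_assoc, scal_mul_comm, ← mul_assoc, vec_mul_lvec, ← mul_assoc (lvec 𝕜 Q G)]
      exact neg_mul (lvec 𝕜 Q G * vec 𝕜 Q[T;T⁻¹] a) (scal 𝕜 P (T l))
  | cst_mul_T a l =>
    rw [lvec_cst_mul_T, mul_assoc, scal_mul_comm, mul_assoc, ← mul_assoc, vec_mul_self, zero_mul]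

/-- The Koszul differential attached to an algebra homomorphism. -/
def kdiff (f : P[T;T⁻¹] →ₐ[𝕜] Q[T;T⁻¹]) : Kos 𝕜 P Q →ₗ[𝕜] Kos 𝕜 P Q :=
  contr (f.toLinearMap ∘ₗ (cst 𝕜).toLinearMap)

theorem kdiff_scal_mul (f : P[T;T⁻¹] →ₐ[𝕜] Q[T;T⁻¹]) (a : Q[T;T⁻¹]) (x : Kos 𝕜 P Q) :
    kdiff f (scal 𝕜 P a * x) = scal 𝕜 P a * kdiff f x :=
  contr_scal_mul _ a x

theorem kdiff_kdiff (f : P[T;T⁻¹] →ₐ[𝕜] Q[T;T⁻¹]) (x : Kos 𝕜 P Q) : kdiff f (kdiff f x) = 0 :=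
  contr_contr _ x

theorem kdiff_vec_mul (f : P[T;T⁻¹] →ₐ[𝕜] Q[T;T⁻¹]) (v : P) (x : Kos 𝕜 P Q) :
    kdiff f (vec 𝕜 Q[T;T⁻¹] v * x) =
      scal 𝕜 P (f (cst 𝕜 v)) * x - vec 𝕜 Q[T;T⁻¹] v * kdiff f x :=
  contr_vec_mul _ v x

theorem kdiff_lvec_mul {f : P[T;T⁻¹] →ₐ[𝕜] Q[T;T⁻¹]} (hf : ∀ m, f (T m) = T m) (F : P[T;T⁻¹])
    (x : Kos 𝕜 P Q) :
    kdiff f (lvec 𝕜 Q F * x) = scal 𝕜 P (f F) * x - lvec 𝕜 Q F * kdiff f x := by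
  induction F using laurent_induction 𝕜 P with
  | add F G hF hG => rw [map_add, add_mul, map_add, hF, hG, map_add, map_add, add_mul, add_mul]; abel
  | cst_mul_T a m =>
    rw [lvec_cst_mul_T, mul_assoc, kdiff_vec_mul, kdiff_scal_mul, map_mul, hf, map_mul, mul_assoc,
      mul_assoc]

/-- The homomorphism of Koszul algebras induced by `Θ` on vectors and `ΘA` on coefficients. -/
def kmap (Θ : P₁[T;T⁻¹] →ₐ[𝕜] P₂[T;T⁻¹]) (ΘA : Q₁[T;T⁻¹] →ₐ[𝕜] Q₂[T;T⁻¹]) :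
    Kos 𝕜 P₁ Q₁ →ₐ[𝕜] Kos 𝕜 P₂ Q₂ :=
  Algebra.TensorProduct.lift
    (ExteriorAlgebra.lift 𝕜 ⟨lvec 𝕜 Q₂ ∘ₗ Θ.toLinearMap ∘ₗ (cst 𝕜).toLinearMap,
      fun _ => lvec_mul_self _⟩)
    ((scal 𝕜 P₂).comp ΘA) fun _ a => by
      rw [AlgHom.comp_apply]; exact (scal_mul_comm (ΘA a) _).symm

variable {Θ : P₁[T;T⁻¹] →ₐ[𝕜] P₂[T;T⁻¹]} {ΘA : Q₁[T;T⁻¹] →ₐ[𝕜] Q₂[T;T⁻¹]}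

@[simp] theorem kmap_vec (v : P₁) : kmap Θ ΘA (vec 𝕜 _ v) = lvec 𝕜 Q₂ (Θ (cst 𝕜 v)) := by
  have h : vec 𝕜 Q₁[T;T⁻¹] v = ExteriorAlgebra.ι 𝕜 v ⊗ₜ[𝕜] 1 := rfl
  rw [h, kmap, Algebra.TensorProduct.lift_tmul, ExteriorAlgebra.lift_ι_apply, map_one]
  exact mul_one _

@[simp] theorem kmap_scal (a : Q₁[T;T⁻¹]) : kmap Θ ΘA (scal 𝕜 P₁ a) = scal 𝕜 P₂ (ΘA a) := by
  simp [kmap, scal]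

theorem kmap_lvec {ε : ℤ} (hΘ : ∀ m, Θ (T m) = T (ε * m)) (hA : ∀ m, ΘA (T m) = T (ε * m))
    (F : P₁[T;T⁻¹]) : kmap Θ ΘA (lvec 𝕜 Q₁ F) = lvec 𝕜 Q₂ (Θ F) := by
  induction F using laurent_induction 𝕜 P₁ with
  | add F G hF hG => simp only [map_add, hF, hG]
  | cst_mul_T a m =>
    rw [lvec_cst_mul_T, map_mul, kmap_vec, kmap_scal, hA, map_mul, hΘ, lvec_mul_T]

theorem kmap_kmap {ε : ℤ} {Θ' : P₂[T;T⁻¹] →ₐ[𝕜] P₃[T;T⁻¹]} {ΘA' : Q₂[T;T⁻¹] →ₐ[𝕜] Q₃[T;T⁻¹]}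
    (hΘ : ∀ m, Θ' (T m) = T (ε * m)) (hA : ∀ m, ΘA' (T m) = T (ε * m)) (x : Kos 𝕜 P₁ Q₁) :
    kmap Θ' ΘA' (kmap Θ ΘA x) = kmap (Θ'.comp Θ) (ΘA'.comp ΘA) x := by
  suffices h : (kmap Θ' ΘA').comp (kmap Θ ΘA) = kmap (Θ'.comp Θ) (ΘA'.comp ΘA) from
    DFunLike.congr_fun h x
  refine algHom_ext_vec_scal (fun v => ?_) fun a => ?_
  · rw [AlgHom.comp_apply, kmap_vec, kmap_lvec hΘ hA, kmap_vec, AlgHom.comp_apply]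
  · rw [AlgHom.comp_apply, kmap_scal, kmap_scal, kmap_scal, AlgHom.comp_apply]

theorem kmap_id (x : Kos 𝕜 P Q) : kmap (AlgHom.id 𝕜 P[T;T⁻¹]) (AlgHom.id 𝕜 Q[T;T⁻¹]) x = x := by
  suffices h : kmap (AlgHom.id 𝕜 P[T;T⁻¹]) (AlgHom.id 𝕜 Q[T;T⁻¹]) = AlgHom.id 𝕜 (Kos 𝕜 P Q) from
    DFunLike.congr_fun h x
  refine algHom_ext_vec_scal (fun v => ?_) fun a => ?_
  · rw [kmap_vec, AlgHom.id_apply, AlgHom.id_apply, lvec_cst]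
  · rw [kmap_scal, AlgHom.id_apply, AlgHom.id_apply]

theorem kdiff_kmap {f₁ : P₁[T;T⁻¹] →ₐ[𝕜] Q₁[T;T⁻¹]} {f₂ : P₂[T;T⁻¹] →ₐ[𝕜] Q₂[T;T⁻¹]}
    (hf₂ : ∀ m, f₂ (T m) = T m) (h : ∀ v, f₂ (Θ (cst 𝕜 v)) = ΘA (f₁ (cst 𝕜 v)))
    (x : Kos 𝕜 P₁ Q₁) : kdiff f₂ (kmap Θ ΘA x) = kmap Θ ΘA (kdiff f₁ x) := by
  refine map_contr (kmap Θ ΘA) _ _ ΘA (fun a => kmap_scal a) (fun v x => ?_) x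
  rw [kmap_vec]
  refine (kdiff_lvec_mul hf₂ _ _).trans ?_
  rw [h]; rfl

/-- The part of `⋀ P ⊗ Q[T;T⁻¹]` of exterior degree `p`, with vectors in `W`, and coefficients in
`M` with exponents in `S`. -/
abbrev kgr (W : Submodule 𝕜 P) (p : ℕ) (M : Submodule 𝕜 Q) (S : Set ℤ) :
    Submodule 𝕜 (Kos 𝕜 P Q) := wedgeDeg W p (laurentSub M S)

theorem kgr_mono {W : Submodule 𝕜 P} {p : ℕ} {M : Submodule 𝕜 Q} (h : S ⊆ S') :
    kgr W p M S ≤ kgr W p M S' :=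
  wedgeDeg_mono (laurentSub_mono le_rfl h)

theorem scal_mul_mem_kgr {W : Submodule 𝕜 P} {p : ℕ} {M M' : Submodule 𝕜 Q} {a : Q}
    (ha : ∀ b ∈ M, a * b ∈ M') {m : ℤ} (hS : ∀ l ∈ S, m + l ∈ S') {x : Kos 𝕜 P Q}
    (hx : x ∈ kgr W p M S) : scal 𝕜 P (cst 𝕜 a * T m) * x ∈ kgr W p M' S' := by
  refine scal_mul_mem_wedgeDeg (fun F hF => ?_) hx
  refine mul_mem_laurentSub (W := 𝕜 ∙ a) (S := {m}) ?_ ?_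
    (cst_mul_T_mem (Submodule.mem_span_singleton_self a) rfl) hF
  · intro r hr b hb
    obtain ⟨c, rfl⟩ := Submodule.mem_span_singleton.1 hr
    rw [smul_mul_assoc]; exact M'.smul_mem c (ha b hb)
  · rintro l rfl m hm; exact hS m hm

theorem T_mul_mem_kgr {W : Submodule 𝕜 P} {p : ℕ} {M : Submodule 𝕜 Q} {m : ℤ}
    (hS : ∀ l ∈ S, m + l ∈ S') {x : Kos 𝕜 P Q}
    (hx : x ∈ kgr W p M S) : scal 𝕜 P (T m) * x ∈ kgr W p M S' := by
  have := scal_mul_mem_kgr (a := (1 : Q)) (M := M) (M' := M) (fun b hb => by rwa [one_mul]) hS hx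
  rwa [map_one, one_mul] at this

theorem lvec_mul_mem_kgr {W : Submodule 𝕜 P} {p : ℕ} {M : Submodule 𝕜 Q} {F : P[T;T⁻¹]}
    {R : Set ℤ} (hF : F ∈ laurentSub W R) (hS : ∀ l ∈ R, ∀ m ∈ S, l + m ∈ S') {x : Kos 𝕜 P Q}
    (hx : x ∈ kgr W p M S) : lvec 𝕜 Q F * x ∈ kgr W (p + 1) M S' := by
  refine laurentSub_induction (motive := fun F => lvec 𝕜 Q F * x ∈ kgr W (p + 1) M S') ?_ ?_ ?_ hF
  · rw [map_zero, zero_mul]; exact zero_mem _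
  · intro F G _ _ h h'; rw [map_add, add_mul]; exact add_mem h h'
  · intro a ha m hm
    rw [lvec_cst_mul_T, mul_assoc]
    exact vec_mul_mem_wedgeDeg ha (T_mul_mem_kgr (hS m hm) hx)

theorem kmap_mem_kgr {W₁ : Submodule 𝕜 P₁} {W₂ : Submodule 𝕜 P₂} {M₁ : Submodule 𝕜 Q₁}
    {M₂ : Submodule 𝕜 Q₂} {R : Set ℤ} {S' : ℕ → Set ℤ} {p : ℕ}
    (hΘ : ∀ v ∈ W₁, Θ (cst 𝕜 v) ∈ laurentSub W₂ R)
    (hA : ∀ a ∈ M₁, ∀ m ∈ S, ΘA (cst 𝕜 a * T m) ∈ laurentSub M₂ (S' 0))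
    (hS : ∀ i, ∀ l ∈ R, ∀ m ∈ S' i, l + m ∈ S' (i + 1)) {x : Kos 𝕜 P₁ Q₁}
    (hx : x ∈ kgr W₁ p M₁ S) : kmap Θ ΘA x ∈ kgr W₂ p M₂ (S' p) := by
  refine wedgeDeg_induction (motive := fun p x => kmap Θ ΘA x ∈ kgr W₂ p M₂ (S' p)) ?_ ?_ ?_ hx
  · intro F hF
    rw [kmap_scal]
    exact scal_mem_wedgeDeg (algHom_mem_laurentSub hA hF)
  · intro p x y hx hy; rw [map_add]; exact add_mem hx hy
  · intro p v hv x _ hx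
    rw [map_mul, kmap_vec]
    exact lvec_mul_mem_kgr (hΘ v hv) (hS p) hx

/-- Selecting the exponents in `S`. -/
def kfilter (𝕜 P Q : Type*) [Field 𝕜] [CommRing P] [Algebra 𝕜 P] [CommRing Q] [Algebra 𝕜 Q]
    (S : Set ℤ) : Kos 𝕜 P Q →ₗ[𝕜] Kos 𝕜 P Q :=
  LinearMap.lTensor _ (laurentFilter 𝕜 S)

theorem kfilter_scal (F : Q[T;T⁻¹]) :
    kfilter 𝕜 P Q S (scal 𝕜 P F) = scal 𝕜 P (laurentFilter 𝕜 S F) := by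
  simp [kfilter, scal]

theorem kfilter_vec_mul (v : P) (x : Kos 𝕜 P Q) :
    kfilter 𝕜 P Q S (vec 𝕜 _ v * x) = vec 𝕜 _ v * kfilter 𝕜 P Q S x := by
  induction x using TensorProduct.induction_on with
  | zero => simp
  | add x y hx hy => simp only [mul_add, map_add, hx, hy]
  | tmul x F => simp [kfilter, vec]

theorem kfilter_mem {W : Submodule 𝕜 P} {p : ℕ} {M : Submodule 𝕜 Q} (S' : Set ℤ)
    {x : Kos 𝕜 P Q} (hx : x ∈ kgr W p M S) : kfilter 𝕜 P Q S' x ∈ kgr W p M (S ∩ S') := by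
  refine wedgeDeg_induction (motive := fun p x => kfilter 𝕜 P Q S' x ∈ kgr W p M (S ∩ S'))
    ?_ ?_ ?_ hx
  · intro F hF
    rw [kfilter_scal]; exact scal_mem_wedgeDeg (laurentFilter_mem hF S')
  · intro p x y hx hy; rw [map_add]; exact add_mem hx hy
  · intro p v hv x _ hx
    rw [kfilter_vec_mul]; exact vec_mul_mem_wedgeDeg hv hx

theorem kfilter_of_mem {W : Submodule 𝕜 P} {p : ℕ} {M : Submodule 𝕜 Q}
    {x : Kos 𝕜 P Q} (hx : x ∈ kgr W p M S) : kfilter 𝕜 P Q S x = x := by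
  refine wedgeDeg_induction (motive := fun p x => kfilter 𝕜 P Q S x = x)
    ?_ ?_ ?_ hx
  · intro F hF
    rw [kfilter_scal, laurentFilter_of_mem hF]
  · intro p x y hx hy; rw [map_add, hx, hy]
  · intro p v hv x _ hx
    rw [kfilter_vec_mul, hx]

theorem kfilter_add_compl (S : Set ℤ) (x : Kos 𝕜 P Q) :
    kfilter 𝕜 P Q S x + kfilter 𝕜 P Q Sᶜ x = x := by
  induction x using vec_scal_induction with
  | scal_mem F => rw [kfilter_scal, kfilter_scal, ← map_add, laurentFilter_add_compl]
  | add x y hx hy => rw [map_add, map_add]; nth_rw 3 [← hx, ← hy]; abel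
  | vec_mul v x hx => rw [kfilter_vec_mul, kfilter_vec_mul, ← mul_add, hx]

theorem mem_kgr_inter {W : Submodule 𝕜 P} {p : ℕ} {M : Submodule 𝕜 Q} {x : Kos 𝕜 P Q}
    (hx : x ∈ kgr W p M S) (hx' : x ∈ kgr W p M S') : x ∈ kgr W p M (S ∩ S') := by
  have := kfilter_mem S' hx
  rwa [kfilter_of_mem hx'] at this

theorem kdiff_kfilter (x : Kos 𝕜 P P) :
    kdiff (AlgHom.id 𝕜 _) (kfilter 𝕜 P P S x) = kfilter 𝕜 P P S (kdiff (AlgHom.id 𝕜 _) x) := by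
  have hs : ∀ F : P[T;T⁻¹], kdiff (AlgHom.id 𝕜 _) (scal 𝕜 P F) = 0 := contr_scal _
  have hm : ∀ (a : P) (x : Kos 𝕜 P P),
      kfilter 𝕜 P P S (scal 𝕜 P (cst 𝕜 a) * x) = scal 𝕜 P (cst 𝕜 a) * kfilter 𝕜 P P S x := by
    intro a x
    induction x using TensorProduct.induction_on with
    | zero => simp
    | add x y hx hy => simp only [mul_add, map_add, hx, hy]
    | tmul x F => simp [kfilter, scal, laurentFilter_cst_mul]
  induction x using vec_scal_induction with
  | scal_mem F => rw [kfilter_scal, hs, hs, map_zero]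
  | add x y hx hy => simp only [map_add, hx, hy]
  | vec_mul v x hx =>
    rw [kfilter_vec_mul, kdiff_vec_mul, kdiff_vec_mul, map_sub, kfilter_vec_mul, hx,
      AlgHom.id_apply, hm]

theorem kdiff_mem_kgr {W : Submodule 𝕜 P} {p : ℕ} {M M' : Submodule 𝕜 Q}
    {f : P[T;T⁻¹] →ₐ[𝕜] Q[T;T⁻¹]} {W' : Submodule 𝕜 Q} {R : Set ℤ}
    (hf : ∀ v ∈ W, f (cst 𝕜 v) ∈ laurentSub W' R) (hW : ∀ a ∈ W', ∀ b ∈ M, a * b ∈ M')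
    (hS : ∀ l ∈ R, ∀ m ∈ S, l + m ∈ S') {x : Kos 𝕜 P Q} (hx : x ∈ kgr W (p + 1) M S) :
    kdiff f x ∈ kgr W p M' S' :=
  contr_mem_wedgeDeg _ (fun v hv _ hF => mul_mem_laurentSub hW hS (hf v hv) hF) hx

end Laurent

section Idempotent

variable {𝕜 V A : Type*} [Field 𝕜] [AddCommGroup V] [Module 𝕜 V] [CommRing A] [Algebra 𝕜 A]

/-- The endomorphism of `⋀ V ⊗ A` induced by an endomorphism of `V`. -/
def vmap (A : Type*) [CommRing A] [Algebra 𝕜 A] (g : V →ₗ[𝕜] V) :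
    ExteriorAlgebra 𝕜 V ⊗[𝕜] A →ₐ[𝕜] ExteriorAlgebra 𝕜 V ⊗[𝕜] A :=
  Algebra.TensorProduct.map (ExteriorAlgebra.map g) (AlgHom.id 𝕜 A)

@[simp] theorem vmap_vec (g : V →ₗ[𝕜] V) (v : V) : vmap A g (vec 𝕜 A v) = vec 𝕜 A (g v) := by
  simp [vmap, vec]

@[simp] theorem vmap_scal (g : V →ₗ[𝕜] V) (a : A) : vmap A g (scal 𝕜 V a) = scal 𝕜 V a := by
  simp [vmap, scal]

theorem vmap_vmap (g h : V →ₗ[𝕜] V) (x : ExteriorAlgebra 𝕜 V ⊗[𝕜] A) :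
    vmap A g (vmap A h x) = vmap A (g ∘ₗ h) x := by
  suffices H : (vmap A g).comp (vmap A h) = vmap A (g ∘ₗ h) from DFunLike.congr_fun H x
  refine algHom_ext_vec_scal (fun v => ?_) fun a => ?_ <;> simp

theorem vmap_sub_smulRight (ξ : V →ₗ[𝕜] 𝕜) (w : V) (x : ExteriorAlgebra 𝕜 V ⊗[𝕜] A) :
    vmap A (LinearMap.id - ξ.smulRight w) x =
      x - vec 𝕜 A w * contr (Algebra.linearMap 𝕜 A ∘ₗ ξ) x := by
  induction x using vec_scal_induction with
  | scal_mem a => rw [vmap_scal, contr_scal, mul_zero, sub_zero]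
  | add x y hx hy => rw [map_add, hx, hy, map_add, mul_add]; abel
  | vec_mul v x hx =>
    have h : scal 𝕜 V ((Algebra.linearMap 𝕜 A ∘ₗ ξ) v) * x = ξ v • x := by
      rw [LinearMap.comp_apply, Algebra.linearMap_apply, AlgHom.commutes, Algebra.smul_def]
    rw [map_mul, hx, vmap_vec, contr_vec_mul, h]
    simp only [LinearMap.sub_apply, LinearMap.id_apply, LinearMap.smulRight_apply, map_sub,
      map_smul, mul_sub, sub_mul, smul_mul_assoc, mul_smul_comm]
    rw [← mul_assoc (vec 𝕜 A w), ← mul_assoc (vec 𝕜 A w), vec_mul_self, zero_mul, smul_zero,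
      ← mul_assoc (vec 𝕜 A v), vec_mul_vec v w]
    simp only [neg_mul]
    abel

variable {W : Submodule 𝕜 V} {p : ℕ} {N : Submodule 𝕜 A}

theorem contr_vmap {f : V →ₗ[𝕜] A} {g : V →ₗ[𝕜] V} (hg : ∀ v, f (g v) = f v)
    (x : ExteriorAlgebra 𝕜 V ⊗[𝕜] A) : contr f (vmap A g x) = vmap A g (contr f x) := by
  refine map_contr (vmap A g) f f (AlgHom.id 𝕜 A) (fun a => vmap_scal g a) (fun v x => ?_) x
  rw [vmap_vec, contr_vec_mul, hg]; rfl

theorem vmap_mem_wedgeDeg {g : V →ₗ[𝕜] V} (hg : ∀ v ∈ W, g v ∈ W)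
    {x : ExteriorAlgebra 𝕜 V ⊗[𝕜] A} (hx : x ∈ wedgeDeg W p N) : vmap A g x ∈ wedgeDeg W p N := by
  refine wedgeDeg_induction (motive := fun p x => vmap A g x ∈ wedgeDeg W p N) ?_ ?_ ?_ hx
  · intro a ha; rw [vmap_scal]; exact scal_mem_wedgeDeg ha
  · intro p x y hx hy; rw [map_add]; exact add_mem hx hy
  · intro p v hv x _ hx
    rw [map_mul, vmap_vec]; exact vec_mul_mem_wedgeDeg (hg v hv) hx

theorem vmap_congr {g g' : V →ₗ[𝕜] V} (hg : ∀ v ∈ W, g v = g' v)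
    {x : ExteriorAlgebra 𝕜 V ⊗[𝕜] A} (hx : x ∈ wedgeDeg W p N) : vmap A g x = vmap A g' x := by
  refine wedgeDeg_induction (motive := fun p x => vmap A g x = vmap A g' x) ?_ ?_ ?_ hx
  · intro a _; rw [vmap_scal, vmap_scal]
  · intro p x y hx hy; rw [map_add, map_add, hx, hy]
  · intro p v hv x _ hx
    rw [map_mul, map_mul, vmap_vec, vmap_vec, hg v hv, hx]

/-- If an idempotent `e` preserves the map defining the Koszul differential, a Koszul cycle and its
image under `e` differ by multiples of vectors killed by `e`. -/
theorem sub_vmap_mem_span [FiniteDimensional 𝕜 W] {f : V →ₗ[𝕜] A} {e : V →ₗ[𝕜] V}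
    (hee : ∀ v, e (e v) = e v) (heW : ∀ v ∈ W, e v ∈ W) (hfe : ∀ v, f (e v) = f v)
    {x : ExteriorAlgebra 𝕜 V ⊗[𝕜] A} (hx : x ∈ wedgeDeg W (p + 1) N) (hfx : contr f x = 0) :
    x - vmap A e x ∈ Submodule.span 𝕜 {y | ∃ w ∈ W, e w = 0 ∧ ∃ z ∈ wedgeDeg W p N,
      contr f z = 0 ∧ y = vec 𝕜 A w * z} := by
  classical
  set K : Submodule 𝕜 V := W ⊓ LinearMap.ker e
  have : FiniteDimensional 𝕜 K := Submodule.finiteDimensional_of_le inf_le_left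
  obtain ⟨r, hr⟩ := LinearMap.exists_leftInverse_of_injective K.subtype
    (LinearMap.ker_eq_bot.2 K.subtype_injective)
  have hr' : ∀ v : K, r v = v := fun v => LinearMap.congr_fun hr v
  let B := Module.finBasis 𝕜 K
  let ξ : Fin (Module.finrank 𝕜 K) → V →ₗ[𝕜] 𝕜 := fun i => B.coord i ∘ₗ r ∘ₗ (LinearMap.id - e)
  have hB : ∀ i, (B i : V) ∈ W ∧ e (B i) = 0 := fun i => ⟨(B i).2.1, (B i).2.2⟩
  have hξB : ∀ i j, i ≠ j → ξ i (B j) = 0 := by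
    intro i j hij
    have : ξ i (B j) = B.coord i (r (B j - e (B j))) := rfl
    rw [this, (hB j).2, sub_zero, hr', Module.Basis.coord_apply, B.repr_self,
      Finsupp.single_eq_of_ne hij]
  have hξ : ∀ v ∈ W, ∑ i, ξ i v • (B i : V) = v - e v := by
    intro v hv
    have hk : v - e v ∈ K := ⟨sub_mem hv (heW v hv), by simp [hee]⟩
    have h := congrArg (Subtype.val) (B.sum_repr (r (v - e v)))
    rw [hr' ⟨_, hk⟩] at h
    refine Eq.trans ?_ h
    rw [AddSubmonoidClass.coe_finsetSum]
    refine Finset.sum_congr rfl fun i _ => ?_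
    have : ξ i v = B.coord i (r (v - e v)) := rfl
    rw [this, hr' ⟨_, hk⟩]; rfl
  let g : Finset (Fin (Module.finrank 𝕜 K)) → V →ₗ[𝕜] V := fun s =>
    LinearMap.id - ∑ i ∈ s, (ξ i).smulRight (B i : V)
  have hgv : ∀ s v, g s v = v - ∑ i ∈ s, ξ i v • (B i : V) := fun s v => by
    simp [g, LinearMap.sum_apply]
  have hfg : ∀ s v, f (g s v) = f v := by
    intro s v
    rw [hgv, map_sub, map_sum, Finset.sum_eq_zero, sub_zero]
    intro i _
    rw [map_smul, ← hfe, (hB i).2, map_zero, smul_zero]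
  have hgW : ∀ s, ∀ v ∈ W, g s v ∈ W := by
    intro s v hv
    rw [hgv]
    exact sub_mem hv (sum_mem fun i _ => W.smul_mem _ (hB i).1)
  have hgs : ∀ s, x - vmap A (g s) x ∈ Submodule.span 𝕜 {y | ∃ w ∈ W, e w = 0 ∧
      ∃ z ∈ wedgeDeg W p N, contr f z = 0 ∧ y = vec 𝕜 A w * z} := by
    intro s
    induction s using Finset.induction_on with
    | empty =>
      have : vmap A (g ∅) x = x := by
        have := vmap_congr (A := A) (g := g ∅) (g' := LinearMap.id) (fun v _ => by rw [hgv]; simp)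
          hx
        rw [this, vmap]
        simp
      rw [this, sub_self]; exact zero_mem _
    | insert a s has ih =>
      have hcomp : g (insert a s) = (LinearMap.id - (ξ a).smulRight (B a : V)) ∘ₗ g s := by
        ext v
        have h0 : ξ a (g s v) = ξ a v := by
          rw [hgv, map_sub, map_sum, Finset.sum_eq_zero, sub_zero]
          intro i hi
          rw [map_smul, hξB a i (fun h => has (h ▸ hi)), smul_zero]
        have h1 : ((LinearMap.id - (ξ a).smulRight (B a : V)) ∘ₗ g s) v =
            g s v - ξ a (g s v) • (B a : V) := rfl
        rw [h1, h0, hgv, hgv, Finset.sum_insert has]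
        abel
      rw [hcomp, ← vmap_vmap, vmap_sub_smulRight, ← sub_add]
      refine add_mem ih (Submodule.subset_span ⟨_, (hB a).1, (hB a).2, _, ?_, ?_, rfl⟩)
      · refine contr_mem_wedgeDeg _ (fun v _ b hb => ?_) (vmap_mem_wedgeDeg (hgW s) hx)
        rw [LinearMap.comp_apply, Algebra.linearMap_apply, ← Algebra.smul_def]
        exact N.smul_mem _ hb
      · rw [contr_anticomm, contr_vmap (hfg s), hfx, map_zero, map_zero, neg_zero]
  have := hgs Finset.univ
  rwa [vmap_congr (A := A) (g' := e) (fun v hv => by rw [hgv, hξ v hv]; abel) hx] at this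

end Idempotent

section Multigraded

open LaurentPolynomial (T)
open scoped LaurentPolynomial

variable {k : ℕ}

/-- The homogeneous coordinate ring of a product of projective spaces. -/
abbrev CoordRing (𝕜 : Type*) [Field 𝕜] (n : Fin k → ℕ) := MvPolynomial ((j : Fin k) × Fin (n j + 1)) 𝕜

/-- The component of `CoordRing 𝕜 n` of multidegree `c`. -/
abbrev comp (𝕜 : Type*) [Field 𝕜] (n : Fin k → ℕ) (c : Fin k → ℤ) : Submodule 𝕜 (CoordRing 𝕜 n) :=
  component 𝕜 (fun x => Pi.single x.1 1) c

/-- The variable `x^{(j)}_i`, extended by zero to all integers `i`. -/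
def xv (𝕜 : Type*) [Field 𝕜] (n : Fin k → ℕ) (j : Fin k) (i : ℤ) : CoordRing 𝕜 n :=
  if h : 0 ≤ i ∧ i ≤ n j then X ⟨j, ⟨i.toNat, by omega⟩⟩ else 0

/-- The algebra homomorphism out of `CoordRing 𝕜 n` with given values on variables. -/
def xhom {𝕜 : Type*} [Field 𝕜] (n : Fin k → ℕ) {A : Type*} [CommRing A] [Algebra 𝕜 A]
    (g : Fin k → ℤ → A) : CoordRing 𝕜 n →ₐ[𝕜] A :=
  aeval fun x => g x.1 (x.2 : ℕ)

variable {𝕜 : Type*} [Field 𝕜] {n n' : Fin k → ℕ} {A : Type*} [CommRing A] [Algebra 𝕜 A]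

theorem xv_of_range {j : Fin k} {i : ℤ} (h₀ : 0 ≤ i) (h₁ : i ≤ n j) :
    xv 𝕜 n j i = X ⟨j, ⟨i.toNat, by omega⟩⟩ := dif_pos ⟨h₀, h₁⟩

theorem xv_of_neg {j : Fin k} {i : ℤ} (h : i < 0) : xv 𝕜 n j i = 0 := dif_neg (by omega)

theorem xv_of_gt {j : Fin k} {i : ℤ} (h : (n j : ℤ) < i) : xv 𝕜 n j i = 0 := dif_neg (by omega)

theorem xhom_xv (g : Fin k → ℤ → A) {j : Fin k} {i : ℤ} (h₀ : 0 ≤ i) (h₁ : i ≤ n j) :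
    xhom (𝕜 := 𝕜) n g (xv 𝕜 n j i) = g j i := by
  rw [xv_of_range h₀ h₁, xhom, aeval_X]
  congr; simp [h₀]

theorem X_eq_xv (x : (j : Fin k) × Fin (n j + 1)) : (X x : CoordRing 𝕜 n) = xv 𝕜 n x.1 (x.2 : ℕ) := by
  rw [xv_of_range (Int.natCast_nonneg _) (by omega)]
  rfl

theorem xv_algHom_ext {F G : CoordRing 𝕜 n →ₐ[𝕜] A}
    (h : ∀ j, ∀ i : ℤ, 0 ≤ i → i ≤ n j → F (xv 𝕜 n j i) = G (xv 𝕜 n j i)) : F = G :=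
  MvPolynomial.algHom_ext fun x => by
    rw [X_eq_xv]; exact h _ _ (Int.natCast_nonneg _) (by omega)

theorem xv_mem_comp (j : Fin k) (i : ℤ) : xv 𝕜 n j i ∈ comp 𝕜 n (Pi.single j 1) := by
  by_cases h : 0 ≤ i ∧ i ≤ n j
  · rw [xv_of_range h.1 h.2]
    exact (mem_weightedHomogeneousSubmodule _ _ _ _).2 (isWeightedHomogeneous_X 𝕜 _ _)
  · rw [xv, dif_neg h]; exact zero_mem _

theorem one_mem_comp : (1 : CoordRing 𝕜 n) ∈ comp 𝕜 n 0 :=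
  (mem_weightedHomogeneousSubmodule _ _ _ _).2 (isWeightedHomogeneous_one 𝕜 _)

theorem mul_mem_comp {c c' c'' : Fin k → ℤ} (h : c + c' = c'') {a b : CoordRing 𝕜 n}
    (ha : a ∈ comp 𝕜 n c) (hb : b ∈ comp 𝕜 n c') : a * b ∈ comp 𝕜 n c'' := by
  subst h
  exact (mem_weightedHomogeneousSubmodule _ _ _ _).2
    (IsWeightedHomogeneous.mul ((mem_weightedHomogeneousSubmodule _ _ _ _).1 ha)
      ((mem_weightedHomogeneousSubmodule _ _ _ _).1 hb))

theorem comp_induction {motive : (Fin k → ℤ) → CoordRing 𝕜 n → Prop} (zero : ∀ c, motive c 0)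
    (add : ∀ c a b, a ∈ comp 𝕜 n c → b ∈ comp 𝕜 n c → motive c a → motive c b → motive c (a + b))
    (algebraMap : ∀ r : 𝕜, motive 0 (algebraMap 𝕜 _ r))
    (mul : ∀ j, ∀ i : ℤ, 0 ≤ i → i ≤ n j → ∀ c, ∀ a ∈ comp 𝕜 n c, motive c a →
      motive (Pi.single j 1 + c) (xv 𝕜 n j i * a))
    {c : Fin k → ℤ} {a : CoordRing 𝕜 n} (ha : a ∈ comp 𝕜 n c) : motive c a := by
  classical
  have ha' : ∀ m, coeff m a ≠ 0 → Finsupp.weight (fun x => Pi.single x.1 (1 : ℤ)) m = c :=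
    fun m hm => (mem_weightedHomogeneousSubmodule _ _ _ _).1 ha hm
  have mon : ∀ (s : Multiset ((j : Fin k) × Fin (n j + 1))) (r : 𝕜),
      monomial (Multiset.toFinsupp s) r ∈ comp 𝕜 n
        (Finsupp.weight (fun x => Pi.single x.1 (1 : ℤ)) (Multiset.toFinsupp s)) ∧
      motive (Finsupp.weight (fun x => Pi.single x.1 (1 : ℤ)) (Multiset.toFinsupp s))
        (monomial (Multiset.toFinsupp s) r) := by
    intro s r
    refine ⟨(mem_weightedHomogeneousSubmodule _ _ _ _).2
      (isWeightedHomogeneous_monomial _ _ _ rfl), ?_⟩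
    induction s using Multiset.induction with
    | empty => simpa using algebraMap r
    | cons x s ih =>
      rw [← Multiset.singleton_add, Multiset.toFinsupp_add, Multiset.toFinsupp_singleton, map_add,
        Finsupp.weight_single, one_smul, ← mul_one r, mul_comm r, ← monomial_mul, ← X, X_eq_xv]
      exact mul _ _ (Int.natCast_nonneg _) (by omega) _ _
        ((mem_weightedHomogeneousSubmodule _ _ _ _).2 (isWeightedHomogeneous_monomial _ _ _ rfl)) ih
  suffices h : ∀ s : Finset (((j : Fin k) × Fin (n j + 1)) →₀ ℕ),
      (∑ m ∈ s, monomial m (coeff m a)) ∈ comp 𝕜 n c ∧ motive c (∑ m ∈ s, monomial m (coeff m a)) by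
    rw [← support_sum_monomial_coeff a]
    exact (h _).2
  intro s
  induction s using Finset.induction_on with
  | empty => simpa using zero c
  | insert m s hm ih =>
    rw [Finset.sum_insert hm]
    by_cases h : coeff m a = 0
    · rw [h, monomial_zero, zero_add]; exact ih
    · have := mon (Finsupp.toMultiset m) (coeff m a)
      rw [Finsupp.toMultiset_toFinsupp, ha' m h] at this
      exact ⟨add_mem this.1 ih.1, add _ _ _ this.1 ih.1 this.2 ih.2⟩

theorem comp_eq_zero {c : Fin k → ℤ} {j : Fin k} (hc : c j < 0) {a : CoordRing 𝕜 n}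
    (ha : a ∈ comp 𝕜 n c) : a = 0 := by
  refine comp_induction (motive := fun c a => c j < 0 → a = 0) ?_ ?_ ?_ ?_ ha hc
  · intro c _; rfl
  · intro c a b _ _ h h' hc; rw [h hc, h' hc, add_zero]
  · intro r h; exact absurd h (lt_irrefl _)
  · intro l i _ _ c a _ h hc
    rw [h, mul_zero]
    have : (0 : ℤ) ≤ (Pi.single l 1 : Fin k → ℤ) j := by
      by_cases h : j = l
      · subst h; simp
      · rw [Pi.single_eq_of_ne h]
    rw [Pi.add_apply] at hc
    omega

instance finiteDimensional_comp (c : Fin k → ℤ) : FiniteDimensional 𝕜 (comp 𝕜 n c) := by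
  have h : comp 𝕜 n c ≤ restrictTotalDegree _ 𝕜 (∑ j, c j).toNat := by
    intro a ha
    rw [mem_restrictTotalDegree, totalDegree]
    refine Finset.sup_le fun m hm => ?_
    rw [← (mem_weightedHomogeneousSubmodule _ _ _ _).1 ha (mem_support_iff.1 hm),
      Finsupp.weight_eq_sum, Finsupp.sum_fintype _ _ fun _ => rfl]
    simp only [Finset.sum_apply]
    rw [Finset.sum_comm]
    simp [← Finset.mul_sum, ← Nat.cast_sum]
  exact Submodule.finiteDimensional_of_le h

/-- Homomorphisms between the rings of Laurent polynomials over `CoordRing`, given on variables. -/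
def lhom (n : Fin k → ℕ) {n' : Fin k → ℕ} (g : Fin k → ℤ → (CoordRing 𝕜 n')[T;T⁻¹]) (ε : ℤ) :
    (CoordRing 𝕜 n)[T;T⁻¹] →ₐ[𝕜] (CoordRing 𝕜 n')[T;T⁻¹] :=
  laurentLift (xhom n g) ε

theorem lhom_xv {g : Fin k → ℤ → (CoordRing 𝕜 n')[T;T⁻¹]} {ε : ℤ} {j : Fin k} {i : ℤ} (h₀ : 0 ≤ i)
    (h₁ : i ≤ n j) : lhom n g ε (cst 𝕜 (xv 𝕜 n j i)) = g j i := by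
  rw [lhom, laurentLift_cst, xhom_xv _ h₀ h₁]

/-- A version of `lhom_xv` for out of range indices. -/
theorem lhom_xv' {g : Fin k → ℤ → (CoordRing 𝕜 n')[T;T⁻¹]} {ε : ℤ} {j : Fin k} {i : ℤ}
    (h : ¬ (0 ≤ i ∧ i ≤ n j) → g j i = 0) : lhom n g ε (cst 𝕜 (xv 𝕜 n j i)) = g j i := by
  by_cases hi : 0 ≤ i ∧ i ≤ n j
  · exact lhom_xv hi.1 hi.2
  · rw [h hi, xv, dif_neg hi, map_zero, map_zero]

theorem lhom_T (g : Fin k → ℤ → (CoordRing 𝕜 n')[T;T⁻¹]) (ε m : ℤ) : lhom n g ε (T m) = T (ε * m) :=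
  laurentLift_T _ _ _

theorem lhom_ext {F G : (CoordRing 𝕜 n)[T;T⁻¹] →ₐ[𝕜] A}
    (hx : ∀ j, ∀ i : ℤ, 0 ≤ i → i ≤ n j → F (cst 𝕜 (xv 𝕜 n j i)) = G (cst 𝕜 (xv 𝕜 n j i)))
    (hT : ∀ m, F (T m) = G (T m)) : F = G := by
  refine laurent_algHom_ext (𝕜 := 𝕜) (fun a => ?_) hT
  have : F.comp (cst 𝕜) = G.comp (cst 𝕜) := xv_algHom_ext hx
  exact DFunLike.congr_fun this a

/-- Homomorphisms respect multidegrees and bounds on exponents if they do so for variables. -/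
theorem lhom_mem {B : (Fin k → ℤ) → Set ℤ} {g : Fin k → ℤ → (CoordRing 𝕜 n')[T;T⁻¹]} {ε : ℤ}
    (hB₀ : 0 ∈ B 0) (hB : ∀ c c', ∀ l ∈ B c, ∀ m ∈ B c', l + m ∈ B (c + c'))
    (hg : ∀ j, ∀ i : ℤ, 0 ≤ i → i ≤ n j →
      g j i ∈ laurentSub (comp 𝕜 n' (Pi.single j 1)) (B (Pi.single j 1)))
    {c : Fin k → ℤ} {a : CoordRing 𝕜 n} (ha : a ∈ comp 𝕜 n c) :
    lhom n g ε (cst 𝕜 a) ∈ laurentSub (comp 𝕜 n' c) (B c) := by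
  refine comp_induction (motive := fun c a => lhom n g ε (cst 𝕜 a) ∈ laurentSub (comp 𝕜 n' c) (B c))
    ?_ ?_ ?_ ?_ ha
  · intro c; rw [map_zero, map_zero]; exact zero_mem _
  · intro c a b _ _ h h'; rw [map_add, map_add]; exact add_mem h h'
  · intro r
    rw [AlgHom.commutes, AlgHom.commutes, ← (cst 𝕜 : CoordRing 𝕜 n' →ₐ[𝕜] _).commutes]
    refine cst_mem_laurentSub ?_ hB₀
    rw [Algebra.algebraMap_eq_smul_one]
    exact Submodule.smul_mem _ _ one_mem_comp
  · intro j i h₀ h₁ c a _ h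
    rw [map_mul, map_mul, lhom_xv h₀ h₁]
    exact mul_mem_laurentSub (fun _ h _ h' => mul_mem_comp rfl h h') (hB _ _) (hg j i h₀ h₁) h

end Multigraded

section Maps

open LaurentPolynomial (T)
open scoped LaurentPolynomial

variable {k : ℕ}

/-- The list of dimensions `n'` is obtained from `n` by decreasing the entry at `j₀` by one. -/
structure IsDrop (n n' : Fin k → ℕ) (j₀ : Fin k) : Prop where
  self : n j₀ = n' j₀ + 1
  of_ne : ∀ j, j ≠ j₀ → n j = n' j

variable (𝕜 : Type*) [Field 𝕜] (n n' : Fin k → ℕ) (j₀ : Fin k)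

/-- The substitution `x_i ↦ x_i - T x_{i-1}` in the group of variables `j₀`. -/
def shear : (CoordRing 𝕜 n)[T;T⁻¹] →ₐ[𝕜] (CoordRing 𝕜 n')[T;T⁻¹] :=
  lhom n (fun j i => cst 𝕜 (xv 𝕜 n' j i) -
    if j = j₀ then cst 𝕜 (xv 𝕜 n' j (i - 1)) * T 1 else 0) 1

/-- The substitution `x_i ↦ x_i`, killing the variables which are not available. -/
def restrictVars : (CoordRing 𝕜 n)[T;T⁻¹] →ₐ[𝕜] (CoordRing 𝕜 n')[T;T⁻¹] :=
  lhom n (fun j i => cst 𝕜 (xv 𝕜 n' j i)) 1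

/-- The sum `∑_{l ≤ i} T ^ (i - l) x_l` over variables of the group `j₀`. -/
def geomVar : ℕ → (CoordRing 𝕜 n)[T;T⁻¹]
  | 0 => cst 𝕜 (xv 𝕜 n j₀ 0)
  | i + 1 => cst 𝕜 (xv 𝕜 n j₀ (i + 1)) + geomVar i * T 1

/-- The inverse of the substitution `shear`. -/
def unshear : (CoordRing 𝕜 n)[T;T⁻¹] →ₐ[𝕜] (CoordRing 𝕜 n)[T;T⁻¹] :=
  lhom n (fun j i => if j = j₀ then geomVar 𝕜 n j₀ i.toNat else cst 𝕜 (xv 𝕜 n j i)) 1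

/-- Reversing the order of variables, and inverting `T`. -/
def revVars : (CoordRing 𝕜 n)[T;T⁻¹] →ₐ[𝕜] (CoordRing 𝕜 n)[T;T⁻¹] :=
  lhom n (fun j i => cst 𝕜 (xv 𝕜 n j (n j - i))) (-1)

/-- The twisted form of `revVars`, with `x_i ↦ -T x_{n_j - i}` in the group `j₀`. -/
def twistRev : (CoordRing 𝕜 n)[T;T⁻¹] →ₐ[𝕜] (CoordRing 𝕜 n)[T;T⁻¹] :=
  lhom n (fun j i => if j = j₀ then -(cst 𝕜 (xv 𝕜 n j (n j - i)) * T 1) else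
    cst 𝕜 (xv 𝕜 n j (n j - i))) (-1)

variable {𝕜 n n' j₀}

@[simp] theorem shear_T (m : ℤ) : shear 𝕜 n n' j₀ (T m) = T m := by rw [shear, lhom_T, one_mul]
@[simp] theorem unshear_T (m : ℤ) : unshear 𝕜 n j₀ (T m) = T m := by rw [unshear, lhom_T, one_mul]
@[simp] theorem restrictVars_T (m : ℤ) : restrictVars 𝕜 n n' (T m) = T m := by
  rw [restrictVars, lhom_T, one_mul]
@[simp] theorem revVars_T (m : ℤ) : revVars 𝕜 n (T m) = T (-1 * m) := by rw [revVars, lhom_T]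
@[simp] theorem twistRev_T (m : ℤ) : twistRev 𝕜 n j₀ (T m) = T (-1 * m) := by rw [twistRev, lhom_T]

theorem shear_xv_self {i : ℤ} (h₁ : i ≤ n j₀) :
    shear 𝕜 n n' j₀ (cst 𝕜 (xv 𝕜 n j₀ i)) =
      cst 𝕜 (xv 𝕜 n' j₀ i) - cst 𝕜 (xv 𝕜 n' j₀ (i - 1)) * T 1 := by
  rw [shear, lhom_xv', if_pos rfl]
  intro h
  rw [if_pos rfl, xv_of_neg (by omega : i < 0), xv_of_neg (by omega : i - 1 < 0), map_zero, zero_mul,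
    sub_zero]

theorem shear_xv_of_ne {j : Fin k} (hj : j ≠ j₀) {i : ℤ} (h : n j = n' j) :
    shear 𝕜 n n' j₀ (cst 𝕜 (xv 𝕜 n j i)) = cst 𝕜 (xv 𝕜 n' j i) := by
  rw [shear, lhom_xv', if_neg hj, sub_zero]
  intro hi
  rw [if_neg hj, xv, dif_neg (by omega), map_zero, sub_zero]

theorem shear_geomVar {i : ℕ} (hi : i ≤ n j₀) :
    shear 𝕜 n n' j₀ (geomVar 𝕜 n j₀ i) = cst 𝕜 (xv 𝕜 n' j₀ i) := by
  induction i with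
  | zero =>
    rw [geomVar, shear_xv_self (by omega), xv_of_neg (by omega : (0 : ℤ) - 1 < 0), map_zero,
      zero_mul, sub_zero]
    rfl
  | succ i ih =>
    rw [geomVar, map_add, map_mul, ih (by omega), shear_xv_self (by omega), shear_T,
      add_sub_cancel_right]
    push_cast; ring

theorem shear_geomVar_top (h : IsDrop n n' j₀) :
    shear 𝕜 n n' j₀ (geomVar 𝕜 n j₀ (n j₀)) = 0 := by
  rw [shear_geomVar le_rfl, xv_of_gt (by have := h.self; omega), map_zero]

theorem unshear_xv_self {i : ℕ} (h : i ≤ n j₀) :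
    unshear 𝕜 n j₀ (cst 𝕜 (xv 𝕜 n j₀ i)) = geomVar 𝕜 n j₀ i := by
  rw [unshear, lhom_xv (by omega) (by omega), if_pos rfl, Int.toNat_natCast]

theorem unshear_xv_of_ne {j : Fin k} (hj : j ≠ j₀) {i : ℤ} :
    unshear 𝕜 n j₀ (cst 𝕜 (xv 𝕜 n j i)) = cst 𝕜 (xv 𝕜 n j i) := by
  rw [unshear, lhom_xv', if_neg hj]
  intro hi
  rw [if_neg hj, xv, dif_neg (by omega), map_zero]

theorem shear_unshear : (shear 𝕜 n n j₀).comp (unshear 𝕜 n j₀) = AlgHom.id 𝕜 _ := by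
  refine lhom_ext (fun j i h₀ h₁ => ?_) fun m => ?_
  · rw [AlgHom.comp_apply, AlgHom.id_apply]
    by_cases hj : j = j₀
    · subst hj
      lift i to ℕ using h₀
      rw [unshear_xv_self (by omega), shear_geomVar (by omega)]
    · rw [unshear_xv_of_ne hj, shear_xv_of_ne hj rfl]
  · simp

theorem unshear_shear : (unshear 𝕜 n j₀).comp (shear 𝕜 n n j₀) = AlgHom.id 𝕜 _ := by
  refine lhom_ext (fun j i h₀ h₁ => ?_) fun m => ?_
  · rw [AlgHom.comp_apply, AlgHom.id_apply]
    by_cases hj : j = j₀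
    · subst hj
      lift i to ℕ using h₀
      rw [shear_xv_self h₁, map_sub, map_mul, unshear_T, unshear_xv_self (by omega)]
      cases i with
      | zero => simp [xv_of_neg, geomVar]
      | succ i =>
        rw [Nat.cast_succ, add_sub_cancel_right, unshear_xv_self (by omega), geomVar,
          add_sub_cancel_right]
    · rw [shear_xv_of_ne hj rfl, unshear_xv_of_ne hj]
  · simp

theorem restrictVars_xv {j : Fin k} {i : ℤ} (h : (n j < i) → (n' j < i)) :
    restrictVars 𝕜 n n' (cst 𝕜 (xv 𝕜 n j i)) = cst 𝕜 (xv 𝕜 n' j i) := by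
  rw [restrictVars, lhom_xv']
  intro hi
  rw [xv, dif_neg (by omega), map_zero]

theorem restrictVars_shear (h : IsDrop n n' j₀) :
    (restrictVars 𝕜 n n').comp (shear 𝕜 n n j₀) = shear 𝕜 n n' j₀ := by
  refine lhom_ext (fun j i h₀ h₁ => ?_) fun m => ?_
  · rw [AlgHom.comp_apply]
    by_cases hj : j = j₀
    · subst hj
      have := h.self
      rw [shear_xv_self h₁, shear_xv_self h₁, map_sub, map_mul, restrictVars_T,
        restrictVars_xv (by omega), restrictVars_xv (by omega)]
    · have := h.of_ne j hj
      rw [shear_xv_of_ne hj rfl, shear_xv_of_ne hj this, restrictVars_xv (by omega)]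
  · simp

theorem IsDrop.le (h : IsDrop n n' j₀) (j : Fin k) : n' j ≤ n j := by
  by_cases hj : j = j₀
  · subst hj; have := h.self; omega
  · exact (h.of_ne j hj).ge

theorem restrictVars_restrictVars (h : IsDrop n n' j₀) :
    (restrictVars 𝕜 n n').comp (restrictVars 𝕜 n' n) = AlgHom.id 𝕜 _ := by
  refine lhom_ext (fun j i h₀ h₁ => ?_) fun m => ?_
  · rw [AlgHom.comp_apply, AlgHom.id_apply]
    have := h.le j
    rw [restrictVars_xv (n := n'), restrictVars_xv (by omega)]
    omega
  · simp

theorem revVars_xv (j : Fin k) (i : ℤ) :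
    revVars 𝕜 n (cst 𝕜 (xv 𝕜 n j i)) = cst 𝕜 (xv 𝕜 n j (n j - i)) := by
  rw [revVars, lhom_xv']
  intro hi
  rw [xv, dif_neg (by omega), map_zero]

theorem twistRev_xv_self (i : ℤ) :
    twistRev 𝕜 n j₀ (cst 𝕜 (xv 𝕜 n j₀ i)) = -(cst 𝕜 (xv 𝕜 n j₀ (n j₀ - i)) * T 1) := by
  rw [twistRev, lhom_xv', if_pos rfl]
  intro hi
  rw [if_pos rfl, xv, dif_neg (by omega), map_zero, zero_mul, neg_zero]

theorem twistRev_xv_of_ne {j : Fin k} (hj : j ≠ j₀) (i : ℤ) :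
    twistRev 𝕜 n j₀ (cst 𝕜 (xv 𝕜 n j i)) = cst 𝕜 (xv 𝕜 n j (n j - i)) := by
  rw [twistRev, lhom_xv', if_neg hj]
  intro hi
  rw [if_neg hj, xv, dif_neg (by omega), map_zero]

theorem revVars_revVars : (revVars 𝕜 n).comp (revVars 𝕜 n) = AlgHom.id 𝕜 _ := by
  refine lhom_ext (fun j i h₀ h₁ => ?_) fun m => ?_
  · rw [AlgHom.comp_apply, AlgHom.id_apply, revVars_xv, revVars_xv, sub_sub_cancel]
  · simp

theorem twistRev_twistRev : (twistRev 𝕜 n j₀).comp (twistRev 𝕜 n j₀) = AlgHom.id 𝕜 _ := by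
  refine lhom_ext (fun j i h₀ h₁ => ?_) fun m => ?_
  · rw [AlgHom.comp_apply, AlgHom.id_apply]
    by_cases hj : j = j₀
    · subst hj
      have : T 1 * T (-1 * 1) = (1 : (CoordRing 𝕜 n)[T;T⁻¹]) := by
        rw [← LaurentPolynomial.T_add]; simp
      rw [twistRev_xv_self, map_neg, map_mul, twistRev_xv_self, twistRev_T, sub_sub_cancel]
      linear_combination cst 𝕜 (xv 𝕜 n j i) * this
    · rw [twistRev_xv_of_ne hj, twistRev_xv_of_ne hj, sub_sub_cancel]
  · simp

theorem shear_revVars (h : IsDrop n n' j₀) :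
    (shear 𝕜 n n' j₀).comp (revVars 𝕜 n) = (twistRev 𝕜 n' j₀).comp (shear 𝕜 n n' j₀) := by
  refine lhom_ext (fun j i h₀ h₁ => ?_) fun m => ?_
  · rw [AlgHom.comp_apply, AlgHom.comp_apply, revVars_xv]
    by_cases hj : j = j₀
    · subst hj
      have := h.self
      rw [shear_xv_self h₁, shear_xv_self (by omega), map_sub, map_mul, twistRev_T,
        twistRev_xv_self, twistRev_xv_self, this]
      have h₁ : ((n' j + 1 : ℕ) : ℤ) - i = n' j - (i - 1) := by push_cast; ring
      have h₂ : (n' j : ℤ) - (i - 1) - 1 = n' j - i := by ring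
      have h₃ : T 1 * T (-1 * 1) = (1 : (CoordRing 𝕜 n')[T;T⁻¹]) := by
        rw [← LaurentPolynomial.T_add]; simp
      rw [h₁, h₂]
      linear_combination -cst 𝕜 (xv 𝕜 n' j (n' j - (i - 1))) * h₃
    · have := h.of_ne j hj
      rw [shear_xv_of_ne hj this, shear_xv_of_ne hj this, twistRev_xv_of_ne hj, this]
  · simp

/-! ### Degrees -/

variable {c : Fin k → ℤ} {a : CoordRing 𝕜 n}

theorem shear_mem (ha : a ∈ comp 𝕜 n c) :
    shear 𝕜 n n' j₀ (cst 𝕜 a) ∈ laurentSub (comp 𝕜 n' c) (Set.Icc 0 (c j₀)) := by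
  refine lhom_mem (B := fun c => Set.Icc 0 (c j₀)) (by simp) ?_ ?_ ha
  · intro c c' l hl m hm
    exact ⟨add_nonneg hl.1 hm.1, add_le_add hl.2 hm.2⟩
  · intro j i _ _
    by_cases hj : j = j₀
    · subst hj
      rw [if_pos rfl, Pi.single_eq_same]
      exact sub_mem (cst_mem_laurentSub (xv_mem_comp _ _) (by simp))
        (cst_mul_T_mem (xv_mem_comp _ _) (by simp))
    · rw [if_neg hj, sub_zero, Pi.single_eq_of_ne (Ne.symm hj)]
      exact cst_mem_laurentSub (xv_mem_comp _ _) (by simp)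

theorem geomVar_mem (i : ℕ) :
    geomVar 𝕜 n j₀ i ∈ laurentSub (comp 𝕜 n (Pi.single j₀ 1)) (Set.Icc 0 i) := by
  induction i with
  | zero => exact cst_mem_laurentSub (xv_mem_comp _ _) (by simp)
  | succ i ih =>
    refine add_mem (cst_mem_laurentSub (xv_mem_comp _ _) (by simp; omega)) ?_
    refine mul_mem_laurentSub (W' := comp 𝕜 n 0) (S' := {1}) ?_ ?_ ih ?_
    · exact fun a ha b hb => mul_mem_comp (add_zero _) ha hb
    · rintro l hl m rfl
      simp only [Set.mem_Icc] at hl ⊢; push_cast; omega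
    · simpa using cst_mul_T_mem (𝕜 := 𝕜) (one_mem_comp (n := n)) (Set.mem_singleton (1 : ℤ))

theorem unshear_mem (ha : a ∈ comp 𝕜 n c) :
    unshear 𝕜 n j₀ (cst 𝕜 a) ∈ laurentSub (comp 𝕜 n c) (Set.Ici 0) := by
  refine lhom_mem (B := fun _ => Set.Ici 0) (by simp) ?_ ?_ ha
  · intro c c' l hl m hm
    exact add_nonneg (Set.mem_Ici.1 hl) (Set.mem_Ici.1 hm)
  · intro j i _ _
    split_ifs with hj
    · subst hj
      exact laurentSub_mono le_rfl (fun m hm => hm.1) (geomVar_mem _)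
    · exact cst_mem_laurentSub (xv_mem_comp _ _) (by simp)

theorem restrictVars_mem (ha : a ∈ comp 𝕜 n c) :
    restrictVars 𝕜 n n' (cst 𝕜 a) ∈ laurentSub (comp 𝕜 n' c) {0} := by
  refine lhom_mem (B := fun _ => {0}) rfl ?_ ?_ ha
  · rintro c c' l rfl m rfl
    rfl
  · intro j i _ _
    exact cst_mem_laurentSub (xv_mem_comp _ _) (by simp)

theorem revVars_mem (ha : a ∈ comp 𝕜 n c) :
    revVars 𝕜 n (cst 𝕜 a) ∈ laurentSub (comp 𝕜 n c) {0} := by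
  refine lhom_mem (B := fun _ => {0}) rfl ?_ ?_ ha
  · rintro c c' l rfl m rfl
    rfl
  · intro j i _ _
    exact cst_mem_laurentSub (xv_mem_comp _ _) (by simp)

theorem twistRev_mem (ha : a ∈ comp 𝕜 n c) :
    twistRev 𝕜 n j₀ (cst 𝕜 a) ∈ laurentSub (comp 𝕜 n c) {c j₀} := by
  refine lhom_mem (B := fun c => {c j₀}) rfl ?_ ?_ ha
  · rintro c c' l rfl m rfl
    rfl
  · intro j i _ _
    by_cases hj : j = j₀
    · subst hj
      rw [if_pos rfl, Pi.single_eq_same]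
      exact neg_mem (cst_mul_T_mem (xv_mem_comp _ _) rfl)
    · rw [if_neg hj, Pi.single_eq_of_ne (Ne.symm hj)]
      exact cst_mem_laurentSub (xv_mem_comp _ _) rfl

end Maps

section Kernel

open LaurentPolynomial (T)
open scoped LaurentPolynomial

variable {k : ℕ}

/-- The part of the Koszul algebra with vectors of multidegree `d`, exterior degree `p`, coefficients
of multidegree `c` and exponents in `S`. -/
abbrev mgr (𝕜 : Type*) [Field 𝕜] (n n' : Fin k → ℕ) (d : Fin k → ℤ) (p : ℕ) (c : Fin k → ℤ)
    (S : Set ℤ) : Submodule 𝕜 (Kos 𝕜 (CoordRing 𝕜 n) (CoordRing 𝕜 n')) :=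
  kgr (comp 𝕜 n d) p (comp 𝕜 n' c) S

/-- The substitution `x_i ↦ x_i` on polynomials, killing the variables which are not available. -/
def restrictPoly (𝕜 : Type*) [Field 𝕜] (n n' : Fin k → ℕ) : CoordRing 𝕜 n →ₐ[𝕜] CoordRing 𝕜 n' :=
  xhom n (xv 𝕜 n')

variable {𝕜 : Type*} [Field 𝕜] {n n' : Fin k → ℕ} {j₀ : Fin k} {c d : Fin k → ℤ}

theorem restrictVars_cst (a : CoordRing 𝕜 n) :
    restrictVars 𝕜 n n' (cst 𝕜 a) = cst 𝕜 (restrictPoly 𝕜 n n' a) := by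
  suffices h : (restrictVars 𝕜 n n').comp (cst 𝕜) = (cst 𝕜).comp (restrictPoly 𝕜 n n') from
    DFunLike.congr_fun h a
  refine xv_algHom_ext fun j i h₀ h₁ => ?_
  rw [AlgHom.comp_apply, AlgHom.comp_apply, restrictVars, lhom_xv h₀ h₁, restrictPoly,
    xhom_xv _ h₀ h₁]

theorem cst_injective {P : Type*} [CommRing P] [Algebra 𝕜 P] :
    Function.Injective (cst 𝕜 : P →ₐ[𝕜] P[T;T⁻¹]) :=
  fun a b h => by simpa [cst] using congrArg (fun F => F.coeff 0) h

theorem restrictPoly_xv {j : Fin k} {i : ℤ} (h₀ : 0 ≤ i) (h₁ : i ≤ n j) :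
    restrictPoly 𝕜 n n' (xv 𝕜 n j i) = xv 𝕜 n' j i := xhom_xv _ h₀ h₁

theorem restrictPoly_restrictPoly (h : IsDrop n n' j₀) (a : CoordRing 𝕜 n') :
    restrictPoly 𝕜 n n' (restrictPoly 𝕜 n' n a) = a := by
  apply cst_injective (𝕜 := 𝕜)
  rw [← restrictVars_cst, ← restrictVars_cst]
  exact DFunLike.congr_fun (restrictVars_restrictVars h) _

theorem restrictPoly_mem {a : CoordRing 𝕜 n} (ha : a ∈ comp 𝕜 n c) :
    restrictPoly 𝕜 n n' a ∈ comp 𝕜 n' c := by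
  have := (restrictVars_mem (n' := n') ha 0).1
  rwa [restrictVars_cst, cst, AddMonoidAlgebra.singleZeroAlgHom_apply,
    AddMonoidAlgebra.coeff_single, Finsupp.single_eq_same] at this

/-- Polynomials killed by setting the last variable of the group `j₀` to zero are multiples of this
variable. -/
theorem exists_sub_restrictPoly_eq_mul (h : IsDrop n n' j₀) {a : CoordRing 𝕜 n}
    (ha : a ∈ comp 𝕜 n c) : ∃ b ∈ comp 𝕜 n (c - Pi.single j₀ 1),
      a - restrictPoly 𝕜 n' n (restrictPoly 𝕜 n n' a) = xv 𝕜 n j₀ (n j₀) * b := by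
  refine comp_induction (motive := fun c a => ∃ b ∈ comp 𝕜 n (c - Pi.single j₀ 1),
      a - restrictPoly 𝕜 n' n (restrictPoly 𝕜 n n' a) = xv 𝕜 n j₀ (n j₀) * b) ?_ ?_ ?_ ?_ ha
  · intro c
    exact ⟨0, zero_mem _, by simp⟩
  · rintro c a a' _ _ ⟨b, hb, hab⟩ ⟨b', hb', hab'⟩
    refine ⟨b + b', add_mem hb hb', ?_⟩
    rw [map_add, map_add, mul_add, ← hab, ← hab']; ring
  · intro r
    refine ⟨0, zero_mem _, ?_⟩
    rw [AlgHom.commutes, AlgHom.commutes, sub_self, mul_zero]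
  · rintro j i h₀ h₁ c a ha ⟨b, hb, hab⟩
    by_cases hi : j = j₀ ∧ i = n j₀
    · obtain ⟨rfl, rfl⟩ := hi
      refine ⟨a, by rwa [add_sub_cancel_left], ?_⟩
      have := h.self
      rw [map_mul, restrictPoly_xv h₀ h₁, xv_of_gt (n := n') (by omega), zero_mul, map_zero, sub_zero]
    · refine ⟨xv 𝕜 n j i * b, mul_mem_comp (by abel) (xv_mem_comp j i) hb, ?_⟩
      have hi' : i ≤ n' j := by
        by_cases hj : j = j₀
        · subst hj; have := h.self; omega
        · rw [← h.of_ne j hj]; exact h₁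
      have hx : restrictPoly 𝕜 n' n (restrictPoly 𝕜 n n' (xv 𝕜 n j i)) = xv 𝕜 n j i := by
        rw [restrictPoly_xv h₀ h₁, restrictPoly_xv h₀ hi']
      rw [map_mul, map_mul, hx, ← mul_sub, hab]; ring

/-- Cycles killed by the restriction to a smaller product of projective spaces. -/
theorem mem_span_of_kmap_shear_eq_zero (h : IsDrop n n' j₀) {S : Set ℤ}
    (hS : ∀ m ∈ S, ∀ l, 0 ≤ l → l + m ∈ S) {p : ℕ} {x : Kos 𝕜 (CoordRing 𝕜 n) (CoordRing 𝕜 n')}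
    (hx : x ∈ mgr 𝕜 n n' d (p + 1) c S) (hD : kdiff (shear 𝕜 n n' j₀) x = 0)
    (hπ : kmap (shear 𝕜 n n' j₀) (AlgHom.id 𝕜 _) x = 0) :
    x ∈ Submodule.span 𝕜 {y | ∃ a ∈ comp 𝕜 n (d - Pi.single j₀ 1), ∃ z ∈ mgr 𝕜 n n' d p c S,
      kdiff (shear 𝕜 n n' j₀) z = 0 ∧
      y = lvec 𝕜 (CoordRing 𝕜 n') (geomVar 𝕜 n j₀ (n j₀) * cst 𝕜 a) * z} := by
  have hid : ∀ m : ℤ, AlgHom.id 𝕜 ((CoordRing 𝕜 n')[T;T⁻¹]) (T m) = T (1 * m) := by simp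
  have hidS : ∀ a ∈ comp 𝕜 n' c, ∀ m ∈ S,
      AlgHom.id 𝕜 ((CoordRing 𝕜 n')[T;T⁻¹]) (cst 𝕜 a * T m) ∈ laurentSub (comp 𝕜 n' c) S :=
    fun a ha m hm => cst_mul_T_mem ha hm
  set e : CoordRing 𝕜 n →ₗ[𝕜] CoordRing 𝕜 n :=
    ((restrictPoly 𝕜 n' n).comp (restrictPoly 𝕜 n n')).toLinearMap with he
  set y := kmap (shear 𝕜 n n j₀) (AlgHom.id 𝕜 (CoordRing 𝕜 n')[T;T⁻¹]) x with hy
  have hyx : kmap (unshear 𝕜 n j₀) (AlgHom.id 𝕜 _) y = x := by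
    refine (kmap_kmap (ε := 1) (by simp) hid x).trans ?_
    rw [unshear_shear]
    exact kmap_id x
  have hyS : y ∈ mgr 𝕜 n n' d (p + 1) c S :=
    kmap_mem_kgr (S' := fun _ => S) (fun v hv => shear_mem hv) hidS
      (fun i l hl m hm => hS m hm l hl.1) hx
  have hyD : kdiff (restrictVars 𝕜 n n') y = 0 := by
    rw [hy, kdiff_kmap (f₁ := shear 𝕜 n n' j₀) (by simp), hD, map_zero]
    intro v
    exact DFunLike.congr_fun (restrictVars_shear h) (cst 𝕜 v)
  have hye : vmap _ e y = 0 := by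
    have h₁ : vmap (CoordRing 𝕜 n')[T;T⁻¹] e =
        (kmap (restrictVars 𝕜 n' n) (AlgHom.id 𝕜 (CoordRing 𝕜 n')[T;T⁻¹])).comp
          (kmap (restrictVars 𝕜 n n') (AlgHom.id 𝕜 (CoordRing 𝕜 n')[T;T⁻¹])) := by
      refine algHom_ext_vec_scal (fun v => ?_) fun a => ?_
      · rw [vmap_vec, AlgHom.comp_apply, kmap_vec, restrictVars_cst, lvec_cst, kmap_vec,
          restrictVars_cst, lvec_cst]
        rfl
      · rw [vmap_scal, AlgHom.comp_apply, kmap_scal, kmap_scal]; rfl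
    have h₂ : kmap (restrictVars 𝕜 n n') (AlgHom.id 𝕜 _) y = 0 := by
      refine (kmap_kmap (ε := 1) (by simp) hid x).trans ?_
      rw [restrictVars_shear h]
      exact hπ
    rw [h₁, AlgHom.comp_apply, h₂, map_zero]
  have key := sub_vmap_mem_span (W := comp 𝕜 n d) (N := laurentSub (comp 𝕜 n' c) S) (e := e)
    (f := (restrictVars 𝕜 n n').toLinearMap ∘ₗ (cst 𝕜).toLinearMap)
    (fun v => by simp [he, restrictPoly_restrictPoly h])
    (fun v hv => restrictPoly_mem (restrictPoly_mem hv))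
    (fun v => by simp [he, restrictVars_cst, restrictPoly_restrictPoly h]) hyS hyD
  rw [hye, sub_zero] at key
  rw [← hyx]
  refine Submodule.span_induction ?_ ?_ ?_ ?_ key
  · rintro _ ⟨w, hw, hew, z, hz, hzD, rfl⟩
    obtain ⟨a, ha, hwa⟩ := exists_sub_restrictPoly_eq_mul h hw
    have hwa : w = xv 𝕜 n j₀ (n j₀) * a := by
      rw [← hwa, eq_comm, sub_eq_self]
      exact hew
    subst hwa
    rw [map_mul, kmap_vec, map_mul, map_mul, unshear_xv_self le_rfl]
    set z' := kmap (unshear 𝕜 n j₀) (AlgHom.id 𝕜 (CoordRing 𝕜 n')[T;T⁻¹]) z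
    have hz' : z' ∈ mgr 𝕜 n n' d p c S :=
      kmap_mem_kgr (S' := fun _ => S) (fun v hv => unshear_mem hv) hidS
        (fun i l hl m hm => hS m hm l hl) hz
    have hzD' : kdiff (shear 𝕜 n n' j₀) z' = 0 := by
      rw [kdiff_kmap (f₁ := restrictVars 𝕜 n n') (by simp)]
      · exact (congrArg _ hzD).trans (map_zero _)
      · intro v
        rw [← restrictVars_shear h, AlgHom.comp_apply, ← AlgHom.comp_apply (shear 𝕜 n n j₀),
          shear_unshear]
        rfl
    refine laurentSub_induction (motive := fun F => lvec 𝕜 (CoordRing 𝕜 n')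
      (geomVar 𝕜 n j₀ (n j₀) * F) * z' ∈ _) ?_ ?_ ?_ (unshear_mem ha)
    · rw [mul_zero, map_zero, zero_mul]; exact zero_mem _
    · intro F G _ _ hF hG
      rw [mul_add, map_add, add_mul]; exact add_mem hF hG
    · intro b hb m hm
      rw [← mul_assoc, lvec_mul_T, mul_assoc]
      refine Submodule.subset_span ⟨b, hb, _, T_mul_mem_kgr (fun l hl => hS l hl m hm) hz', ?_, rfl⟩
      rw [kdiff_scal_mul, hzD', mul_zero]
  · rw [map_zero]; exact zero_mem _
  · intro x y _ _ hx hy; rw [map_add]; exact add_mem hx hy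
  · intro r x _ hx; rw [map_smul]; exact Submodule.smul_mem _ _ hx

end Kernel

section Charts

open LaurentPolynomial (T)
open scoped LaurentPolynomial

variable {k : ℕ} {𝕜 : Type*} [Field 𝕜] {n n' : Fin k → ℕ} {j₀ : Fin k} {c d : Fin k → ℤ}
  {S S' : Set ℤ} {p : ℕ}

variable (𝕜 n n' j₀) in
/-- The homomorphism of Koszul algebras induced by `shear` on vectors. -/
def descend : Kos 𝕜 (CoordRing 𝕜 n) (CoordRing 𝕜 n') →ₐ[𝕜] Kos 𝕜 (CoordRing 𝕜 n') (CoordRing 𝕜 n') :=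
  kmap (shear 𝕜 n n' j₀) (AlgHom.id 𝕜 _)

variable (𝕜 n n' j₀) in
/-- A section of `descend`. -/
def ascend : Kos 𝕜 (CoordRing 𝕜 n') (CoordRing 𝕜 n') →ₐ[𝕜] Kos 𝕜 (CoordRing 𝕜 n) (CoordRing 𝕜 n') :=
  kmap ((unshear 𝕜 n j₀).comp (restrictVars 𝕜 n' n)) (AlgHom.id 𝕜 _)

variable (𝕜 n n' j₀) in
/-- The involution reversing the variables. -/
def flipVars : Kos 𝕜 (CoordRing 𝕜 n) (CoordRing 𝕜 n') →ₐ[𝕜] Kos 𝕜 (CoordRing 𝕜 n) (CoordRing 𝕜 n') :=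
  kmap (revVars 𝕜 n) (twistRev 𝕜 n' j₀)

variable (𝕜 n j₀) in
/-- The involution reversing the variables, in the smaller product of projective spaces. -/
def flipTwist : Kos 𝕜 (CoordRing 𝕜 n) (CoordRing 𝕜 n) →ₐ[𝕜] Kos 𝕜 (CoordRing 𝕜 n) (CoordRing 𝕜 n) :=
  kmap (twistRev 𝕜 n j₀) (twistRev 𝕜 n j₀)

variable (𝕜 n) in
/-- The Koszul differential of `CoordRing 𝕜 n` with Laurent coefficients. -/
abbrev koszulD : Kos 𝕜 (CoordRing 𝕜 n) (CoordRing 𝕜 n) →ₗ[𝕜] Kos 𝕜 (CoordRing 𝕜 n) (CoordRing 𝕜 n) :=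
  kdiff (AlgHom.id 𝕜 _)

variable (𝕜 n n' j₀) in
/-- The Koszul differential of `shear`. -/
abbrev shearD :
    Kos 𝕜 (CoordRing 𝕜 n) (CoordRing 𝕜 n') →ₗ[𝕜] Kos 𝕜 (CoordRing 𝕜 n) (CoordRing 𝕜 n') :=
  kdiff (shear 𝕜 n n' j₀)

theorem id_T (m : ℤ) : AlgHom.id 𝕜 ((CoordRing 𝕜 n')[T;T⁻¹]) (T m) = T (1 * m) := by simp

theorem shear_unshear_restrictVars (h : IsDrop n n' j₀) :
    (shear 𝕜 n n' j₀).comp ((unshear 𝕜 n j₀).comp (restrictVars 𝕜 n' n)) = AlgHom.id 𝕜 _ := by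
  rw [← restrictVars_shear h, AlgHom.comp_assoc, ← AlgHom.comp_assoc _ (unshear 𝕜 n j₀),
    shear_unshear, AlgHom.id_comp, restrictVars_restrictVars h]

theorem descend_ascend (h : IsDrop n n' j₀) (x) :
    descend 𝕜 n n' j₀ (ascend 𝕜 n n' j₀ x) = x := by
  refine (kmap_kmap (ε := 1) (by simp) id_T x).trans ?_
  rw [shear_unshear_restrictVars h]
  exact kmap_id x

theorem flipVars_flipVars (x) : flipVars 𝕜 n n' j₀ (flipVars 𝕜 n n' j₀ x) = x := by
  refine (kmap_kmap (ε := -1) (by simp) (by simp) x).trans ?_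
  rw [revVars_revVars, twistRev_twistRev]
  exact kmap_id x

theorem flipTwist_flipTwist (x) : flipTwist 𝕜 n j₀ (flipTwist 𝕜 n j₀ x) = x := by
  refine (kmap_kmap (ε := -1) (by simp) (by simp) x).trans ?_
  rw [twistRev_twistRev]
  exact kmap_id x

theorem descend_flipVars (h : IsDrop n n' j₀) (x) :
    descend 𝕜 n n' j₀ (flipVars 𝕜 n n' j₀ x) = flipTwist 𝕜 n' j₀ (descend 𝕜 n n' j₀ x) := by
  refine (kmap_kmap (ε := 1) (by simp) id_T x).trans ?_
  refine Eq.trans ?_ (kmap_kmap (ε := -1) (by simp) (by simp) x).symm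
  rw [shear_revVars h]
  rfl

theorem koszulD_descend (x) :
    koszulD 𝕜 n' (descend 𝕜 n n' j₀ x) = descend 𝕜 n n' j₀ (shearD 𝕜 n n' j₀ x) :=
  kdiff_kmap (fun _ => rfl) (fun _ => rfl) x

theorem shearD_ascend (h : IsDrop n n' j₀) (x) :
    shearD 𝕜 n n' j₀ (ascend 𝕜 n n' j₀ x) = ascend 𝕜 n n' j₀ (koszulD 𝕜 n' x) :=
  kdiff_kmap (by simp) (fun v => DFunLike.congr_fun (shear_unshear_restrictVars h) (cst 𝕜 v)) x

theorem shearD_flipVars (h : IsDrop n n' j₀) (x) :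
    shearD 𝕜 n n' j₀ (flipVars 𝕜 n n' j₀ x) = flipVars 𝕜 n n' j₀ (shearD 𝕜 n n' j₀ x) :=
  kdiff_kmap (by simp) (fun v => DFunLike.congr_fun (shear_revVars h) (cst 𝕜 v)) x

theorem koszulD_flipTwist (x) :
    koszulD 𝕜 n (flipTwist 𝕜 n j₀ x) = flipTwist 𝕜 n j₀ (koszulD 𝕜 n x) :=
  kdiff_kmap (fun _ => by rw [AlgHom.id_apply]) (fun v => by rw [AlgHom.id_apply, AlgHom.id_apply]) x

theorem descend_mem (hS : ∀ m ∈ S, ∀ l, 0 ≤ l → l + m ∈ S) {x} (hx : x ∈ mgr 𝕜 n n' d p c S) :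
    descend 𝕜 n n' j₀ x ∈ mgr 𝕜 n' n' d p c S :=
  kmap_mem_kgr (S' := fun _ => S) (fun _ hv => shear_mem hv) (fun _ ha _ hm => cst_mul_T_mem ha hm)
    (fun _ l hl m hm => hS m hm l hl.1) hx

theorem ascend_mem (hS : ∀ m ∈ S, ∀ l, 0 ≤ l → l + m ∈ S) {x} (hx : x ∈ mgr 𝕜 n' n' d p c S) :
    ascend 𝕜 n n' j₀ x ∈ mgr 𝕜 n n' d p c S := by
  refine kmap_mem_kgr (S' := fun _ => S) (R := Set.Ici 0) (fun v hv => ?_)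
    (fun _ ha _ hm => cst_mul_T_mem ha hm) (fun _ l hl m hm => hS m hm l hl) hx
  rw [AlgHom.comp_apply, restrictVars_cst]
  exact unshear_mem (restrictPoly_mem hv)

theorem twistRev_cst_mul_T_mem {a : CoordRing 𝕜 n} (ha : a ∈ comp 𝕜 n c) {m : ℤ}
    (hm : c j₀ - m ∈ S) : twistRev 𝕜 n j₀ (cst 𝕜 a * T m) ∈ laurentSub (comp 𝕜 n c) S := by
  rw [map_mul, twistRev_T]
  refine mul_mem_laurentSub (W' := comp 𝕜 n 0) (S' := {-1 * m}) ?_ ?_ (twistRev_mem ha) ?_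
  · exact fun a ha b hb => mul_mem_comp (add_zero _) ha hb
  · rintro l rfl _ rfl
    convert hm using 1; ring
  · simpa using cst_mul_T_mem (𝕜 := 𝕜) (one_mem_comp (n := n)) (Set.mem_singleton (-1 * m))

theorem flipVars_mem (hS : ∀ m ∈ S, c j₀ - m ∈ S') {x} (hx : x ∈ mgr 𝕜 n n' d p c S) :
    flipVars 𝕜 n n' j₀ x ∈ mgr 𝕜 n n' d p c S' := by
  refine kmap_mem_kgr (S' := fun _ => S') (fun _ hv => revVars_mem hv)
    (fun _ ha m hm => twistRev_cst_mul_T_mem ha (hS m hm)) ?_ hx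
  rintro _ _ rfl m hm
  rwa [zero_add]

theorem flipTwist_mem (hS : ∀ m ∈ S, p * d j₀ + c j₀ - m ∈ S') {x} (hx : x ∈ mgr 𝕜 n n d p c S) :
    flipTwist 𝕜 n j₀ x ∈ mgr 𝕜 n n d p c S' := by
  refine kgr_mono ?_ (kmap_mem_kgr (S' := fun i => {m : ℤ | i * d j₀ + c j₀ - m ∈ S})
    (fun _ hv => twistRev_mem hv) (fun _ ha m hm => twistRev_cst_mul_T_mem ha ?_) ?_ hx)
  · intro m hm
    convert hS _ hm using 1; ring
  · simpa using hm
  · rintro i _ rfl m hm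
    simp only [Set.mem_ofPred_eq] at hm ⊢
    convert hm using 1; push_cast; ring

theorem shearD_mem (hS : ∀ l ∈ Set.Icc 0 (d j₀), ∀ m ∈ S, l + m ∈ S') {x}
    (hx : x ∈ mgr 𝕜 n n' d (p + 1) (c - d) S) : shearD 𝕜 n n' j₀ x ∈ mgr 𝕜 n n' d p c S' :=
  kdiff_mem_kgr (fun _ hv => shear_mem hv) (fun _ ha _ hb => mul_mem_comp (by abel) ha hb) hS hx

theorem koszulD_mem {x} (hx : x ∈ mgr 𝕜 n n d (p + 1) (c - d) S) :
    koszulD 𝕜 n x ∈ mgr 𝕜 n n d p c S :=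
  kdiff_mem_kgr (R := {0}) (W' := comp 𝕜 n d) (fun _ hv => cst_mem_laurentSub hv (Set.mem_singleton 0))
    (fun _ ha _ hb => mul_mem_comp (by abel) ha hb) (by rintro _ rfl m hm; rwa [zero_add]) hx

/-- The multiple of `geomVar` of multidegree `d` by a form. -/
theorem geomVar_mul_mem {a : CoordRing 𝕜 n} (ha : a ∈ comp 𝕜 n (d - Pi.single j₀ 1)) :
    geomVar 𝕜 n j₀ (n j₀) * cst 𝕜 a ∈ laurentSub (comp 𝕜 n d) (Set.Icc 0 (n j₀)) :=
  mul_mem_laurentSub (fun _ ha _ hb => mul_mem_comp (by abel) ha hb)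
    (by rintro l hl _ rfl; rwa [add_zero]) (geomVar_mem _) (cst_mem_laurentSub ha rfl)

theorem shearD_geomVar_mul (h : IsDrop n n' j₀) (a : CoordRing 𝕜 n) (x) :
    shearD 𝕜 n n' j₀ (lvec 𝕜 _ (geomVar 𝕜 n j₀ (n j₀) * cst 𝕜 a) * x) =
      -(lvec 𝕜 _ (geomVar 𝕜 n j₀ (n j₀) * cst 𝕜 a) * shearD 𝕜 n n' j₀ x) := by
  rw [shearD, kdiff_lvec_mul (by simp), map_mul, shear_geomVar_top h, zero_mul, map_zero, zero_mul,
    zero_sub]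

theorem scal_injective {V A : Type*} [AddCommGroup V] [Module 𝕜 V] [CommRing A] [Algebra 𝕜 A] :
    Function.Injective (scal 𝕜 V : A →ₐ[𝕜] _) := by
  have h : Function.LeftInverse ((Algebra.TensorProduct.lid 𝕜 A).toAlgHom.comp
      (Algebra.TensorProduct.map ExteriorAlgebra.algebraMapInv (AlgHom.id 𝕜 A))) (scal 𝕜 V) := by
    intro a; simp [scal]
  exact h.injective

/-- Cycles can be captured by lifting cycles from the smaller product of projective spaces. -/
theorem cycle_mem_of_lift (h : IsDrop n n' j₀) (hS : ∀ m ∈ S, ∀ l, 0 ≤ l → l + m ∈ S) {P : ℕ}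
    (G : ℕ → Submodule 𝕜 (Kos 𝕜 (CoordRing 𝕜 n) (CoordRing 𝕜 n')))
    (lift : ∀ i ≤ P, ∀ z ∈ mgr 𝕜 n' n' d i c S, koszulD 𝕜 n' z = 0 →
      ∃ g ∈ G i, g ∈ mgr 𝕜 n n' d i c S ∧ shearD 𝕜 n n' j₀ g = 0 ∧ descend 𝕜 n n' j₀ g = z)
    (mul : ∀ i < P, ∀ a ∈ comp 𝕜 n (d - Pi.single j₀ 1), ∀ g ∈ G i,
      lvec 𝕜 _ (geomVar 𝕜 n j₀ (n j₀) * cst 𝕜 a) * g ∈ G (i + 1))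
    {i : ℕ} (hi : i ≤ P) {z} (hz : z ∈ mgr 𝕜 n n' d i c S) (hD : shearD 𝕜 n n' j₀ z = 0) :
    z ∈ G i := by
  induction i generalizing z with
  | zero =>
    obtain ⟨g, hgG, hg, hgD, hgz⟩ := lift 0 hi (descend 𝕜 n n' j₀ z) (descend_mem hS hz)
      (by rw [koszulD_descend, hD, map_zero])
    convert hgG
    rw [mgr, kgr, wedgeDeg_zero] at hz hg
    obtain ⟨F, -, rfl⟩ := hz
    obtain ⟨F', -, rfl⟩ := hg
    have h₁ := (kmap_scal (Θ := shear 𝕜 n n' j₀) (ΘA := AlgHom.id 𝕜 _) F').symm.trans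
      (hgz.trans (kmap_scal (Θ := shear 𝕜 n n' j₀) (ΘA := AlgHom.id 𝕜 _) F))
    exact congrArg _ (scal_injective h₁).symm
  | succ i ih =>
    obtain ⟨g, hgG, hg, hgD, hgz⟩ := lift (i + 1) hi (descend 𝕜 n n' j₀ z) (descend_mem hS hz)
      (by rw [koszulD_descend, hD, map_zero])
    rw [← sub_add_cancel z g]
    refine add_mem ?_ hgG
    have := mem_span_of_kmap_shear_eq_zero h hS (sub_mem hz hg)
      (by rw [map_sub, hD]; exact (congrArg _ hgD).trans (sub_zero _))
      ((map_sub (descend 𝕜 n n' j₀) z g).trans (sub_eq_zero.2 hgz.symm))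
    refine Submodule.span_le.2 ?_ this
    rintro _ ⟨a, ha, y, hy, hyD, rfl⟩
    exact mul i hi a ha y (ih (by omega) hy hyD)

/-- Vanishing of Koszul cohomology, with Laurent polynomial coefficients. -/
def KoszulVanishing (𝕜 : Type*) [Field 𝕜] (n : Fin k → ℕ) (d : Fin k → ℤ) (p : ℕ)
    (c : Fin k → ℤ) : Prop :=
  ∀ (S : Set ℤ) (x), x ∈ mgr 𝕜 n n d p c S → koszulD 𝕜 n x = 0 →
    ∃ y ∈ mgr 𝕜 n n d (p + 1) (c - d) S, koszulD 𝕜 n y = x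

/-- The lift of a boundary. -/
theorem exists_boundary_lift (h : IsDrop n n' j₀) (hS : ∀ m ∈ S, ∀ l, 0 ≤ l → l + m ∈ S)
    (hV : KoszulVanishing 𝕜 n' d p c) {z} (hz : z ∈ mgr 𝕜 n' n' d p c S)
    (hD : koszulD 𝕜 n' z = 0) : ∃ w ∈ mgr 𝕜 n n' d (p + 1) (c - d) S,
      descend 𝕜 n n' j₀ (shearD 𝕜 n n' j₀ w) = z := by
  obtain ⟨y, hy, hyz⟩ := hV S z hz hD
  refine ⟨ascend 𝕜 n n' j₀ y, ascend_mem hS hy, ?_⟩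
  rw [shearD_ascend h, hyz, descend_ascend h]

/-- Exactness in the first chart. -/
theorem exists_shearD_eq (h : IsDrop n n' j₀) (hV : ∀ i ≤ p, KoszulVanishing 𝕜 n' d i c) {z}
    (hz : z ∈ mgr 𝕜 n n' d p c (Set.Ici 0)) (hD : shearD 𝕜 n n' j₀ z = 0) :
    ∃ w ∈ mgr 𝕜 n n' d (p + 1) (c - d) (Set.Ici 0), shearD 𝕜 n n' j₀ w = z := by
  have hS : ∀ m ∈ Set.Ici (0 : ℤ), ∀ l, 0 ≤ l → l + m ∈ Set.Ici (0 : ℤ) :=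
    fun m hm l hl => add_nonneg hl hm
  refine cycle_mem_of_lift h hS (P := p)
    (fun i => (mgr 𝕜 n n' d (i + 1) (c - d) (Set.Ici 0)).map (shearD 𝕜 n n' j₀))
    ?_ ?_ le_rfl hz hD
  · intro i hi z hz hzD
    obtain ⟨w, hw, hwz⟩ := exists_boundary_lift (n := n) h hS (hV i hi) hz hzD
    exact ⟨_, Submodule.mem_map_of_mem hw, shearD_mem (fun l hl m hm => hS m hm l hl.1) hw,
      kdiff_kdiff _ _, hwz⟩
  · rintro i hi a ha _ ⟨w, hw, rfl⟩
    rw [← neg_neg (lvec 𝕜 _ _ * _), ← shearD_geomVar_mul h]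
    exact neg_mem (Submodule.mem_map_of_mem
      (lvec_mul_mem_kgr (geomVar_mul_mem ha) (fun l hl m hm => hS m hm l hl.1) hw))

/-- Exactness in the second chart. -/
theorem exists_shearD_eq' (h : IsDrop n n' j₀) (hV : ∀ i ≤ p, KoszulVanishing 𝕜 n' d i c) {e : ℤ}
    {z} (hz : z ∈ mgr 𝕜 n n' d p c (Set.Iic (c j₀ + e))) (hD : shearD 𝕜 n n' j₀ z = 0) :
    ∃ w ∈ mgr 𝕜 n n' d (p + 1) (c - d) (Set.Iic ((c - d) j₀ + e)), shearD 𝕜 n n' j₀ w = z := by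
  have hz' : flipVars 𝕜 n n' j₀ (scal 𝕜 _ (T (-e)) * z) ∈ mgr 𝕜 n n' d p c (Set.Ici 0) := by
    refine flipVars_mem (S := Set.Iic (c j₀)) ?_ (T_mul_mem_kgr ?_ hz)
    · intro m hm
      simp only [Set.mem_Iic, Set.mem_Ici] at hm ⊢; omega
    · intro m hm
      simp only [Set.mem_Iic] at hm ⊢; omega
  obtain ⟨w, hw, hwz⟩ := exists_shearD_eq h hV hz'
    (by rw [shearD_flipVars h, kdiff_scal_mul, hD, mul_zero, map_zero])
  refine ⟨scal 𝕜 _ (T e) * flipVars 𝕜 n n' j₀ w, T_mul_mem_kgr ?_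
    (flipVars_mem (S' := Set.Iic ((c - d) j₀)) ?_ hw), ?_⟩
  · intro m hm
    simp only [Set.mem_Iic] at hm ⊢; omega
  · intro m hm
    simp only [Set.mem_Iic, Set.mem_Ici] at hm ⊢; omega
  · rw [kdiff_scal_mul, shearD_flipVars h, hwz, flipVars_flipVars, ← mul_assoc, ← map_mul,
      ← LaurentPolynomial.T_add, add_neg_cancel, LaurentPolynomial.T_zero, map_one, one_mul]

/-- The cycles in a graded part of the Koszul complex of `shear`. -/
abbrev shearCycles (𝕜 : Type*) [Field 𝕜] (n n' : Fin k → ℕ) (j₀ : Fin k) (d : Fin k → ℤ) (p : ℕ)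
    (c : Fin k → ℤ) (S : Set ℤ) : Submodule 𝕜 (Kos 𝕜 (CoordRing 𝕜 n) (CoordRing 𝕜 n')) :=
  mgr 𝕜 n n' d p c S ⊓ LinearMap.ker (shearD 𝕜 n n' j₀)

/-- Splitting of cycles over the intersection of both charts. -/
theorem cycle_mem_sup (h : IsDrop n n' j₀) {e : ℤ}
    (hV : ∀ i ≤ p, KoszulVanishing 𝕜 n' d i c ∨ -1 ≤ e - n j₀ * (p - i) + (i * d j₀ + c j₀)) {z}
    (hz : z ∈ mgr 𝕜 n n' d p c Set.univ) (hD : shearD 𝕜 n n' j₀ z = 0) :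
    z ∈ shearCycles 𝕜 n n' j₀ d p c (Set.Ici 0) ⊔
      shearCycles 𝕜 n n' j₀ d p c (Set.Iic (c j₀ + e)) ⊔
      (mgr 𝕜 n n' d (p + 1) (c - d) Set.univ).map (shearD 𝕜 n n' j₀) := by
  have hS : ∀ m ∈ Set.Ici (0 : ℤ), ∀ l, 0 ≤ l → l + m ∈ Set.Ici (0 : ℤ) :=
    fun m hm l hl => add_nonneg hl hm
  have key := cycle_mem_of_lift h (S := Set.univ) (fun _ _ _ _ => Set.mem_univ _) (P := p)
    (fun i => shearCycles 𝕜 n n' j₀ d i c (Set.Ici 0) ⊔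
      shearCycles 𝕜 n n' j₀ d i c (Set.Iic (c j₀ + (e - n j₀ * (p - i)))) ⊔
      (mgr 𝕜 n n' d (i + 1) (c - d) Set.univ).map (shearD 𝕜 n n' j₀))
    ?_ ?_ le_rfl hz hD
  · simpa using key
  · intro i hi z hz hzD
    rcases hV i hi with hV | hi'
    · obtain ⟨w, hw, hwz⟩ := exists_boundary_lift (n := n) h (fun _ _ _ _ => Set.mem_univ _) hV hz hzD
      exact ⟨_, Submodule.mem_sup_right (Submodule.mem_map_of_mem hw),
        shearD_mem (fun _ _ _ _ => Set.mem_univ _) hw, kdiff_kdiff _ _, hwz⟩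
    · set z₀ := kfilter 𝕜 _ _ (Set.Ici 0) z
      set z₁ := kfilter 𝕜 _ _ (Set.Ici 0)ᶜ z
      have hz₀ : z₀ ∈ mgr 𝕜 n' n' d i c (Set.Ici 0) :=
        kgr_mono Set.inter_subset_right (kfilter_mem _ hz)
      have hz₁ : z₁ ∈ mgr 𝕜 n' n' d i c (Set.Ici 0)ᶜ :=
        kgr_mono Set.inter_subset_right (kfilter_mem _ hz)
      have hD₀ : koszulD 𝕜 n' z₀ = 0 := by rw [koszulD, kdiff_kfilter, hzD, map_zero]
      have hD₁ : koszulD 𝕜 n' z₁ = 0 := by rw [koszulD, kdiff_kfilter, hzD, map_zero]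
      have hg₀ : ascend 𝕜 n n' j₀ z₀ ∈ shearCycles 𝕜 n n' j₀ d i c (Set.Ici 0) :=
        ⟨ascend_mem hS hz₀, LinearMap.mem_ker.2 (by rw [shearD_ascend h, hD₀, map_zero])⟩
      have hg₁ : flipVars 𝕜 n n' j₀ (ascend 𝕜 n n' j₀ (flipTwist 𝕜 n' j₀ z₁)) ∈
          shearCycles 𝕜 n n' j₀ d i c (Set.Iic (c j₀ + (e - n j₀ * (p - i)))) := by
        refine ⟨flipVars_mem ?_ (ascend_mem (S := Set.Ici (i * d j₀ + c j₀ + 1)) ?_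
          (flipTwist_mem ?_ hz₁)), ?_⟩
        · intro m hm
          simp only [Set.mem_Iic, Set.mem_Ici] at hm ⊢; omega
        · intro m hm l hl
          simp only [Set.mem_Ici] at hm ⊢; omega
        · intro m hm
          simp only [Set.mem_compl_iff, Set.mem_Ici] at hm ⊢; omega
        · refine LinearMap.mem_ker.2 ?_
          rw [shearD_flipVars h, shearD_ascend h, koszulD_flipTwist, hD₁, map_zero, map_zero,
            map_zero]
      refine ⟨_, Submodule.mem_sup_left (add_mem (Submodule.mem_sup_left hg₀)
        (Submodule.mem_sup_right hg₁)), add_mem (kgr_mono (Set.subset_univ _) hg₀.1)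
        (kgr_mono (Set.subset_univ _) hg₁.1), add_mem hg₀.2 hg₁.2, ?_⟩
      rw [map_add, descend_flipVars h, descend_ascend h, descend_ascend h, flipTwist_flipTwist]
      exact kfilter_add_compl _ _
  · intro i hi a ha g hg
    set M := LinearMap.mulLeft 𝕜 (lvec 𝕜 (CoordRing 𝕜 n') (geomVar 𝕜 n j₀ (n j₀) * cst 𝕜 a))
    have hM : ∀ {R R' : Set ℤ}, (∀ l ∈ Set.Icc (0 : ℤ) (n j₀), ∀ m ∈ R, l + m ∈ R') →
        ∀ x ∈ shearCycles 𝕜 n n' j₀ d i c R, M x ∈ shearCycles 𝕜 n n' j₀ d (i + 1) c R' := by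
      intro R R' hR x hx
      refine ⟨lvec_mul_mem_kgr (geomVar_mul_mem ha) hR hx.1, LinearMap.mem_ker.2 ?_⟩
      exact (shearD_geomVar_mul h a x).trans (by rw [LinearMap.mem_ker.1 hx.2, mul_zero, neg_zero])
    refine Submodule.mem_comap.1 ((sup_le (sup_le ?_ ?_) ?_ : _ ≤ Submodule.comap M _) hg)
    · exact fun x hx => Submodule.mem_sup_left (Submodule.mem_sup_left
        (hM (fun l hl m hm => hS m hm l hl.1) x hx))
    · refine fun x hx => Submodule.mem_sup_left (Submodule.mem_sup_right
        (hM (fun l hl m hm => ?_) x hx))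
      simp only [Set.mem_Iic, Set.mem_Icc] at hl hm ⊢
      push_cast
      linarith
    · rintro _ ⟨w, hw, rfl⟩
      refine Submodule.mem_sup_right ?_
      have : M (shearD 𝕜 n n' j₀ w) = shearD 𝕜 n n' j₀ (-M w) := by
        rw [map_neg]
        exact eq_neg_of_add_eq_zero_right
          (by rw [LinearMap.mulLeft_apply, LinearMap.mulLeft_apply, shearD_geomVar_mul h,
            neg_add_cancel])
      rw [this]
      exact Submodule.mem_map_of_mem (neg_mem
        (lvec_mul_mem_kgr (geomVar_mul_mem ha) (fun _ _ _ _ => Set.mem_univ _) hw))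

end Charts

section Cech

open LaurentPolynomial (T)
open scoped LaurentPolynomial

section Support

variable {𝕜 P : Type*} [Field 𝕜] [CommRing P] [Algebra 𝕜 P] {W W' : Submodule 𝕜 P} {S S' : Set ℤ}

theorem coeff_mul_of_mem_laurentSub {a b : ℤ} (h : ∀ l ∈ S, ∀ m ∈ S', l + m = a + b → l = a ∧ m = b)
    {F G : P[T;T⁻¹]} (hF : F ∈ laurentSub W S) (hG : G ∈ laurentSub W' S') :
    (F * G).coeff (a + b) = F.coeff a * G.coeff b := by
  classical
  refine laurentSub_induction
    (motive := fun F => (F * G).coeff (a + b) = F.coeff a * G.coeff b) ?_ ?_ ?_ hF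
  · simp
  · intro F F' _ _ hF hF'
    rw [add_mul, AddMonoidAlgebra.coeff_add, Finsupp.add_apply, hF, hF',
      AddMonoidAlgebra.coeff_add, Finsupp.add_apply, add_mul]
  · intro u _ l hl
    refine laurentSub_induction
      (motive := fun G => (cst 𝕜 u * T l * G).coeff (a + b) = (cst 𝕜 u * T l).coeff a * G.coeff b)
      ?_ ?_ ?_ hG
    · simp
    · intro F F' _ _ hF hF'
      rw [mul_add, AddMonoidAlgebra.coeff_add, Finsupp.add_apply, hF, hF',
        AddMonoidAlgebra.coeff_add, Finsupp.add_apply, mul_add]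
    · intro v _ m hm
      rw [cst_mul_T, cst_mul_T, AddMonoidAlgebra.single_mul_single, AddMonoidAlgebra.coeff_single,
        AddMonoidAlgebra.coeff_single, AddMonoidAlgebra.coeff_single, Finsupp.single_apply,
        Finsupp.single_apply, Finsupp.single_apply]
      by_cases hlm : l + m = a + b
      · obtain ⟨rfl, rfl⟩ := h l hl m hm hlm
        simp
      · rw [if_neg hlm]
        by_cases hla : l = a
        · rw [if_neg (fun hmb : m = b => hlm (by rw [hla, hmb])), mul_zero]
        · rw [if_neg hla, zero_mul]

theorem mem_laurentSub_top {F : P[T;T⁻¹]} (h : ∀ m ∉ S, F.coeff m = 0) :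
    F ∈ laurentSub (⊤ : Submodule 𝕜 P) S :=
  fun m => ⟨trivial, h m⟩

/-- Multiples of a Laurent polynomial with exponents exactly in the range from `0` to `N` cannot have
all exponents between `0` and `N - 1`. -/
theorem eq_zero_of_mul_mem_laurentSub [IsDomain P] {N : ℤ} {H K : P[T;T⁻¹]}
    (hH : H ∈ laurentSub W (Set.Icc 0 N)) (h₀ : H.coeff 0 ≠ 0) (h₁ : H.coeff N ≠ 0)
    (hHK : H * K ∈ laurentSub W' (Set.Icc 0 (N - 1))) : K = 0 := by
  by_contra hK
  have hs : K.coeff.support.Nonempty :=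
    Finsupp.support_nonempty_iff.2 fun h => hK (AddMonoidAlgebra.coeff_injective h)
  set b := K.coeff.support.max' hs with hb
  set a := K.coeff.support.min' hs with ha
  have hKab : K ∈ laurentSub (⊤ : Submodule 𝕜 P) (Set.Icc a b) := by
    refine mem_laurentSub_top fun m hm => Finsupp.notMem_support_iff.1 fun h => hm ?_
    exact ⟨Finset.min'_le _ _ h, Finset.le_max' _ _ h⟩
  have hba : K.coeff b ≠ 0 := Finsupp.mem_support_iff.1 (Finset.max'_mem _ hs)
  have haa : K.coeff a ≠ 0 := Finsupp.mem_support_iff.1 (Finset.min'_mem _ hs)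
  have hab : a ≤ b := Finset.min'_le _ _ (Finset.max'_mem _ hs)
  have e₀ := coeff_mul_of_mem_laurentSub (a := 0) (b := a) (by
    rintro l ⟨hl, -⟩ m ⟨hm, -⟩ hlm; omega) hH hKab
  have e₁ := coeff_mul_of_mem_laurentSub (a := N) (b := b) (by
    rintro l ⟨-, hl⟩ m ⟨-, hm⟩ hlm; omega) hH hKab
  have m₀ : 0 + a ∈ Set.Icc 0 (N - 1) := by
    by_contra h
    exact mul_ne_zero h₀ haa (e₀.symm.trans ((hHK _).2 h))
  have m₁ : N + b ∈ Set.Icc 0 (N - 1) := by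
    by_contra h
    exact mul_ne_zero h₁ hba (e₁.symm.trans ((hHK _).2 h))
  have := m₀.1
  have := m₁.2
  omega

end Support

variable {k : ℕ} {𝕜 : Type*} [Field 𝕜] {n n' : Fin k → ℕ} {j₀ : Fin k} {c d : Fin k → ℤ}

theorem xv_ne_zero {j : Fin k} {i : ℤ} (h₀ : 0 ≤ i) (h₁ : i ≤ n j) : xv 𝕜 n j i ≠ 0 := by
  rw [xv_of_range h₀ h₁]
  exact X_ne_zero _

theorem geomVar_coeff_zero (i : ℕ) : (geomVar 𝕜 n j₀ i).coeff 0 = xv 𝕜 n j₀ i := by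
  cases i with
  | zero => simp [geomVar, cst]
  | succ i =>
    have h := (mul_mem_laurentSub (W'' := (⊤ : Submodule 𝕜 (CoordRing 𝕜 n))) (S'' := Set.Ici 1)
      (fun _ _ _ _ => trivial) ?_ (geomVar_mem (𝕜 := 𝕜) (n := n) (j₀ := j₀) i)
      (G := T 1) (S' := {1}) (W' := comp 𝕜 n 0) ?_ 0).2 (by simp)
    · rw [geomVar, AddMonoidAlgebra.coeff_add, Finsupp.add_apply, h]
      simp [cst]
    · rintro l ⟨hl, -⟩ _ rfl
      simpa using hl
    · simpa using cst_mul_T_mem (𝕜 := 𝕜) (one_mem_comp (n := n)) (Set.mem_singleton (1 : ℤ))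

theorem geomVar_coeff_self (i : ℕ) : (geomVar 𝕜 n j₀ i).coeff i = xv 𝕜 n j₀ 0 := by
  induction i with
  | zero => simp [geomVar, cst]
  | succ i ih =>
    have h := coeff_mul_of_mem_laurentSub (a := i) (b := 1) (S' := {1}) (by
      rintro l _ m rfl hlm; omega) (geomVar_mem (𝕜 := 𝕜) (n := n) (j₀ := j₀) i)
      (G := T 1) (W' := comp 𝕜 n 0)
      (by simpa using cst_mul_T_mem (𝕜 := 𝕜) (one_mem_comp (n := n)) (Set.mem_singleton (1 : ℤ)))
    rw [geomVar, AddMonoidAlgebra.coeff_add, Finsupp.add_apply, Nat.cast_succ, h, ih]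
    have hi : (0 : ℤ) ≠ i + 1 := by omega
    rw [cst, AddMonoidAlgebra.singleZeroAlgHom_apply, AddMonoidAlgebra.coeff_single,
      Finsupp.single_eq_of_ne hi.symm, zero_add]
    have : (T 1 : (CoordRing 𝕜 n)[T;T⁻¹]).coeff 1 = 1 := by
      rw [T, AddMonoidAlgebra.coeff_single, Finsupp.single_eq_same]
    rw [this, mul_one]

/-- `shear` is injective on Laurent polynomials with few exponents. -/
theorem eq_zero_of_shear_eq_zero (h : IsDrop n n' j₀) {F : (CoordRing 𝕜 n)[T;T⁻¹]}
    (hF : F ∈ laurentSub (comp 𝕜 n c) (Set.Icc 0 (n j₀ - 1)))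
    (hF₀ : shear 𝕜 n n' j₀ F = 0) : F = 0 := by
  have hmul : ∀ G ∈ laurentSub (comp 𝕜 n c) Set.univ,
      ∃ K, G - restrictVars 𝕜 n' n (restrictVars 𝕜 n n' G) = cst 𝕜 (xv 𝕜 n j₀ (n j₀)) * K := by
    intro G hG
    refine laurentSub_induction (motive := fun G => ∃ K,
      G - restrictVars 𝕜 n' n (restrictVars 𝕜 n n' G) = cst 𝕜 (xv 𝕜 n j₀ (n j₀)) * K)
      ⟨0, by simp⟩ ?_ ?_ hG
    · rintro G G' _ _ ⟨K, hK⟩ ⟨K', hK'⟩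
      refine ⟨K + K', ?_⟩
      rw [map_add, map_add, mul_add, ← hK, ← hK']; ring
    · rintro a ha m -
      obtain ⟨b, -, hb⟩ := exists_sub_restrictPoly_eq_mul h ha
      refine ⟨cst 𝕜 b * T m, ?_⟩
      rw [map_mul, map_mul, restrictVars_cst, restrictVars_cst, restrictVars_T, restrictVars_T,
        ← mul_assoc, ← map_mul, ← hb, map_sub, sub_mul]
  have hG : shear 𝕜 n n j₀ F ∈ laurentSub (comp 𝕜 n c) Set.univ := by
    refine algHom_mem_laurentSub (fun a ha m _ => ?_) hF
    rw [map_mul, shear_T]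
    exact mul_mem_laurentSub (W' := comp 𝕜 n 0) (fun a ha b hb => mul_mem_comp (add_zero _) ha hb)
      (fun _ _ _ _ => Set.mem_univ _) (shear_mem ha)
      (by simpa using cst_mul_T_mem (𝕜 := 𝕜) (one_mem_comp (n := n)) (Set.mem_univ m))
  obtain ⟨K, hK⟩ := hmul _ hG
  have hr : restrictVars 𝕜 n n' (shear 𝕜 n n j₀ F) = 0 :=
    (DFunLike.congr_fun (restrictVars_shear h) F).trans hF₀
  rw [hr, map_zero, sub_zero] at hK
  have hFK : F = geomVar 𝕜 n j₀ (n j₀) * unshear 𝕜 n j₀ K := by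
    have := DFunLike.congr_fun (unshear_shear (𝕜 := 𝕜) (n := n) (j₀ := j₀)) F
    rw [AlgHom.comp_apply, AlgHom.id_apply, hK, map_mul, unshear_xv_self le_rfl] at this
    exact this.symm
  have hK₀ : unshear 𝕜 n j₀ K = 0 := by
    clear hK hr hG hmul hF₀
    rw [hFK] at hF
    refine eq_zero_of_mul_mem_laurentSub (geomVar_mem (n j₀)) ?_ ?_ hF
    · rw [geomVar_coeff_zero]; exact xv_ne_zero (by omega) le_rfl
    · rw [geomVar_coeff_self]; exact xv_ne_zero le_rfl (by omega)
  exact hFK.trans (by rw [hK₀, mul_zero])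

/-- `shear` is surjective in a range of exponents. -/
theorem laurentSub_le_map_shear (h : IsDrop n n' j₀) :
    laurentSub (comp 𝕜 n' c) (Set.Icc 0 (c j₀ + n j₀ - 1)) ≤
      (laurentSub (comp 𝕜 n c) (Set.Icc 0 (n j₀ - 1))).map (shear 𝕜 n n' j₀).toLinearMap := by
  set I : (Fin k → ℤ) → Submodule 𝕜 (CoordRing 𝕜 n')[T;T⁻¹] := fun c =>
    (laurentSub (comp 𝕜 n c) (Set.Icc 0 (n j₀ - 1))).map (shear 𝕜 n n' j₀).toLinearMap
  have mul_mem : ∀ {j : Fin k} {i : ℤ} {c} {F}, F ∈ I c →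
      shear 𝕜 n n' j₀ (cst 𝕜 (xv 𝕜 n j i)) * F ∈ I (Pi.single j 1 + c) := by
    rintro j i c _ ⟨F, hF, rfl⟩
    refine ⟨cst 𝕜 (xv 𝕜 n j i) * F, mul_mem_laurentSub (S := {0}) (W := comp 𝕜 n (Pi.single j 1))
      (fun a ha b hb => mul_mem_comp rfl ha hb) ?_ (cst_mem_laurentSub (xv_mem_comp _ _) rfl) hF,
      map_mul (shear 𝕜 n n' j₀) _ _⟩
    rintro _ rfl m hm
    rwa [zero_add]
  have key : ∀ {c} {a : CoordRing 𝕜 n'}, a ∈ comp 𝕜 n' c →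
      ∀ m ∈ Set.Icc 0 (c j₀ + n j₀ - 1), cst 𝕜 a * T m ∈ I c := by
    intro c a ha
    refine comp_induction (motive := fun c a => ∀ m ∈ Set.Icc 0 (c j₀ + n j₀ - 1),
      cst 𝕜 a * T m ∈ I c) ?_ ?_ ?_ ?_ ha
    · intro c m _
      rw [map_zero, zero_mul]; exact zero_mem _
    · intro c a b _ _ ha hb m hm
      rw [map_add, add_mul]; exact add_mem (ha m hm) (hb m hm)
    · rintro r m ⟨hm₀, hm₁⟩
      refine ⟨cst 𝕜 (algebraMap 𝕜 _ r) * T m, cst_mul_T_mem ?_ ⟨hm₀, by simpa using hm₁⟩, ?_⟩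
      · rw [Algebra.algebraMap_eq_smul_one]
        exact Submodule.smul_mem _ _ one_mem_comp
      · change shear 𝕜 n n' j₀ _ = _
        rw [map_mul, shear_T, AlgHom.commutes, AlgHom.commutes, AlgHom.commutes]
    · intro j i h₀ h₁ c a ha ih m hm
      by_cases hj : j = j₀
      · subst hj
        have hN := h.self
        have step : ∀ i : ℤ, i ≤ n j → ∀ m, 0 ≤ m → m ≤ c j + n j - 1 →
            cst 𝕜 (xv 𝕜 n' j i * a) * T m - cst 𝕜 (xv 𝕜 n' j (i - 1) * a) * T (m + 1) ∈
              I (Pi.single j 1 + c) := by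
          intro i hi m hm₀ hm₁
          convert mul_mem (j := j) (i := i) (ih m ⟨hm₀, hm₁⟩) using 1
          rw [shear_xv_self hi, map_mul, map_mul, LaurentPolynomial.T_add]; ring
        have down : ∀ i : ℕ, ∀ m : ℤ, i ≤ n j → 0 ≤ m → m + i ≤ c j + n j - 1 →
            cst 𝕜 (xv 𝕜 n' j i * a) * T m ∈ I (Pi.single j 1 + c) := by
          intro i
          induction i with
          | zero =>
            intro m _ hm₀ hm₁
            have := step 0 (by omega) m hm₀ (by simpa using hm₁)
            rwa [xv_of_neg (by omega : (0 : ℤ) - 1 < 0), zero_mul, map_zero, zero_mul,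
              sub_zero] at this
          | succ i ih =>
            intro m hi hm₀ hm₁
            push_cast at hm₁ ⊢
            have := add_mem (step (i + 1) (by omega) m hm₀ (by omega))
              (ih (m + 1) (by omega) (by omega) (by omega))
            rwa [add_sub_cancel_right, sub_add_cancel] at this
        have up : ∀ r : ℕ, ∀ m : ℤ, r ≤ m → m ≤ c j + n j →
            cst 𝕜 (xv 𝕜 n' j (n j - r) * a) * T m ∈ I (Pi.single j 1 + c) := by
          intro r
          induction r with
          | zero =>
            intro m _ _
            rw [xv_of_gt (by push_cast; omega), zero_mul, map_zero, zero_mul]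
            exact zero_mem _
          | succ r ih =>
            intro m hr hm₁
            push_cast at hr ⊢
            have := sub_mem (ih (m - 1) (by omega) (by omega))
              (step (n j - r) (by omega) (m - 1) (by omega) (by omega))
            rwa [sub_sub_cancel, sub_add_cancel, sub_sub] at this
        by_cases hc : c j < 0
        · rw [comp_eq_zero hc ha, mul_zero, map_zero, zero_mul]
          exact zero_mem _
        · have hm₀ := hm.1
          have hm₁ := hm.2
          rw [Pi.add_apply, Pi.single_eq_same] at hm₁
          by_cases hmi : m + i ≤ n j - 1
          · have := down i.toNat m (by omega) hm₀ (by omega)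
            rwa [Int.toNat_of_nonneg h₀] at this
          · have := up (n j - i).toNat m (by omega) (by omega)
            rwa [Int.toNat_of_nonneg (by omega), sub_sub_cancel] at this
      · have := mul_mem (j := j) (i := i) (ih m ?_)
        · rwa [shear_xv_of_ne hj (h.of_ne j hj), ← mul_assoc, ← map_mul] at this
        · rwa [Pi.add_apply, Pi.single_eq_of_ne (Ne.symm hj), zero_add] at hm
  intro F hF
  exact laurentSub_induction (motive := fun F => F ∈ I c) (zero_mem _)
    (fun F G _ _ hF hG => add_mem hF hG) (fun a ha m hm => key ha m hm) hF

end Cech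

section CechStep

open LaurentPolynomial (T)
open scoped LaurentPolynomial

section Finite

variable {𝕜 P Q : Type*} [Field 𝕜] [CommRing P] [Algebra 𝕜 P] [CommRing Q] [Algebra 𝕜 Q]

theorem exists_finset_mem_kgr {W : Submodule 𝕜 P} {p : ℕ} {M : Submodule 𝕜 Q} {S : Set ℤ}
    {x : Kos 𝕜 P Q} (hx : x ∈ kgr W p M S) :
    ∃ s : Finset ℤ, (s : Set ℤ) ⊆ S ∧ x ∈ kgr W p M s := by
  classical
  refine wedgeDeg_induction
    (motive := fun p x => ∃ s : Finset ℤ, (s : Set ℤ) ⊆ S ∧ x ∈ kgr W p M s) ?_ ?_ ?_ hx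
  · intro F hF
    refine ⟨F.coeff.support, fun m hm => ?_, scal_mem_wedgeDeg fun m => ⟨(hF m).1, fun hm => ?_⟩⟩
    · by_contra h
      exact Finsupp.mem_support_iff.1 hm ((hF m).2 h)
    · exact Finsupp.notMem_support_iff.1 hm
  · rintro p x y ⟨s, hs, hx⟩ ⟨t, ht, hy⟩
    refine ⟨s ∪ t, by simp [hs, ht], add_mem (kgr_mono ?_ hx) (kgr_mono ?_ hy)⟩ <;> simp
  · rintro p v hv x _ ⟨s, hs, hx⟩
    exact ⟨s, hs, vec_mul_mem_wedgeDeg hv hx⟩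

theorem lTensor_vec_mul {V A B : Type*} [AddCommGroup V] [Module 𝕜 V] [CommRing A] [Algebra 𝕜 A]
    [CommRing B] [Algebra 𝕜 B] (g : A →ₗ[𝕜] B) (v : V) (x : ExteriorAlgebra 𝕜 V ⊗[𝕜] A) :
    g.lTensor _ (vec 𝕜 A v * x) = vec 𝕜 B v * g.lTensor _ x := by
  induction x using TensorProduct.induction_on with
  | zero => simp
  | add x y hx hy => rw [mul_add, map_add, hx, hy, map_add, mul_add]
  | tmul x a => simp [vec]

theorem lTensor_scal {V A B : Type*} [AddCommGroup V] [Module 𝕜 V] [CommRing A] [Algebra 𝕜 A]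
    [CommRing B] [Algebra 𝕜 B] (g : A →ₗ[𝕜] B) (a : A) :
    g.lTensor (ExteriorAlgebra 𝕜 V) (scal 𝕜 V a) = scal 𝕜 V (g a) := by
  simp [scal]

theorem exists_leftInverse_on {A B : Type*} [AddCommGroup A] [Module 𝕜 A] [AddCommGroup B]
    [Module 𝕜 B] (f : A →ₗ[𝕜] B) (U : Submodule 𝕜 A) (hf : ∀ a ∈ U, f a = 0 → a = 0) :
    ∃ g : B →ₗ[𝕜] A, ∀ a ∈ U, g (f a) = a := by
  obtain ⟨r, hr⟩ := LinearMap.exists_leftInverse_of_injective (f ∘ₗ U.subtype)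
    (LinearMap.ker_eq_bot'.2 fun a ha => Subtype.ext (hf a a.2 ha))
  exact ⟨U.subtype ∘ₗ r, fun a ha => congrArg Subtype.val (LinearMap.congr_fun hr ⟨a, ha⟩)⟩

end Finite

variable {k : ℕ} {𝕜 : Type*} [Field 𝕜] {n n' : Fin k → ℕ} {j₀ : Fin k} {c d : Fin k → ℤ} {p : ℕ}

/-- It suffices to consider Laurent polynomials which are constant. -/
theorem koszulVanishing_of_zero (h : ∀ x ∈ mgr 𝕜 n n d p c {0}, koszulD 𝕜 n x = 0 →
    ∃ y ∈ mgr 𝕜 n n d (p + 1) (c - d) {0}, koszulD 𝕜 n y = x) : KoszulVanishing 𝕜 n d p c := by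
  classical
  have single : ∀ m : ℤ, ∀ x ∈ mgr 𝕜 n n d p c {m}, koszulD 𝕜 n x = 0 →
      ∃ y ∈ mgr 𝕜 n n d (p + 1) (c - d) {m}, koszulD 𝕜 n y = x := by
    intro m x hx hD
    obtain ⟨y, hy, hyx⟩ := h (scal 𝕜 _ (T (-m)) * x)
      (T_mul_mem_kgr (by rintro _ rfl; exact neg_add_cancel _) hx)
      (by rw [koszulD, kdiff_scal_mul, hD, mul_zero])
    refine ⟨scal 𝕜 _ (T m) * y, T_mul_mem_kgr (by rintro _ rfl; exact add_zero _) hy, ?_⟩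
    rw [koszulD, kdiff_scal_mul, hyx, ← mul_assoc, ← map_mul, ← LaurentPolynomial.T_add,
      add_neg_cancel, LaurentPolynomial.T_zero, map_one, one_mul]
  intro S x hx hD
  obtain ⟨s, hs, hx⟩ := exists_finset_mem_kgr hx
  induction s using Finset.induction_on generalizing x with
  | empty =>
    refine ⟨0, zero_mem _, ?_⟩
    have h₀ : kfilter 𝕜 _ _ ∅ x = x := kfilter_of_mem (by simpa using hx)
    have h₁ : kfilter 𝕜 _ _ (∅ : Set ℤ)ᶜ x = x := kfilter_of_mem (kgr_mono (by simp) hx)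
    have := kfilter_add_compl ∅ x
    rw [h₀, h₁, add_eq_left] at this
    rw [this, map_zero]
  | insert m s _ ih =>
    rw [Finset.coe_insert, Set.insert_subset_iff] at hs
    obtain ⟨y₀, hy₀, hyx₀⟩ := single m (kfilter 𝕜 _ _ {m} x)
      (kgr_mono Set.inter_subset_right (kfilter_mem _ hx)) (by rw [koszulD, kdiff_kfilter, hD, map_zero])
    have hss : (↑(insert m s) : Set ℤ) ∩ {m}ᶜ ⊆ ↑s := by
      rintro l ⟨hl, hlm⟩
      exact (Finset.mem_insert.1 hl).resolve_left hlm
    have h₁ : kfilter 𝕜 _ _ {m}ᶜ x ∈ mgr 𝕜 n n d p c s := kgr_mono hss (kfilter_mem _ hx)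
    obtain ⟨y₁, hy₁, hyx₁⟩ := ih _ (kgr_mono hs.2 h₁) (by rw [koszulD, kdiff_kfilter, hD, map_zero])
      hs.2 h₁
    refine ⟨y₀ + y₁, add_mem (kgr_mono (by simpa using hs.1) hy₀) hy₁, ?_⟩
    rw [map_add, hyx₀, hyx₁, kfilter_add_compl]

variable (𝕜 n n' j₀) in
/-- The homomorphism of Koszul algebras induced by `shear` on coefficients. -/
def shearCoeff : Kos 𝕜 (CoordRing 𝕜 n) (CoordRing 𝕜 n) →ₐ[𝕜] Kos 𝕜 (CoordRing 𝕜 n) (CoordRing 𝕜 n') :=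
  kmap (AlgHom.id 𝕜 _) (shear 𝕜 n n' j₀)

theorem shearCoeff_vec_mul (v : CoordRing 𝕜 n) (x) :
    shearCoeff 𝕜 n n' j₀ (vec 𝕜 _ v * x) = vec 𝕜 _ v * shearCoeff 𝕜 n n' j₀ x := by
  rw [map_mul]
  congr 1
  exact (kmap_vec v).trans (lvec_cst v)

theorem shearCoeff_scal (F) :
    shearCoeff 𝕜 n n' j₀ (scal 𝕜 _ F) = scal 𝕜 _ (shear 𝕜 n n' j₀ F) :=
  kmap_scal F

theorem shearD_shearCoeff (x) :
    shearD 𝕜 n n' j₀ (shearCoeff 𝕜 n n' j₀ x) = shearCoeff 𝕜 n n' j₀ (koszulD 𝕜 n x) :=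
  kdiff_kmap (by simp) (fun _ => rfl) x

theorem shearCoeff_mem {x} (hx : x ∈ mgr 𝕜 n n d p c {0}) :
    shearCoeff 𝕜 n n' j₀ x ∈ mgr 𝕜 n n' d p c (Set.Icc 0 (c j₀)) := by
  refine kmap_mem_kgr (Θ := AlgHom.id 𝕜 _) (ΘA := shear 𝕜 n n' j₀) (W₁ := comp 𝕜 n d)
    (W₂ := comp 𝕜 n d) (M₁ := comp 𝕜 n c) (M₂ := comp 𝕜 n' c) (R := {0}) (S := {0})
    (S' := fun _ => Set.Icc 0 (c j₀))
    (fun v hv => cst_mem_laurentSub hv (Set.mem_singleton 0)) ?_ ?_ hx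
  · rintro a ha _ rfl
    rw [LaurentPolynomial.T_zero, mul_one]
    exact shear_mem ha
  · rintro _ _ rfl m hm
    rwa [zero_add]

theorem eq_of_shearCoeff_eq (h : IsDrop n n' j₀) {x y}
    (hx : x ∈ mgr 𝕜 n n d p c (Set.Icc 0 (n j₀ - 1))) (hy : y ∈ mgr 𝕜 n n d p c (Set.Icc 0 (n j₀ - 1)))
    (hxy : shearCoeff 𝕜 n n' j₀ x = shearCoeff 𝕜 n n' j₀ y) : x = y := by
  obtain ⟨g, hg⟩ := exists_leftInverse_on (shear 𝕜 n n' j₀).toLinearMap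
    (laurentSub (comp 𝕜 n c) (Set.Icc 0 (n j₀ - 1))) fun F hF hF₀ =>
      eq_zero_of_shear_eq_zero h hF hF₀
  have key : ∀ {x}, x ∈ mgr 𝕜 n n d p c (Set.Icc 0 (n j₀ - 1)) →
      g.lTensor _ (shearCoeff 𝕜 n n' j₀ x) = x := by
    intro x hx
    refine wedgeDeg_induction (motive := fun _ x => g.lTensor _ (shearCoeff 𝕜 n n' j₀ x) = x)
      ?_ ?_ ?_ hx
    · intro F hF
      rw [shearCoeff_scal, lTensor_scal]
      exact congrArg _ (hg F hF)
    · intro p x y hx hy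
      rw [map_add, map_add, hx, hy]
    · intro p v _ x _ hx
      rw [shearCoeff_vec_mul, lTensor_vec_mul, hx]
  rw [← key hx, ← key hy, hxy]

theorem exists_shearCoeff_eq (h : IsDrop n n' j₀) {y}
    (hy : y ∈ mgr 𝕜 n n' d p c (Set.Icc 0 (c j₀ + n j₀ - 1))) :
    ∃ x ∈ mgr 𝕜 n n d p c (Set.Icc 0 (n j₀ - 1)), shearCoeff 𝕜 n n' j₀ x = y := by
  refine wedgeDeg_induction (motive := fun p y => ∃ x ∈ mgr 𝕜 n n d p c (Set.Icc 0 (n j₀ - 1)),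
    shearCoeff 𝕜 n n' j₀ x = y) ?_ ?_ ?_ hy
  · intro F hF
    obtain ⟨G, hG, rfl⟩ := laurentSub_le_map_shear h hF
    exact ⟨_, scal_mem_wedgeDeg hG, kmap_scal G⟩
  · rintro p _ _ ⟨x, hx, rfl⟩ ⟨y, hy, rfl⟩
    exact ⟨x + y, add_mem hx hy, map_add _ _ _⟩
  · rintro p v hv _ - ⟨x, hx, rfl⟩
    exact ⟨_, vec_mul_mem_wedgeDeg hv hx, shearCoeff_vec_mul v x⟩

theorem mgr_eq_zero {S : Set ℤ} {j : Fin k} (hc : c j < 0) {x} (hx : x ∈ mgr 𝕜 n n' d p c S) :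
    x = 0 := by
  refine wedgeDeg_induction (motive := fun _ x => x = 0) ?_ ?_ ?_ hx
  · intro F hF
    have : F = 0 := AddMonoidAlgebra.coeff_injective (Finsupp.ext fun m => comp_eq_zero hc (hF m).1)
    rw [this, map_zero]
  · rintro p _ _ rfl rfl; exact add_zero _
  · rintro p v _ _ _ rfl; exact mul_zero _

/-- The inductive step for the vanishing of Koszul cohomology: covering by two charts. -/
theorem koszulVanishing_of_isDrop (h : IsDrop n n' j₀) (hV : ∀ i ≤ p, KoszulVanishing 𝕜 n' d i c)
    (hV' : ∀ i ≤ p + 1, KoszulVanishing 𝕜 n' d i (c - d) ∨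
      n j₀ * ((p : ℤ) - i) ≤ i * d j₀ + (c - d) j₀) : KoszulVanishing 𝕜 n d p c := by
  refine koszulVanishing_of_zero fun z hz hzD => ?_
  have hN := h.self
  set Z := shearCoeff 𝕜 n n' j₀ z with hZ
  have hZm : Z ∈ mgr 𝕜 n n' d p c (Set.Icc 0 (c j₀)) := shearCoeff_mem hz
  have hZD : shearD 𝕜 n n' j₀ Z = 0 := by rw [hZ, shearD_shearCoeff, hzD, map_zero]
  obtain ⟨w₀, hw₀, hwD₀⟩ := exists_shearD_eq h hV (kgr_mono (fun m hm => hm.1) hZm) hZD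
  obtain ⟨w₁, hw₁, hwD₁⟩ := exists_shearD_eq' (e := n j₀ - 1) h hV
    (kgr_mono (fun m hm => Set.mem_Iic.2 (by have := hm.2; omega)) hZm) hZD
  have hw : w₀ - w₁ ∈ mgr 𝕜 n n' d (p + 1) (c - d) Set.univ :=
    sub_mem (kgr_mono (Set.subset_univ _) hw₀) (kgr_mono (Set.subset_univ _) hw₁)
  have hsup := cycle_mem_sup (e := n j₀ - 1) h (fun i hi => (hV' i hi).imp_right fun h => by
    push_cast; linarith) hw (by rw [map_sub, hwD₀, hwD₁, sub_self])
  obtain ⟨_, hζ, _, ⟨η, hη, rfl⟩, hsum⟩ := Submodule.mem_sup.1 hsup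
  obtain ⟨ζ₀, hζ₀, ζ₁, hζ₁, rfl⟩ := Submodule.mem_sup.1 hζ
  set η₀ := kfilter 𝕜 _ _ (Set.Ici 0) η
  set η₁ := kfilter 𝕜 _ _ (Set.Ici 0)ᶜ η
  have hη₀ : shearD 𝕜 n n' j₀ η₀ ∈ mgr 𝕜 n n' d (p + 1) (c - d) (Set.Ici 0) :=
    shearD_mem (fun l hl m hm => add_nonneg hl.1 hm.2) (kfilter_mem (Set.Ici 0) hη)
  have hη₁ : shearD 𝕜 n n' j₀ η₁ ∈
      mgr 𝕜 n n' d (p + 1) (c - d) (Set.Iic ((c - d) j₀ + (n j₀ - 1))) := by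
    by_cases hc : (c - d - d) j₀ < 0
    · rw [show η₁ = 0 from mgr_eq_zero hc (kfilter_mem (Set.Ici 0)ᶜ hη), map_zero]
      exact zero_mem _
    · refine shearD_mem (fun l hl m hm => ?_) (kfilter_mem (Set.Ici 0)ᶜ hη)
      have h₁ := hl.2
      have h₂ := hm.2
      simp only [Set.mem_compl_iff, Set.mem_Ici, Set.mem_Iic, Pi.sub_apply] at *
      omega
  have hηη : shearD 𝕜 n n' j₀ η₀ + shearD 𝕜 n n' j₀ η₁ = shearD 𝕜 n n' j₀ η := by
    rw [← map_add, kfilter_add_compl]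
  set w := w₀ - ζ₀ - shearD 𝕜 n n' j₀ η₀ with hwdef
  have hwdef' : w = w₁ + ζ₁ + shearD 𝕜 n n' j₀ η₁ := by
    rw [← hηη, ← sub_eq_zero] at hsum
    rw [hwdef, ← sub_eq_zero, ← neg_eq_zero, ← hsum]
    abel
  have hwm : w ∈ mgr 𝕜 n n' d (p + 1) (c - d) (Set.Icc 0 ((c - d) j₀ + n j₀ - 1)) := by
    have h₀ : w ∈ mgr 𝕜 n n' d (p + 1) (c - d) (Set.Ici 0) :=
      sub_mem (sub_mem hw₀ hζ₀.1) hη₀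
    have h₁ : w ∈ mgr 𝕜 n n' d (p + 1) (c - d) (Set.Iic ((c - d) j₀ + (n j₀ - 1))) :=
      hwdef' ▸ add_mem (add_mem hw₁ hζ₁.1) hη₁
    have := mem_kgr_inter h₀ h₁
    rwa [Set.Ici_inter_Iic, ← add_sub_assoc] at this
  have hwD : shearD 𝕜 n n' j₀ w = Z := by
    rw [hwdef, map_sub, map_sub, hwD₀, LinearMap.mem_ker.1 hζ₀.2, sub_zero]
    exact (congrArg _ (kdiff_kdiff _ _)).trans (sub_zero _)
  obtain ⟨y, hy, hyw⟩ := exists_shearCoeff_eq h hwm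
  have hyz : koszulD 𝕜 n y = z := by
    refine eq_of_shearCoeff_eq h (koszulD_mem hy) (kgr_mono ?_ hz)
      (by rw [← shearD_shearCoeff, hyw, hwD])
    rw [Set.singleton_subset_iff]
    exact ⟨le_rfl, by omega⟩
  refine ⟨kfilter 𝕜 _ _ {0} y, kgr_mono Set.inter_subset_right (kfilter_mem _ hy), ?_⟩
  rw [koszulD, kdiff_kfilter, hyz, kfilter_of_mem hz]

end CechStep

section Vanishing

open LaurentPolynomial (T)
open scoped LaurentPolynomial

variable {k : ℕ} {𝕜 : Type*} [Field 𝕜] {n : Fin k → ℕ} {c d : Fin k → ℤ} {p : ℕ}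

variable (𝕜 n) in
/-- The monomial of multidegree `c` in the variables `x^{(j)}_0`. -/
def baseMonomial (c : Fin k → ℤ) : CoordRing 𝕜 n := ∏ j, xv 𝕜 n j 0 ^ (c j).toNat

theorem baseMonomial_ne_zero : baseMonomial 𝕜 n c ≠ 0 :=
  Finset.prod_ne_zero_iff.2 fun _ _ => pow_ne_zero _ (xv_ne_zero le_rfl (Int.natCast_nonneg _))

theorem baseMonomial_mem (hc : 0 ≤ c) : baseMonomial 𝕜 n c ∈ comp 𝕜 n c := by
  have h : ∑ j, (c j).toNat • (Pi.single j 1 : Fin k → ℤ) = c := by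
    ext i
    simp only [Finset.sum_apply, Pi.smul_apply, Pi.single_apply, smul_ite, smul_zero]
    rw [Finset.sum_ite_eq Finset.univ i, if_pos (Finset.mem_univ i)]
    simpa using hc i
  have := IsWeightedHomogeneous.prod Finset.univ (fun j => xv 𝕜 n j 0 ^ (c j).toNat)
    (fun j => (c j).toNat • (Pi.single j 1 : Fin k → ℤ)) (w := fun x => Pi.single x.1 1)
    fun j _ => ((mem_weightedHomogeneousSubmodule _ _ _ _).1 (xv_mem_comp j 0)).pow _
  rw [h] at this
  exact (mem_weightedHomogeneousSubmodule _ _ _ _).2 this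

theorem baseMonomial_add (hc : 0 ≤ c) (hd : 0 ≤ d) :
    baseMonomial 𝕜 n (c + d) = baseMonomial 𝕜 n c * baseMonomial 𝕜 n d := by
  rw [baseMonomial, baseMonomial, baseMonomial, ← Finset.prod_mul_distrib]
  refine Finset.prod_congr rfl fun j _ => ?_
  rw [← pow_add, Pi.add_apply, Int.toNat_add (hc j) (hd j)]

theorem exists_smul_baseMonomial (hn : ∀ j, n j = 0) {a : CoordRing 𝕜 n} (ha : a ∈ comp 𝕜 n c) :
    ∃ r : 𝕜, a = r • baseMonomial 𝕜 n c := by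
  refine comp_induction (motive := fun c a => ∃ r : 𝕜, a = r • baseMonomial 𝕜 n c) ?_ ?_ ?_ ?_ ha
  · exact fun c => ⟨0, (zero_smul _ _).symm⟩
  · rintro c _ _ _ _ ⟨r, rfl⟩ ⟨s, rfl⟩
    exact ⟨r + s, (add_smul _ _ _).symm⟩
  · intro r
    exact ⟨r, by rw [Algebra.algebraMap_eq_smul_one]; simp [baseMonomial]⟩
  · rintro j i h₀ h₁ c a ha ⟨r, h⟩
    obtain rfl : i = 0 := by have := hn j; omega
    by_cases hc : 0 ≤ c
    · refine ⟨r, ?_⟩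
      have h₁ : (0 : Fin k → ℤ) ≤ Pi.single j 1 := Pi.single_nonneg.2 zero_le_one
      have h₂ : baseMonomial 𝕜 n (Pi.single j 1) = xv 𝕜 n j 0 := by
        rw [baseMonomial, Finset.prod_eq_single_of_mem j (Finset.mem_univ j)]
        · simp
        · intro i _ hi
          simp [Pi.single_eq_of_ne hi]
      rw [baseMonomial_add h₁ hc, h₂, h, mul_smul_comm]
    · obtain ⟨l, hl⟩ := not_forall.1 hc
      refine ⟨0, ?_⟩
      rw [comp_eq_zero (not_le.1 hl) ha, mul_zero, zero_smul]

/-- Vanishing of Koszul cohomology for a product of projective spaces of dimension zero. -/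
theorem koszulVanishing_of_eq_zero (hn : ∀ j, n j = 0) (hd : 0 ≤ d) (hc : 0 ≤ c - d) :
    KoszulVanishing 𝕜 n d p c := by
  refine koszulVanishing_of_zero fun x hx hD => ?_
  set v := baseMonomial 𝕜 n d
  have key : ∃ F, x = vec 𝕜 _ v ^ p * scal 𝕜 _ F := by
    refine wedgeDeg_induction (motive := fun p x => ∃ F, x = vec 𝕜 _ v ^ p * scal 𝕜 _ F) ?_ ?_ ?_ hx
    · exact fun F _ => ⟨F, by rw [pow_zero, one_mul]⟩
    · rintro p _ _ ⟨F, rfl⟩ ⟨G, rfl⟩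
      exact ⟨F + G, by rw [map_add, mul_add]⟩
    · rintro p u hu _ _ ⟨F, rfl⟩
      obtain ⟨r, rfl⟩ := exists_smul_baseMonomial hn hu
      exact ⟨r • F, by rw [map_smul, map_smul, mul_smul_comm, smul_mul_assoc, pow_succ', mul_assoc]⟩
  match p with
  | 0 =>
    refine wedgeDeg_induction (motive := fun p x => p = 0 →
      ∃ y ∈ mgr 𝕜 n n d 1 (c - d) {0}, koszulD 𝕜 n y = x) ?_ ?_ ?_ hx rfl
    · intro F hF _
      refine laurentSub_induction (motive := fun F =>
        ∃ y ∈ mgr 𝕜 n n d 1 (c - d) {0}, koszulD 𝕜 n y = scal 𝕜 _ F) ?_ ?_ ?_ hF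
      · exact ⟨0, zero_mem _, by rw [map_zero, map_zero]⟩
      · rintro F G _ _ ⟨y, hy, hyF⟩ ⟨z, hz, hzG⟩
        exact ⟨y + z, add_mem hy hz, by rw [map_add, map_add, hyF, hzG]⟩
      · intro a ha m hm
        obtain ⟨r, rfl⟩ := exists_smul_baseMonomial hn ha
        refine ⟨vec 𝕜 _ v * scal 𝕜 _ (cst 𝕜 (r • baseMonomial 𝕜 n (c - d)) * T m),
          vec_mul_mem_wedgeDeg (baseMonomial_mem hd) (scal_mem_wedgeDeg (cst_mul_T_mem
            (Submodule.smul_mem _ _ (baseMonomial_mem hc)) hm)), ?_⟩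
        have h₀ : kdiff (AlgHom.id 𝕜 _)
            (scal 𝕜 (CoordRing 𝕜 n) (cst 𝕜 (r • baseMonomial 𝕜 n (c - d)) * T m)) = 0 :=
          contr_scal _ _
        rw [koszulD, kdiff_vec_mul, h₀, mul_zero, sub_zero, ← map_mul, AlgHom.id_apply,
          ← mul_assoc, ← map_mul, mul_smul_comm, ← baseMonomial_add hd hc, add_sub_cancel]
    · rintro p x y hx hy hp
      obtain ⟨x', hx', rfl⟩ := hx hp
      obtain ⟨y', hy', rfl⟩ := hy hp
      exact ⟨x' + y', add_mem hx' hy', map_add _ _ _⟩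
    · exact fun p _ _ _ _ _ hp => absurd hp (Nat.succ_ne_zero p)
  | 1 =>
    obtain ⟨F, rfl⟩ := key
    have h₀ : kdiff (AlgHom.id 𝕜 _) (scal 𝕜 (CoordRing 𝕜 n) F) = 0 := contr_scal _ _
    rw [pow_one, koszulD, kdiff_vec_mul, h₀, mul_zero, sub_zero, ← map_mul, AlgHom.id_apply] at hD
    have hF := (mul_eq_zero.1 (scal_injective (hD.trans (map_zero _).symm))).resolve_left fun h =>
      baseMonomial_ne_zero (cst_injective (h.trans (map_zero _).symm))
    exact ⟨0, zero_mem _, by rw [hF, map_zero, map_zero, mul_zero]⟩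
  | p + 2 =>
    obtain ⟨F, rfl⟩ := key
    exact ⟨0, zero_mem _, by
      rw [pow_add, pow_two, vec_mul_self, mul_zero, zero_mul, map_zero]⟩

theorem isDrop_update {j₀ : Fin k} (h : n j₀ ≠ 0) :
    IsDrop n (Function.update n j₀ (n j₀ - 1)) j₀ where
  self := by rw [Function.update_self]; omega
  of_ne j hj := (Function.update_of_ne hj _ _).symm

theorem IsDrop.prod_factorial {n' : Fin k → ℕ} {j₀ : Fin k} (h : IsDrop n n' j₀) :
    ∏ j, (n j).factorial = n j₀ * ∏ j, (n' j).factorial := by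
  rw [← Finset.mul_prod_erase _ _ (Finset.mem_univ j₀),
    ← Finset.mul_prod_erase _ (fun j => (n' j).factorial) (Finset.mem_univ j₀), ← mul_assoc, h.self,
    Nat.factorial_succ]
  congr 1
  exact Finset.prod_congr rfl fun j hj => by rw [h.of_ne j (Finset.ne_of_mem_erase hj)]

theorem IsDrop.sum_eq {n' : Fin k → ℕ} {j₀ : Fin k} (h : IsDrop n n' j₀) :
    ∑ j, n j = ∑ j, n' j + 1 := by
  rw [← Finset.add_sum_erase _ _ (Finset.mem_univ j₀),
    ← Finset.add_sum_erase _ n' (Finset.mem_univ j₀), h.self,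
    Finset.sum_congr rfl fun j hj => h.of_ne j (Finset.ne_of_mem_erase hj),
    add_right_comm]

/-- Asymptotic vanishing of Koszul cohomology on products of projective spaces. -/
theorem koszulVanishing_of_prod_factorial_mul_le {b : Fin k → ℤ} {δ β : ℤ} (hδ : 1 ≤ δ)
    (hd : ∀ j, δ ≤ d j) (hb : ∀ j, β ≤ b j) (hδβ : 0 ≤ δ + β) (q : ℕ)
    (hp : (∏ j, (n j).factorial : ℕ) * (p : ℤ) ≤ δ ^ q * (δ + β)) :
    KoszulVanishing 𝕜 n d p fun j => b j + (q + 2) * d j := by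
  induction hs : ∑ j, n j generalizing n p q with
  | zero =>
    refine koszulVanishing_of_eq_zero (by simpa using hs)
      (fun j => zero_le_one.trans (hδ.trans (hd j))) fun j => ?_
    have h₁ := hd j
    have h₂ := hb j
    have : 0 ≤ (q : ℤ) * d j := by positivity [hδ.trans h₁]
    rw [Pi.sub_apply, Pi.zero_apply]
    linarith
  | succ s ih =>
    obtain ⟨j₀, -, hj₀⟩ : ∃ j ∈ Finset.univ, n j ≠ 0 :=
      Finset.exists_ne_zero_of_sum_ne_zero (by omega)
    have h := isDrop_update hj₀
    set n' := Function.update n j₀ (n j₀ - 1)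
    have hs' : ∑ j, n' j = s := by have := h.sum_eq; omega
    have hN : (1 : ℤ) ≤ (∏ j, (n' j).factorial : ℕ) :=
      mod_cast Finset.prod_pos fun j _ => Nat.factorial_pos _
    have hn : (1 : ℤ) ≤ n j₀ := mod_cast Nat.one_le_iff_ne_zero.2 hj₀
    rw [h.prod_factorial, Nat.cast_mul] at hp
    set N : ℤ := ((∏ j, (n' j).factorial : ℕ) : ℤ)
    have hd₀ := hd j₀
    have hb₀ := hb j₀
    refine koszulVanishing_of_isDrop h (fun i hi => ih q ?_ hs') fun i _ => ?_
    · refine le_trans ?_ hp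
      have : (i : ℤ) ≤ p := mod_cast hi
      nlinarith [mul_le_mul_of_nonneg_left this (zero_le_one.trans hN),
        mul_nonneg (zero_le_one.trans hN) (Int.natCast_nonneg p)]
    · have hi : (0 : ℤ) ≤ i := Int.natCast_nonneg i
      have hid := mul_le_mul_of_nonneg_left hd₀ hi
      have hni := mul_nonneg (zero_le_one.trans hn) hi
      rw [Pi.sub_apply]
      match q with
      | 0 =>
        right
        have hnp := mul_nonneg (zero_le_one.trans hn) (Int.natCast_nonneg p)
        have hidn : 0 ≤ (i : ℤ) * δ := mul_nonneg hi (zero_le_one.trans hδ)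
        have : (n j₀ : ℤ) * p ≤ δ + β := by nlinarith
        push_cast
        linarith
      | q + 1 =>
        by_cases hq : N * i ≤ δ ^ q * (δ + β)
        · left
          convert ih q hq hs' using 1
          ext j
          rw [Pi.sub_apply]
          push_cast
          ring
        · right
          have h₁ : N * (n j₀ * p) < N * (i * δ) := by
            have := mul_lt_mul_of_pos_right (not_le.1 hq) (zero_lt_one.trans_le hδ)
            rw [pow_succ] at hp
            linarith
          have h₂ := lt_of_mul_lt_mul_left h₁ (zero_le_one.trans hN)
          have : 0 ≤ (q : ℤ) * d j₀ := mul_nonneg (Int.natCast_nonneg q) (by linarith)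
          push_cast
          linarith

end Vanishing

section Wedge

variable {𝕜 V A : Type*} [Field 𝕜] [AddCommGroup V] [Module 𝕜 V] [CommRing A] [Algebra 𝕜 A] {p : ℕ}

theorem omitFun_succ {α : Type*} (v : Fin (p + 1) → α) (i : Fin (p + 1)) :
    omitFun v i = i.removeNth v := by
  funext j
  by_cases h : (j : ℕ) < i
  · rw [omitFun, if_pos h, Fin.removeNth_apply, Fin.succAbove_of_castSucc_lt _ _ (Fin.lt_def.2 h)]
    rfl
  · rw [omitFun, if_neg h, Fin.removeNth_apply,
      Fin.succAbove_of_le_castSucc _ _ (Fin.le_def.2 (not_lt.1 h))]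
    rfl

theorem ιMulti_zero_tmul (v : Fin 0 → V) (a : A) :
    ExteriorAlgebra.ιMulti 𝕜 0 v ⊗ₜ[𝕜] a = scal 𝕜 V a := by
  rw [ExteriorAlgebra.ιMulti_zero_apply]; rfl

theorem ιMulti_succ_tmul (v : Fin (p + 1) → V) (a : A) :
    ExteriorAlgebra.ιMulti 𝕜 (p + 1) v ⊗ₜ[𝕜] a =
      vec 𝕜 A (v 0) * ExteriorAlgebra.ιMulti 𝕜 p (Fin.tail v) ⊗ₜ[𝕜] a := by
  rw [ExteriorAlgebra.ιMulti_succ_apply]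
  simp [vec]
  rfl

/-- The explicit form of the Koszul differential. -/
theorem contr_ιMulti_succ_tmul (f : V →ₗ[𝕜] A) (v : Fin (p + 1) → V) (a : A) :
    contr f (ExteriorAlgebra.ιMulti 𝕜 (p + 1) v ⊗ₜ[𝕜] a) =
      ∑ i : Fin (p + 1), ((-1 : 𝕜) ^ (i : ℕ)) •
        (ExteriorAlgebra.ιMulti 𝕜 p (i.removeNth v) ⊗ₜ[𝕜] (f (v i) * a)) := by
  have hs : ∀ {p} (b : A) (u : Fin p → V), scal 𝕜 V b * ExteriorAlgebra.ιMulti 𝕜 p u ⊗ₜ[𝕜] a =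
      ExteriorAlgebra.ιMulti 𝕜 p u ⊗ₜ[𝕜] (b * a) := by
    intro p b u; simp [scal]
  induction p with
  | zero =>
    rw [ιMulti_succ_tmul, contr_vec_mul, ιMulti_zero_tmul, contr_scal, mul_zero, sub_zero,
      ← map_mul, Fin.sum_univ_one, ιMulti_zero_tmul]
    simp
  | succ p ih =>
    rw [ιMulti_succ_tmul, contr_vec_mul, ih, Fin.sum_univ_succ (n := p + 1), hs, Fin.removeNth_zero,
      Fin.val_zero, pow_zero, one_smul, sub_eq_add_neg, Finset.mul_sum, ← Finset.sum_neg_distrib]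
    congr 1
    refine Finset.sum_congr rfl fun i _ => ?_
    have h : Fin.tail (i.succ.removeNth v) = i.removeNth (Fin.tail v) := by
      funext j
      simp [Fin.tail, Fin.removeNth]
    rw [ιMulti_succ_tmul, h, Fin.val_succ, pow_succ, mul_neg_one, neg_smul, mul_smul_comm]
    rfl

theorem wedgeDeg_eq_span {W : Submodule 𝕜 V} {N : Submodule 𝕜 A} :
    wedgeDeg W p N = Submodule.span 𝕜 {x | ∃ u : Fin p → V, (∀ i, u i ∈ W) ∧ ∃ a ∈ N,
      x = ExteriorAlgebra.ιMulti 𝕜 p u ⊗ₜ[𝕜] a} := by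
  refine le_antisymm (fun x hx => ?_) (Submodule.span_le.2 ?_)
  · refine wedgeDeg_induction (motive := fun p x => x ∈ Submodule.span 𝕜 {x | ∃ u : Fin p → V,
      (∀ i, u i ∈ W) ∧ ∃ a ∈ N, x = ExteriorAlgebra.ιMulti 𝕜 p u ⊗ₜ[𝕜] a}) ?_ ?_ ?_ hx
    · exact fun a ha => Submodule.subset_span
        ⟨Fin.elim0, fun i => i.elim0, a, ha, (ιMulti_zero_tmul _ a).symm⟩
    · exact fun p x y => add_mem
    · intro p v hv x _ hx
      refine (Submodule.span_le.2 ?_ : _ ≤ (Submodule.span 𝕜 {x | ∃ u : Fin (p + 1) → V,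
        (∀ i, u i ∈ W) ∧ ∃ a ∈ N, x = ExteriorAlgebra.ιMulti 𝕜 (p + 1) u ⊗ₜ[𝕜] a}).comap
          (LinearMap.mulLeft 𝕜 (vec 𝕜 A v))) hx
      rintro _ ⟨u, hu, a, ha, rfl⟩
      refine Submodule.subset_span ⟨Fin.cons v u, Fin.cases hv hu, a, ha, ?_⟩
      rw [ιMulti_succ_tmul, Fin.cons_zero, Fin.tail_cons, LinearMap.mulLeft_apply]
  · rintro _ ⟨u, hu, a, ha, rfl⟩
    induction p with
    | zero => rw [ιMulti_zero_tmul]; exact scal_mem_wedgeDeg ha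
    | succ p ih =>
      rw [ιMulti_succ_tmul]
      exact vec_mul_mem_wedgeDeg (hu 0) (ih (Fin.tail u) fun i => hu i.succ)

end Wedge

section Comparison

open LaurentPolynomial (T)
open scoped LaurentPolynomial

variable {k : ℕ} (𝕜 : Type*) [Field 𝕜] (n : Fin k → ℕ) (d : Fin k → ℤ) (p : ℕ) (c : Fin k → ℤ)

/-- The inclusion of a term of a Koszul complex into the Koszul algebra. -/
def koszulIncl : (⋀[𝕜]^p (comp 𝕜 n d)) ⊗[𝕜] comp 𝕜 n c →ₗ[𝕜]
    Kos 𝕜 (CoordRing 𝕜 n) (CoordRing 𝕜 n) :=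
  TensorProduct.map ((ExteriorAlgebra.map (comp 𝕜 n d).subtype).toLinearMap ∘ₗ
    (⋀[𝕜]^p (comp 𝕜 n d)).subtype) ((cst 𝕜).toLinearMap ∘ₗ (comp 𝕜 n c).subtype)

variable {𝕜 n d p c}

theorem koszulIncl_wedge_tmul (v : Fin p → comp 𝕜 n d) (f : comp 𝕜 n c) :
    koszulIncl 𝕜 n d p c (wedge 𝕜 p v ⊗ₜ f) =
      ExteriorAlgebra.ιMulti 𝕜 p (fun i => (v i : CoordRing 𝕜 n)) ⊗ₜ cst 𝕜 (f : CoordRing 𝕜 n) := by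
  rw [koszulIncl, TensorProduct.map_tmul]
  congr 1
  exact ExteriorAlgebra.map_apply_ιMulti _ v

theorem koszulIncl_injective : Function.Injective (koszulIncl 𝕜 n d p c) := by
  refine TensorProduct.map_injective_of_flat_flat _ _ ?_ ?_
  · rw [LinearMap.coe_comp]
    refine Function.Injective.comp ?_ (Submodule.subtype_injective _)
    exact ExteriorAlgebra.map_injective_field (Submodule.ker_subtype _)
  · rw [LinearMap.coe_comp]
    exact (cst_injective (𝕜 := 𝕜)).comp (Submodule.subtype_injective _)

theorem span_wedge_tmul : Submodule.span 𝕜 {x | ∃ (v : Fin p → comp 𝕜 n d) (f : comp 𝕜 n c),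
    x = wedge 𝕜 p v ⊗ₜ[𝕜] f} = ⊤ := by
  refine eq_top_iff.2 fun x _ => ?_
  induction x with
  | zero => exact zero_mem _
  | add x y hx hy => exact add_mem (hx trivial) (hy trivial)
  | tmul x f =>
    have hx : x ∈ Submodule.span 𝕜 (Set.range (exteriorPower.ιMulti 𝕜 p (M := comp 𝕜 n d))) := by
      rw [exteriorPower.ιMulti_span]; trivial
    induction hx using Submodule.span_induction with
    | mem x hx =>
      obtain ⟨v, rfl⟩ := hx
      exact Submodule.subset_span ⟨v, f, rfl⟩
    | zero => rw [TensorProduct.zero_tmul]; exact zero_mem _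
    | add x y _ _ hx hy => rw [TensorProduct.add_tmul]; exact add_mem (hx trivial) (hy trivial)
    | smul a x _ hx => rw [← TensorProduct.smul_tmul']; exact Submodule.smul_mem _ _ (hx trivial)

theorem range_koszulIncl : LinearMap.range (koszulIncl 𝕜 n d p c) = mgr 𝕜 n n d p c {0} := by
  refine le_antisymm ?_ ?_
  · rw [LinearMap.range_eq_map, ← span_wedge_tmul, Submodule.map_span_le]
    rintro _ ⟨v, f, rfl⟩
    rw [koszulIncl_wedge_tmul]
    exact wedgeDeg_eq_span.ge (Submodule.subset_span
      ⟨_, fun i => (v i).2, _, cst_mem_laurentSub f.2 rfl, rfl⟩)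
  · refine wedgeDeg_eq_span.le.trans (Submodule.span_le.2 ?_)
    rintro _ ⟨u, hu, F, hF, rfl⟩
    obtain ⟨a, ha, rfl⟩ : ∃ a ∈ comp 𝕜 n c, cst 𝕜 a = F := by
      refine laurentSub_induction (motive := fun F => ∃ a ∈ comp 𝕜 n c, cst 𝕜 a = F)
        ⟨0, zero_mem _, map_zero _⟩ ?_ ?_ hF
      · rintro _ _ _ _ ⟨a, ha, rfl⟩ ⟨b, hb, rfl⟩
        exact ⟨a + b, add_mem ha hb, map_add _ _ _⟩
      · rintro a ha _ rfl
        exact ⟨a, ha, by rw [LaurentPolynomial.T_zero, mul_one]⟩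
    exact ⟨wedge 𝕜 p (fun i => ⟨u i, hu i⟩) ⊗ₜ ⟨a, ha⟩, koszulIncl_wedge_tmul _ _⟩

/-- The inclusion into the Koszul algebra is compatible with the differentials. -/
theorem koszulIncl_apply {c' : Fin k → ℤ} (h : d + c = c')
    {δ : (⋀[𝕜]^p (comp 𝕜 n d)) ⊗[𝕜] comp 𝕜 n c →ₗ[𝕜]
      (⋀[𝕜]^(p - 1) (comp 𝕜 n d)) ⊗[𝕜] comp 𝕜 n c'}
    (hδ : ∀ (v : Fin p → comp 𝕜 n d) (f : comp 𝕜 n c), δ (wedge 𝕜 p v ⊗ₜ[𝕜] f) =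
      ∑ i : Fin p, ((-1 : 𝕜) ^ (i : ℕ)) •
        (wedge 𝕜 (p - 1) (omitFun v i) ⊗ₜ[𝕜] componentMul 𝕜 _ h (v i) f)) (x) :
    koszulIncl 𝕜 n d (p - 1) c' (δ x) = koszulD 𝕜 n (koszulIncl 𝕜 n d p c x) := by
  suffices H : koszulIncl 𝕜 n d (p - 1) c' ∘ₗ δ = koszulD 𝕜 n ∘ₗ koszulIncl 𝕜 n d p c from
    LinearMap.congr_fun H x
  refine LinearMap.ext_on span_wedge_tmul ?_
  rintro _ ⟨v, f, rfl⟩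
  change koszulIncl 𝕜 n d (p - 1) c' (δ (wedge 𝕜 p v ⊗ₜ f)) =
    koszulD 𝕜 n (koszulIncl 𝕜 n d p c (wedge 𝕜 p v ⊗ₜ f))
  rw [hδ, koszulIncl_wedge_tmul, map_sum]
  cases p with
  | zero =>
    rw [Finset.univ_eq_empty, Finset.sum_empty, ιMulti_zero_tmul]
    exact (contr_scal _ _).symm
  | succ p =>
    refine Eq.trans (Finset.sum_congr rfl fun i _ => ?_) (contr_ιMulti_succ_tmul _ _ _).symm
    rw [map_smul, koszulIncl_wedge_tmul, omitFun_succ]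
    congr 2
    exact map_mul (cst 𝕜) _ _

theorem range_eq_ker_of_koszulVanishing {c₁ c₃ : Fin k → ℤ} (h₁ : d + c₁ = c) (h₂ : d + c = c₃)
    {δ₁ : (⋀[𝕜]^(p + 1) (comp 𝕜 n d)) ⊗[𝕜] comp 𝕜 n c₁ →ₗ[𝕜]
      (⋀[𝕜]^p (comp 𝕜 n d)) ⊗[𝕜] comp 𝕜 n c}
    (hδ₁ : ∀ (v : Fin (p + 1) → comp 𝕜 n d) (f : comp 𝕜 n c₁), δ₁ (wedge 𝕜 (p + 1) v ⊗ₜ[𝕜] f) =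
      ∑ i : Fin (p + 1), ((-1 : 𝕜) ^ (i : ℕ)) •
        (wedge 𝕜 p (omitFun v i) ⊗ₜ[𝕜] componentMul 𝕜 _ h₁ (v i) f))
    {δ₂ : (⋀[𝕜]^p (comp 𝕜 n d)) ⊗[𝕜] comp 𝕜 n c →ₗ[𝕜]
      (⋀[𝕜]^(p - 1) (comp 𝕜 n d)) ⊗[𝕜] comp 𝕜 n c₃}
    (hδ₂ : ∀ (v : Fin p → comp 𝕜 n d) (f : comp 𝕜 n c), δ₂ (wedge 𝕜 p v ⊗ₜ[𝕜] f) =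
      ∑ i : Fin p, ((-1 : 𝕜) ^ (i : ℕ)) •
        (wedge 𝕜 (p - 1) (omitFun v i) ⊗ₜ[𝕜] componentMul 𝕜 _ h₂ (v i) f))
    (hV : KoszulVanishing 𝕜 n d p c) : LinearMap.range δ₁ = LinearMap.ker δ₂ := by
  have e₁ : ∀ x, koszulIncl 𝕜 n d p c (δ₁ x) = koszulD 𝕜 n (koszulIncl 𝕜 n d (p + 1) c₁ x) :=
    koszulIncl_apply h₁ hδ₁
  have e₂ := koszulIncl_apply h₂ hδ₂
  ext x
  rw [LinearMap.mem_ker]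
  refine ⟨?_, fun hx => ?_⟩
  · rintro ⟨y, rfl⟩
    apply koszulIncl_injective
    rw [e₂, e₁, map_zero]
    exact kdiff_kdiff _ _
  · obtain ⟨z, hz, hzx⟩ := hV {0} (koszulIncl 𝕜 n d p c x)
      (range_koszulIncl.le (LinearMap.mem_range_self _ x)) (by rw [← e₂, hx, map_zero])
    obtain rfl : c₁ = c - d := eq_sub_of_add_eq' h₁
    rw [← range_koszulIncl] at hz
    obtain ⟨y, rfl⟩ := hz
    exact ⟨y, koszulIncl_injective ((e₁ y).trans hzx)⟩

end Comparison

/-- **Asymptotic vanishing of syzygies for products of projective spaces.**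
Let `𝕜` be an algebraically closed field, `k ≥ 1`, `n_1, …, n_k, d_1, …, d_k` positive
integers and `b_1, …, b_k` integers, `b = min b_j`, `d = min d_j`, `d + b ≥ 0`.  Then for
`2 ≤ q ≤ n_1 + ⋯ + n_k + 1` and `0 ≤ p` with `n_1!⋯n_k!·p ≤ d^{q-1} + b·d^{q-2}`, the
Koszul cohomology group `K_{p,q}(X, B; L)` vanishes, i.e. the Koszul-type complex
`⋀^{p+1}V ⊗ R_{q-1} → ⋀^{p}V ⊗ R_q → ⋀^{p-1}V ⊗ R_{q+1}` is exact at the middle term,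
where `V = T_{(d_1,…,d_k)}` and `R_m = T_{(b_1+m d_1, …, b_k+m d_k)}` are multihomogeneous
components of the `ℤ^k`-graded polynomial ring `T` in variables `x^{(j)}_0, …, x^{(j)}_{n_j}`. -/
theorem asymptotic_vanishing_syzygies_prod_proj_spaces
    (𝕜 : Type*) [Field 𝕜] [IsAlgClosed 𝕜]
    (k : ℕ) (hk : 1 ≤ k) (n : Fin k → ℕ) (hn : ∀ j, 1 ≤ n j)
    (d b : Fin k → ℤ) (hd : ∀ j, 1 ≤ d j)
    (dmin bmin : ℤ)
    (hdmin : IsLeast (Set.range d) dmin) (hbmin : IsLeast (Set.range b) bmin)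
    (hdb : 0 ≤ dmin + bmin)
    (q : ℕ) (hq2 : 2 ≤ q) (hqtop : q ≤ (∑ j, n j) + 1)
    (p : ℕ)
    (hp : (∏ j, ((n j).factorial : ℤ)) * (p : ℤ) ≤ dmin ^ (q - 1) + bmin * dmin ^ (q - 2))
    -- the weight function giving the `ℤ^k`-multigrading of `T`
    (w : ((j : Fin k) × Fin (n j + 1)) → (Fin k → ℤ))
    (hw : ∀ x, w x = Pi.single x.1 1)
    -- the Koszul differential `δ_{p+1,q-1} : ⋀^{p+1} V ⊗ R_{q-1} → ⋀^p V ⊗ R_q`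
    (δ₁ : ((⋀[𝕜]^(p + 1) (component 𝕜 w fun j => d j)) ⊗[𝕜]
        (component 𝕜 w fun j => b j + ((q : ℤ) - 1) * d j)) →ₗ[𝕜]
        ((⋀[𝕜]^p (component 𝕜 w fun j => d j)) ⊗[𝕜]
        (component 𝕜 w fun j => b j + (q : ℤ) * d j)))
    (hδ₁ : ∀ (v : Fin (p + 1) → (component 𝕜 w fun j => d j))
        (f : component 𝕜 w fun j => b j + ((q : ℤ) - 1) * d j),
        δ₁ (wedge 𝕜 (p + 1) v ⊗ₜ[𝕜] f) =
          ∑ i : Fin (p + 1), ((-1 : 𝕜) ^ (i : ℕ)) •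
            (wedge 𝕜 p (omitFun v i) ⊗ₜ[𝕜]
              componentMul 𝕜 w (by funext j; simp only [Pi.add_apply]; ring) (v i) f))
    -- the Koszul differential `δ_{p,q} : ⋀^{p} V ⊗ R_q → ⋀^{p-1} V ⊗ R_{q+1}`
    (δ₂ : ((⋀[𝕜]^p (component 𝕜 w fun j => d j)) ⊗[𝕜]
        (component 𝕜 w fun j => b j + (q : ℤ) * d j)) →ₗ[𝕜]
        ((⋀[𝕜]^(p - 1) (component 𝕜 w fun j => d j)) ⊗[𝕜]
        (component 𝕜 w fun j => b j + ((q : ℤ) + 1) * d j)))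
    (hδ₂ : ∀ (v : Fin p → (component 𝕜 w fun j => d j))
        (f : component 𝕜 w fun j => b j + (q : ℤ) * d j),
        δ₂ (wedge 𝕜 p v ⊗ₜ[𝕜] f) =
          ∑ i : Fin p, ((-1 : 𝕜) ^ (i : ℕ)) •
            (wedge 𝕜 (p - 1) (omitFun v i) ⊗ₜ[𝕜]
              componentMul 𝕜 w (by funext j; simp only [Pi.add_apply]; ring) (v i) f)) :
    LinearMap.range δ₁ = LinearMap.ker δ₂ := by
  obtain rfl : w = fun x => Pi.single x.1 1 := funext hw
  refine range_eq_ker_of_koszulVanishing _ _ hδ₁ hδ₂ ?_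
  obtain ⟨q, rfl⟩ := Nat.exists_eq_add_of_le' hq2
  obtain ⟨j, hj⟩ := hdmin.1
  convert koszulVanishing_of_prod_factorial_mul_le (n := n) (d := d) (p := p) (b := b)
    (δ := dmin) (β := bmin) (hj ▸ hd j) (fun j => hdmin.2 ⟨j, rfl⟩) (fun j => hbmin.2 ⟨j, rfl⟩) hdb q ?_
    using 1
  · push_cast
    rfl
  · rw [Nat.cast_prod]
    refine hp.trans_eq ?_
    rw [show q + 2 - 1 = q + 1 by omega, Nat.add_sub_cancel]
    ring

end
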